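/- arXiv:1906.07600 — 3 statements merged into one kernel-verified Lean document; each statement's English description precedes it below -/
import Mathlib

section
/- Let f, g : 2^ω → ℝ be Baire 1 functions, neither of which is continuous. Then f ≤_tt g if and only if |f|_α ≲ |g|_α. -/
/-- Cantor space `2^ω`. -/
abbrev Cantor : Type := ℕ → Bool

/-- A bit `b` is a correct answer to the question `f A ≲_ε p`. -/
def CorrectAnswer (f : Cantor → ℝ) (A : Cantor) (p ε : ℚ) (b : Bool) : Prop :=
  (b = true ∧ f A < (p : ℝ) + (ε : ℝ)) ∨ (b = false ∧ (p : ℝ) - (ε : ℝ) < f A)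

/-- Topological m-reducibility `f ≤_m g`. -/
def MReducible (f g : Cantor → ℝ) : Prop :=
  ∀ p ε : ℚ, 0 < ε → ∃ q δ : ℚ, 0 < δ ∧ ∃ k : Cantor → Cantor, Continuous k ∧
    ∀ A b, CorrectAnswer g (k A) q δ b → CorrectAnswer f A p ε b

/-- `f` is Baire class 1: a pointwise limit of continuous functions. -/
def BaireOne (f : Cantor → ℝ) : Prop :=
  ∃ F : ℕ → Cantor → ℝ, (∀ n, Continuous (F n)) ∧
    ∀ A, Filter.Tendsto (fun n => F n A) Filter.atTop (nhds (f A))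

/-- The Bourgain derivation sequence `P^ν_{f,p,ε}`. -/
noncomputable def derivSeq (f : Cantor → ℝ) (p ε : ℚ) (ν : Ordinal.{0}) : Set Cantor :=
  Ordinal.limitRecOn ν Set.univ
    (fun _ P => P \ ⋃₀ {U : Set Cantor | IsOpen U ∧
        (f '' (P ∩ U) ⊆ Set.Iio ((p : ℝ) + (ε : ℝ)) ∨
         f '' (P ∩ U) ⊆ Set.Ioi ((p : ℝ) - (ε : ℝ)))})
    (fun o _ ih => ⋂ (μ : {μ : Ordinal.{0} // μ < o}), ih μ.1 μ.2)

/-- `α(f,p,ε)`: the least ordinal `ν` with `P^ν_{f,p,ε} = ∅`. -/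
noncomputable def bAlpha (f : Cantor → ℝ) (p ε : ℚ) : Ordinal.{0} :=
  sInf {ν | derivSeq f p ε ν = ∅}

/-- The Bourgain rank `|f|_α`. -/
noncomputable def bourgainRank (f : Cantor → ℝ) : Ordinal.{0} :=
  ⨆ x : ℚ × {ε : ℚ // 0 < ε}, bAlpha f x.1 x.2.1

/-- The coarsening `α ≲ β` of the ordinal order: for every `γ < α` there are `δ < β`
and `n ∈ ℕ` with `γ < δ·n`. -/
def OrdLesssim (a b : Ordinal) : Prop :=
  ∀ γ < a, ∃ δ < b, ∃ n : ℕ, γ < δ * (n : Ordinal)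

/-- Topological truth-table reducibility `f ≤_tt g`. -/
def TTReducible (f g : Cantor → ℝ) : Prop :=
  ∀ p ε : ℚ, 0 < ε → ∃ (r : ℕ) (q δ : Fin r → ℚ) (k : Fin r → Cantor → Cantor)
    (h : (Fin r → Bool) → Bool),
    (∀ i, 0 < δ i) ∧ (∀ i, Continuous (k i)) ∧
    ∀ (A : Cantor) (σ : Fin r → Bool),
      (∀ i, CorrectAnswer g (k i A) (q i) (δ i) (σ i)) → CorrectAnswer f A p ε (h σ)

open Set Filter PiNat

/-! ### Bourgain derivatives -/

lemma derivSeq_zero (f : Cantor → ℝ) (p ε : ℚ) : derivSeq f p ε 0 = univ :=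
  Ordinal.limitRecOn_zero ..

lemma derivSeq_limit (f : Cantor → ℝ) (p ε : ℚ) {o : Ordinal.{0}} (ho : Order.IsSuccLimit o) :
    derivSeq f p ε o = ⋂ μ : {μ : Ordinal.{0} // μ < o}, derivSeq f p ε μ.1 :=
  Ordinal.limitRecOn_limit _ _ _ _ ho

lemma mem_derivSeq_add_one {f : Cantor → ℝ} {p ε : ℚ} {ν : Ordinal.{0}} {A : Cantor} :
    A ∈ derivSeq f p ε (ν + 1) ↔ A ∈ derivSeq f p ε ν ∧ ∀ U, IsOpen U → A ∈ U → ∀ b,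
      ∃ B ∈ derivSeq f p ε ν ∩ U, ¬ CorrectAnswer f B p ε b := by
  have h : derivSeq f p ε (ν + 1) = derivSeq f p ε ν \ ⋃₀ {U : Set Cantor | IsOpen U ∧
      (f '' (derivSeq f p ε ν ∩ U) ⊆ Iio ((p : ℝ) + (ε : ℝ)) ∨
        f '' (derivSeq f p ε ν ∩ U) ⊆ Ioi ((p : ℝ) - (ε : ℝ)))} :=
    Ordinal.limitRecOn_add_one ..
  rw [h]
  refine and_congr_right fun _ => ?_
  simp only [mem_sUnion, mem_ofPred_eq, not_exists, not_and, image_subset_iff, CorrectAnswer]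
  constructor
  · intro H U hU hA b
    by_contra! hb
    refine H U ⟨hU, ?_⟩ hA
    cases b
    · exact Or.inr fun B hB => by simpa using hb B hB
    · exact Or.inl fun B hB => by simpa using hb B hB
  · rintro H U ⟨hU, hb | hb⟩ hA
    · obtain ⟨B, hB, h'⟩ := H U hU hA true
      exact h' (Or.inl ⟨rfl, hb hB⟩)
    · obtain ⟨B, hB, h'⟩ := H U hU hA false
      exact h' (Or.inr ⟨rfl, hb hB⟩)

lemma exists_nhd_of_notMem_derivSeq_add_one {f : Cantor → ℝ} {p ε : ℚ} {ν : Ordinal.{0}}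
    {A : Cantor} (hA : A ∈ derivSeq f p ε ν) (hA' : A ∉ derivSeq f p ε (ν + 1)) :
    ∃ U, IsOpen U ∧ A ∈ U ∧ ∃ b, ∀ B ∈ derivSeq f p ε ν ∩ U, CorrectAnswer f B p ε b := by
  by_contra! h
  exact hA' (mem_derivSeq_add_one.2 ⟨hA, h⟩)

lemma derivSeq_antitone (f : Cantor → ℝ) (p ε : ℚ) : Antitone (derivSeq f p ε) := by
  intro a b hab
  induction b using Ordinal.limitRecOn with
  | zero => rw [nonpos_iff_eq_zero.1 hab]
  | add_one b ih =>
    rcases hab.eq_or_lt with rfl | h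
    · exact le_rfl
    · exact fun A hA => ih (Order.lt_add_one_iff.1 h) (mem_derivSeq_add_one.1 hA).1
  | limit b hb ih =>
    rcases hab.eq_or_lt with rfl | h
    · exact le_rfl
    · rw [derivSeq_limit f p ε hb]
      exact iInter_subset (fun μ : {μ : Ordinal.{0} // μ < b} => derivSeq f p ε μ.1) ⟨a, h⟩

lemma isClosed_derivSeq (f : Cantor → ℝ) (p ε : ℚ) (ν : Ordinal.{0}) :
    IsClosed (derivSeq f p ε ν) := by
  induction ν using Ordinal.limitRecOn with
  | zero => rw [derivSeq_zero]; exact isClosed_univ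
  | add_one ν ih =>
    rw [← isOpen_compl_iff, isOpen_iff_forall_mem_open]
    intro A hA
    by_cases h : A ∈ derivSeq f p ε ν
    · obtain ⟨U, hU, hAU, b, hb⟩ := exists_nhd_of_notMem_derivSeq_add_one h hA
      refine ⟨U, fun C hC hC' => ?_, hU, hAU⟩
      obtain ⟨B, hB, hB'⟩ := (mem_derivSeq_add_one.1 hC').2 U hU hC b
      exact hB' (hb B hB)
    · exact ⟨_, fun _ hC hC' => absurd (mem_derivSeq_add_one.1 hC').1 hC, ih.isOpen_compl, h⟩
  | limit ν hν ih =>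
    rw [derivSeq_limit f p ε hν]
    exact isClosed_iInter fun μ => ih μ.1 μ.2

/-- A point that leaves the derivation sequence does so at a successor stage. -/
lemma exists_mem_derivSeq_notMem_add_one {f : Cantor → ℝ} {p ε : ℚ} {κ : Ordinal.{0}}
    {A : Cantor} (hA : A ∉ derivSeq f p ε κ) :
    ∃ ρ < κ, A ∈ derivSeq f p ε ρ ∧ A ∉ derivSeq f p ε (ρ + 1) := by
  induction κ using Ordinal.limitRecOn with
  | zero => simp [derivSeq_zero] at hA
  | add_one κ ih =>
    by_cases h : A ∈ derivSeq f p ε κ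
    · exact ⟨κ, Order.lt_add_one_iff.2 le_rfl, h, hA⟩
    · obtain ⟨ρ, hρ, h'⟩ := ih h
      exact ⟨ρ, hρ.trans (Order.lt_add_one_iff.2 le_rfl), h'⟩
  | limit κ hκ ih =>
    rw [derivSeq_limit f p ε hκ, mem_iInter] at hA
    push Not at hA
    obtain ⟨⟨μ, hμ⟩, hA⟩ := hA
    obtain ⟨ρ, hρ, hmem⟩ := ih μ hμ hA
    exact ⟨ρ, hρ.trans hμ, hmem⟩

/-- By compactness the derivation sequence vanishes first at a successor stage. -/
lemma exists_add_one_of_derivSeq_eq_empty {f : Cantor → ℝ} {p ε : ℚ} {κ : Ordinal.{0}}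
    (hκ : derivSeq f p ε κ = ∅) : ∃ ν < κ, derivSeq f p ε (ν + 1) = ∅ := by
  induction κ using Ordinal.limitRecOn with
  | zero => simp [derivSeq_zero] at hκ
  | add_one κ ih => exact ⟨κ, Order.lt_add_one_iff.2 le_rfl, hκ⟩
  | limit κ hl ih =>
    by_cases h : ∃ μ < κ, derivSeq f p ε μ = ∅
    · obtain ⟨μ, hμ, h⟩ := h
      obtain ⟨ν, hν, h'⟩ := ih μ hμ h
      exact ⟨ν, hν.trans hμ, h'⟩
    · push Not at h
      rw [derivSeq_limit f p ε hl] at hκ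
      have : Nonempty {μ : Ordinal.{0} // μ < κ} := ⟨0, hl.bot_lt⟩
      have := IsCompact.nonempty_iInter_of_directed_nonempty_isCompact_isClosed
        (fun μ : {μ : Ordinal.{0} // μ < κ} => derivSeq f p ε μ.1)
        (directed_of_isDirected_le fun a b hab => derivSeq_antitone f p ε hab)
        (fun μ => h μ.1 μ.2)
        (fun μ => (isClosed_derivSeq f p ε μ.1).isCompact)
        (fun μ => isClosed_derivSeq f p ε μ.1)
      exact absurd hκ this.ne_empty

lemma BaireOne.exists_open_forall_correctAnswer {f : Cantor → ℝ} (hf : BaireOne f) (p : ℚ)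
    {ε : ℚ} (hε : 0 < ε) {P : Set Cantor} (hP : IsClosed P) (hne : P.Nonempty) :
    ∃ U, IsOpen U ∧ (P ∩ U).Nonempty ∧ ∃ b, ∀ B ∈ P ∩ U, CorrectAnswer f B p ε b := by
  obtain ⟨F, hF, hlim⟩ := hf
  have hε' : (0 : ℝ) < ε := by exact_mod_cast hε
  have : CompactSpace P := isCompact_iff_compactSpace.1 hP.isCompact
  have : Nonempty P := hne.to_subtype
  let C : ℕ × Bool → Set P := fun x =>
    {A | ∀ n ≥ x.1, if x.2 then F n A.1 ≤ p else (p : ℝ) - ε / 2 ≤ F n A.1}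
  have hC : ∀ x, IsClosed (C x) := by
    rintro ⟨N, b⟩
    simp only [C, ofPred_forall]
    refine isClosed_iInter fun n => isClosed_iInter fun _ => ?_
    have hFn : Continuous fun A : P => F n A.1 := (hF n).comp continuous_subtype_val
    cases b
    · exact isClosed_le continuous_const hFn
    · exact isClosed_le hFn continuous_const
  have hU : ⋃ x, C x = univ := by
    refine eq_univ_of_forall fun A => mem_iUnion.2 ?_
    rcases lt_or_ge (f A.1) p with h | h
    · obtain ⟨N, hN⟩ := eventually_atTop.1 ((hlim A.1).eventually_lt_const h)
      exact ⟨(N, true), fun n hn => by simpa using (hN n hn).le⟩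
    · obtain ⟨N, hN⟩ := eventually_atTop.1
        ((hlim A.1).eventually_const_lt (show (p : ℝ) - ε / 2 < f A.1 by linarith))
      exact ⟨(N, false), fun n hn => by simpa using (hN n hn).le⟩
  obtain ⟨⟨N, b⟩, A, hA⟩ := nonempty_interior_of_iUnion_of_closed hC hU
  obtain ⟨U, hUo, hUeq⟩ := isOpen_induced_iff.1 (isOpen_interior (s := C (N, b)))
  refine ⟨U, hUo, ⟨A.1, A.2, ?_⟩, b, fun B hB => ?_⟩
  · have : A ∈ Subtype.val ⁻¹' U := hUeq ▸ hA
    exact this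
  · have hB' : (⟨B, hB.1⟩ : P) ∈ interior (C (N, b)) := by
      rw [← hUeq]; exact hB.2
    have hBC : ∀ n ≥ N, if b then F n B ≤ p else (p : ℝ) - ε / 2 ≤ F n B := interior_subset hB'
    cases b
    · have := ge_of_tendsto (hlim B) (eventually_atTop.2 ⟨N, hBC⟩)
      exact Or.inr ⟨rfl, by linarith⟩
    · have := le_of_tendsto (hlim B) (eventually_atTop.2 ⟨N, hBC⟩)
      exact Or.inl ⟨rfl, by linarith⟩

lemma BaireOne.exists_derivSeq_eq_empty {f : Cantor → ℝ} (hf : BaireOne f) (p : ℚ) {ε : ℚ}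
    (hε : 0 < ε) : ∃ ν, derivSeq f p ε ν = ∅ := by
  by_contra! h
  refine not_injective_of_ordinal (derivSeq f p ε) (StrictAnti.injective ?_)
  intro a b hab
  refine lt_of_le_of_lt (derivSeq_antitone f p ε (Order.add_one_le_of_lt hab))
    ⟨derivSeq_antitone f p ε (Order.lt_add_one_iff.2 le_rfl).le, fun hsub => ?_⟩
  obtain ⟨U, hU, ⟨A, hA, hAU⟩, b, hb⟩ :=
    hf.exists_open_forall_correctAnswer p hε (isClosed_derivSeq f p ε a) (h a)
  obtain ⟨B, hB, hB'⟩ := (mem_derivSeq_add_one.1 (hsub hA)).2 U hU hAU b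
  exact hB' (hb B hB)

lemma BaireOne.derivSeq_bAlpha {f : Cantor → ℝ} (hf : BaireOne f) (p : ℚ) {ε : ℚ}
    (hε : 0 < ε) : derivSeq f p ε (bAlpha f p ε) = ∅ :=
  csInf_mem (s := {ν | derivSeq f p ε ν = ∅}) (hf.exists_derivSeq_eq_empty p hε)

lemma derivSeq_nonempty_of_lt_bAlpha {f : Cantor → ℝ} {p ε : ℚ} {ν : Ordinal.{0}}
    (h : ν < bAlpha f p ε) : (derivSeq f p ε ν).Nonempty :=
  nonempty_iff_ne_empty.2 fun he => notMem_of_lt_csInf' h he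

lemma BaireOne.lt_bAlpha {f : Cantor → ℝ} (hf : BaireOne f) {p ε : ℚ} (hε : 0 < ε)
    {ν : Ordinal.{0}} (h : (derivSeq f p ε ν).Nonempty) : ν < bAlpha f p ε := by
  by_contra! hle
  have := h.mono (derivSeq_antitone f p ε hle)
  rw [hf.derivSeq_bAlpha p hε] at this
  exact not_nonempty_empty this

lemma bAlpha_le_bourgainRank (f : Cantor → ℝ) (p : ℚ) {ε : ℚ} (hε : 0 < ε) :
    bAlpha f p ε ≤ bourgainRank f :=
  Ordinal.le_iSup (fun x : ℚ × {ε : ℚ // 0 < ε} => bAlpha f x.1 x.2.1) (p, ⟨ε, hε⟩)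

lemma exists_lt_bAlpha_of_lt_bourgainRank {f : Cantor → ℝ} {ν : Ordinal.{0}}
    (h : ν < bourgainRank f) : ∃ p ε : ℚ, 0 < ε ∧ ν < bAlpha f p ε := by
  obtain ⟨⟨p, ε, hε⟩, h⟩ := Ordinal.lt_iSup_iff.1 h
  exact ⟨p, ε, hε, h⟩

/-! ### Discontinuity -/

/-- Near a discontinuity, one and the same question has forced but opposite answers. -/
lemma exists_forced_of_not_continuous {g : Cantor → ℝ} (hg : ¬ Continuous g) :
    ∃ (q η : ℚ) (Y : Cantor) (X : ℕ → Cantor) (b : Bool), 0 < η ∧ (∀ m, X m ∈ cylinder Y m) ∧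
      ¬ CorrectAnswer g Y q η b ∧ ∀ m, ¬ CorrectAnswer g (X m) q η (!b) := by
  obtain ⟨Y, hY⟩ : ∃ Y, ¬ ContinuousAt g Y := by
    by_contra! h
    exact hg (continuous_iff_continuousAt.2 h)
  obtain ⟨c, hc, hcf⟩ : ∃ c > 0, ∀ m, ∃ X ∈ cylinder Y m, c ≤ |g X - g Y| := by
    by_contra! h
    refine hY (Metric.tendsto_nhds.2 fun c hc => ?_)
    obtain ⟨m, hm⟩ := h c hc
    filter_upwards [(isOpen_cylinder (fun _ => Bool) Y m).mem_nhds (self_mem_cylinder Y m)]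
      with X hX using by rw [Real.dist_eq]; exact hm X hX
  have hside : (∀ m, ∃ X ∈ cylinder Y m, g Y + c ≤ g X) ∨
      ∀ m, ∃ X ∈ cylinder Y m, g X ≤ g Y - c := by
    by_contra! h
    obtain ⟨⟨m, hm⟩, n, hn⟩ := h
    obtain ⟨X, hX, hXc⟩ := hcf (max m n)
    have h1 := hm X (cylinder_anti Y (le_max_left m n) hX)
    have h2 := hn X (cylinder_anti Y (le_max_right m n) hX)
    exact absurd (abs_lt.2 ⟨by linarith, by linarith⟩) (not_lt.2 hXc)
  obtain ⟨η, hη0, hη⟩ := exists_rat_btwn (show (0 : ℝ) < c / 3 by linarith)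
  have hη0' : 0 < η := by exact_mod_cast hη0
  rcases hside with h | h <;> choose X hX hXc using h
  · obtain ⟨q, hq1, hq2⟩ := exists_rat_btwn (show g Y + c / 3 < g Y + 2 * c / 3 by linarith)
    refine ⟨q, η, Y, X, false, hη0', hX, ?_, fun m => ?_⟩
    · simp only [CorrectAnswer]; simp; linarith
    · have := hXc m
      simp only [CorrectAnswer]; simp; linarith
  · obtain ⟨q, hq1, hq2⟩ := exists_rat_btwn (show g Y - 2 * c / 3 < g Y - c / 3 by linarith)
    refine ⟨q, η, Y, X, true, hη0', hX, ?_, fun m => ?_⟩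
    · simp only [CorrectAnswer]; simp; linarith
    · have := hXc m
      simp only [CorrectAnswer]; simp; linarith

lemma exists_cylinder_subset {U : Set Cantor} (hU : IsOpen U) {A : Cantor} (hA : A ∈ U) :
    ∃ m, cylinder A m ⊆ U := by
  obtain ⟨V, ⟨Z, m, rfl⟩, hV, hVU⟩ :=
    (isTopologicalBasis_cylinders (fun _ => Bool)).exists_subset_of_mem_open hA hU
  exact ⟨m, (mem_cylinder_iff_eq.1 hV).symm ▸ hVU⟩

lemma one_lt_bourgainRank {g : Cantor → ℝ} (hg : BaireOne g) (hgc : ¬ Continuous g) :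
    1 < bourgainRank g := by
  obtain ⟨q, η, Y, X, b, hη, hX, hY, hXb⟩ := exists_forced_of_not_continuous hgc
  refine lt_of_lt_of_le (hg.lt_bAlpha hη ⟨Y, ?_⟩) (bAlpha_le_bourgainRank g q hη)
  rw [← zero_add (1 : Ordinal.{0}), mem_derivSeq_add_one, derivSeq_zero]
  refine ⟨trivial, fun U hU hYU b' => ?_⟩
  by_cases hb : b' = b
  · exact ⟨Y, ⟨trivial, hYU⟩, hb ▸ hY⟩
  · obtain ⟨m, hm⟩ := exists_cylinder_subset hU hYU
    rw [Bool.eq_not_of_ne hb]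
    exact ⟨X m, ⟨trivial, hm (hX m)⟩, hXb m⟩

/-! ### Natural sums of ordinals -/

/-- The Hessenberg sum of two ordinals. -/
noncomputable def natSum (a b : Ordinal.{0}) : Ordinal.{0} :=
  max (⨆ x : Iio a, Order.succ (natSum x.1 b)) (⨆ x : Iio b, Order.succ (natSum a x.1))
termination_by (a, b)
decreasing_by all_goals cases x; decreasing_tactic

lemma natSum_le {a b c : Ordinal.{0}} (ha : ∀ a' < a, natSum a' b < c)
    (hb : ∀ b' < b, natSum a b' < c) : natSum a b ≤ c := by
  rw [natSum]
  exact max_le (Ordinal.iSup_le fun x => Order.succ_le_of_lt (ha x.1 x.2))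
    (Ordinal.iSup_le fun x => Order.succ_le_of_lt (hb x.1 x.2))

lemma natSum_strictMono_left (b : Ordinal.{0}) : StrictMono fun a => natSum a b := by
  intro a' a h
  change natSum a' b < natSum a b
  rw [natSum.eq_1 a]
  exact lt_max_of_lt_left (Order.succ_le_iff.1
    (Ordinal.le_iSup (fun x : Iio a => Order.succ (natSum x.1 b)) ⟨a', h⟩))

lemma natSum_strictMono_right (a : Ordinal.{0}) : StrictMono fun b => natSum a b := by
  intro b' b h
  change natSum a b' < natSum a b
  rw [natSum.eq_1 a b]
  exact lt_max_of_lt_right (Order.succ_le_iff.1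
    (Ordinal.le_iSup (fun x : Iio b => Order.succ (natSum a x.1)) ⟨b', h⟩))

open Ordinal in
/-- Powers of `ω` absorb natural sums. -/
lemma natSum_lt_omega0_opow {e a b : Ordinal.{0}} (ha : a < ω ^ e) (hb : b < ω ^ e) :
    natSum a b < ω ^ e := by
  induction e using Ordinal.limitRecOn generalizing a b with
  | zero =>
    rw [opow_zero, Order.lt_one_iff] at *
    subst ha hb
    exact nonpos_iff_eq_zero.1 (natSum_le (fun _ h => absurd h not_lt_zero)
      (fun _ h => absurd h not_lt_zero))
  | limit e he ih =>
    obtain ⟨e₁, h₁, ha⟩ := (lt_opow_of_isSuccLimit omega0_ne_zero he).1 ha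
    obtain ⟨e₂, h₂, hb⟩ := (lt_opow_of_isSuccLimit omega0_ne_zero he).1 hb
    have hm : max e₁ e₂ < e := max_lt h₁ h₂
    refine (ih _ hm (ha.trans_le ?_) (hb.trans_le ?_)).trans_le ?_ <;>
      refine opow_le_opow_right omega0_pos ?_
    exacts [le_max_left _ _, le_max_right _ _, hm.le]
  | add_one e ih =>
    set w := ω ^ e with hw
    have w0 : w ≠ 0 := (opow_pos e omega0_pos).ne'
    rw [opow_add, opow_one] at *
    have key : ∀ m n : ℕ, ∀ a' < w, ∀ b' < w,
        natSum (w * m + a') (w * n + b') ≤ w * (m + n : ℕ) + natSum a' b' := by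
      have lt_next : ∀ {j k : ℕ} {c d : Ordinal.{0}}, j < k → c < w →
          w * (j : Ordinal.{0}) + c < w * (k : Ordinal.{0}) + d := by
        intro j k c d hjk hc
        calc w * (j : Ordinal.{0}) + c < w * j + w := by gcongr
          _ = w * (j + 1 : ℕ) := by push_cast; rw [mul_add_one]
          _ ≤ w * k := by gcongr; exact hjk
          _ ≤ _ := le_self_add
      have split : ∀ {m : ℕ} {a' x : Ordinal.{0}}, a' < w → x < w * m + a' →
          ∃ k : ℕ, ∃ x' < w, x = w * k + x' ∧ (k < m ∨ k = m ∧ x' < a') := by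
        intro m a' x ha' hx
        have hxm : x < w * (m + 1 : ℕ) := by
          push_cast; rw [mul_add_one]; exact hx.trans (by gcongr)
        obtain ⟨c, hc, x', hx', rfl⟩ := lt_mul_iff.1 hxm
        obtain ⟨k, rfl⟩ := lt_omega0.1 (hc.trans (natCast_lt_omega0 _))
        have hk : k ≤ m := Nat.lt_succ_iff.1 (by exact_mod_cast hc)
        refine ⟨k, x', hx', rfl, hk.lt_or_eq.imp_right ?_⟩
        rintro rfl
        exact ⟨rfl, by simpa using hx⟩
      suffices H : ∀ x y : Ordinal.{0}, ∀ m n : ℕ, ∀ a' < w, ∀ b' < w, x = w * m + a' →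
          y = w * n + b' → natSum x y ≤ w * (m + n : ℕ) + natSum a' b' from
        fun m n a' ha' b' hb' => H _ _ m n a' ha' b' hb' rfl rfl
      intro x
      induction x using WellFoundedLT.induction with | _ x ihx
      intro y
      induction y using WellFoundedLT.induction with | _ y ihy
      intro m n a' ha' b' hb' hx hy
      refine natSum_le (fun z hz => ?_) (fun z hz => ?_)
      · obtain ⟨k, c, hc, hzc, h⟩ := split ha' (hx ▸ hz)
        refine (ihx z hz y k n c hc b' hb' hzc hy).trans_lt ?_
        rcases h with h | ⟨rfl, h⟩
        · exact lt_next (by lia) (ih hc hb')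
        · have := natSum_strictMono_left b' h
          gcongr
      · obtain ⟨k, c, hc, hzc, h⟩ := split hb' (hy ▸ hz)
        refine (ihy z hz m k a' ha' c hc hx hzc).trans_lt ?_
        rcases h with h | ⟨rfl, h⟩
        · exact lt_next (by lia) (ih ha' hc)
        · have := natSum_strictMono_right a' h
          gcongr
    obtain ⟨c, hc, a', ha', rfl⟩ := lt_mul_iff.1 ha
    obtain ⟨d, hd, b', hb', rfl⟩ := lt_mul_iff.1 hb
    obtain ⟨m, rfl⟩ := lt_omega0.1 hc
    obtain ⟨n, rfl⟩ := lt_omega0.1 hd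
    exact (key m n a' ha' b' hb').trans_lt
      (lt_mul_iff.2 ⟨_, natCast_lt_omega0 (m + n), _, ih ha' hb', rfl⟩)

open Ordinal in
lemma exists_strictMono_pi_lt_omega0_opow (r : ℕ) :
    ∃ Φ : (Fin r → Ordinal.{0}) → Ordinal.{0}, StrictMono Φ ∧
      ∀ (e : Ordinal.{0}) ρ, (∀ i, ρ i < ω ^ e) → Φ ρ < ω ^ e := by
  induction r with
  | zero => exact ⟨fun _ => 0, Subsingleton.strictMono _, fun e _ _ => opow_pos e omega0_pos⟩
  | succ r ih =>
    obtain ⟨Φ, hΦ, hlt⟩ := ih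
    refine ⟨fun ρ => natSum (ρ 0) (Φ (Fin.tail ρ)), fun ρ ρ' h => ?_, fun e ρ h =>
      natSum_lt_omega0_opow (h 0) (hlt e _ fun i => h i.succ)⟩
    obtain ⟨hle, i, hi⟩ := Pi.lt_def.1 h
    have htail : Fin.tail ρ ≤ Fin.tail ρ' := fun j => hle j.succ
    change natSum (ρ 0) (Φ (Fin.tail ρ)) < natSum (ρ' 0) (Φ (Fin.tail ρ'))
    cases i using Fin.cases with
    | zero =>
      exact (natSum_strictMono_left _ hi).trans_le
        ((natSum_strictMono_right _).monotone (hΦ.monotone htail))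
    | succ i =>
      exact (natSum_strictMono_right _ (hΦ (Pi.lt_def.2 ⟨htail, i, hi⟩))).trans_le
        ((natSum_strictMono_left _).monotone (hle 0))

open Ordinal in
lemma exists_lt_mul_nat_of_lt_omega0_opow {δ γ : Ordinal.{0}} (hδ : δ ≠ 0)
    (h : γ < ω ^ (log ω δ + 1)) : ∃ n : ℕ, γ < δ * n := by
  rw [opow_add, opow_one, lt_mul_iff_of_isSuccLimit isSuccLimit_omega0] at h
  obtain ⟨c, hc, h⟩ := h
  obtain ⟨n, rfl⟩ := lt_omega0.1 hc
  exact ⟨n, h.trans_le (by gcongr; exact opow_log_le_self _ hδ)⟩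

/-! ### Reducibility implies comparison of ranks -/

open Ordinal in
lemma TTReducible.ordLesssim {f g : Cantor → ℝ} (hg : BaireOne g) (hgc : ¬ Continuous g)
    (h : TTReducible f g) : OrdLesssim (bourgainRank f) (bourgainRank g) := by
  intro γ hγ
  obtain ⟨p, ε, hε, hγ⟩ := exists_lt_bAlpha_of_lt_bourgainRank hγ
  obtain ⟨r, q, η, k, t, hη, hk, ht⟩ := h p ε hε
  have hrank : ∀ i A, ∃ ρ < bAlpha g (q i) (η i), k i A ∈ derivSeq g (q i) (η i) ρ ∧
      k i A ∉ derivSeq g (q i) (η i) (ρ + 1) := fun i A =>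
    exists_mem_derivSeq_notMem_add_one (by simp [hg.derivSeq_bAlpha (q i) (hη i)])
  choose R hRlt hRmem hRnot using hrank
  obtain ⟨Φ, hΦ, hΦlt⟩ := exists_strictMono_pi_lt_omega0_opow r
  have key : ∀ ν A, A ∈ derivSeq f p ε ν → ν ≤ Φ fun i => R i A := by
    intro ν
    induction ν using WellFoundedLT.induction with | _ ν ih
    intro A hA
    by_contra! hlt
    set ρ := Φ fun i => R i A with hρ
    have hA' := derivSeq_antitone f p ε (Order.add_one_le_of_lt hlt) hA
    choose U hU hAU b hb using fun i =>
      exists_nhd_of_notMem_derivSeq_add_one (hRmem i A) (hRnot i A)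
    let V : Set Cantor := ⋂ i, k i ⁻¹' (U i ∩ (derivSeq g (q i) (η i) (R i A + 1))ᶜ)
    have hV : IsOpen V := isOpen_iInter_of_finite fun i =>
      ((hU i).inter (isClosed_derivSeq _ _ _ _).isOpen_compl).preimage (hk i)
    have hAV : A ∈ V := mem_iInter.2 fun i => ⟨hAU i, hRnot i A⟩
    obtain ⟨B, ⟨hB, hBV⟩, hBt⟩ := (mem_derivSeq_add_one.1 hA').2 V hV hAV (t b)
    have hBV := mem_iInter.1 hBV
    refine hBt (ht B b fun i => hb i _ ⟨?_, (hBV i).1⟩)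
    have hle : (fun i => R i B) ≤ fun i => R i A := fun i => by
      by_contra! hi
      exact (hBV i).2 (derivSeq_antitone _ _ _ (Order.add_one_le_of_lt hi) (hRmem i B))
    have heq : (fun i => R i B) = fun i => R i A := by
      by_contra hne
      exact absurd (ih ρ hlt B hB) (not_le.2 (hΦ (lt_of_le_of_ne hle hne)))
    rw [← congrFun heq i]
    exact hRmem i B
  obtain ⟨A, hA⟩ := derivSeq_nonempty_of_lt_bAlpha hγ
  let δ : Ordinal.{0} := max 1 (Finset.univ.sup fun i => R i A)
  have hδ0 : δ ≠ 0 := (zero_lt_one.trans_le (le_max_left _ _)).ne'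
  have hδlt : δ < bourgainRank g := max_lt (one_lt_bourgainRank hg hgc)
    ((Finset.sup_lt_iff (bot_lt_of_lt (one_lt_bourgainRank hg hgc))).2 fun i _ =>
      (hRlt i A).trans_le (bAlpha_le_bourgainRank g (q i) (hη i)))
  refine ⟨δ, hδlt, exists_lt_mul_nat_of_lt_omega0_opow hδ0 ((key γ A hA).trans_lt
    (hΦlt _ _ fun i => lt_of_le_of_lt ?_ (lt_opow_succ_log_self one_lt_omega0 δ)))⟩
  exact (Finset.le_sup (f := fun i => R i A) (Finset.mem_univ i)).trans (le_max_right _ _)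

/-! ### Continuous functions built by successive approximation -/

/-- The state reached after reading the first `n` bits of `A`. -/
def approxState {σ : Type*} (s₀ : σ) (step : ℕ → Set Cantor → σ → σ) (A : Cantor) : ℕ → σ
  | 0 => s₀
  | n + 1 => step n (cylinder A n) (approxState s₀ step A n)

lemma exists_continuous_of_approxState {σ : Type*} (pt : σ → Cantor) (s₀ : σ)
    (step : ℕ → Set Cantor → σ → σ)
    (hstep : ∀ n U s, pt (step n U s) ∈ cylinder (pt s) n) :
    ∃ k : Cantor → Cantor, Continuous k ∧ ∀ A X N,
      (∀ n ≥ N, pt (approxState s₀ step A n) = X) → k A = X := by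
  have hdep : ∀ n, ∀ A B : Cantor, B ∈ cylinder A n →
      approxState s₀ step B n = approxState s₀ step A n := by
    intro n
    induction n with
    | zero => exact fun _ _ _ => rfl
    | succ n ih =>
      intro A B hB
      have hB' := cylinder_anti A n.le_succ hB
      simp only [approxState, ih A B hB', mem_cylinder_iff_eq.1 hB']
  refine ⟨fun A m => pt (approxState s₀ step A (m + 1)) m, continuous_pi fun m => ?_, ?_⟩
  · refine IsLocallyConstant.continuous ((IsLocallyConstant.iff_exists_open _).2 fun A =>
      ⟨cylinder A (m + 1), isOpen_cylinder (fun _ => Bool) A _, self_mem_cylinder A _,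
        fun B hB => ?_⟩)
    simp only [hdep _ A B hB]
  · intro A X N hX
    ext1 m
    have hstab : ∀ n ≥ m + 1,
        pt (approxState s₀ step A n) m = pt (approxState s₀ step A (m + 1)) m := by
      intro n hn
      induction n, hn using Nat.le_induction with
      | base => rfl
      | succ n hn ih =>
        rw [← ih]
        exact hstep n _ _ m hn
    change pt (approxState s₀ step A (m + 1)) m = X m
    rw [← hstab (max N (m + 1)) (le_max_right _ _), hX _ (le_max_left _ _)]

open Classical in
/-- A discontinuous function decides membership in any closed set. -/
lemma exists_decides_isClosed {g : Cantor → ℝ} (hgc : ¬ Continuous g) {C : Set Cantor}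
    (hC : IsClosed C) : ∃ (q η : ℚ) (k : Cantor → Cantor) (b₀ : Bool), 0 < η ∧ Continuous k ∧
      ∀ A b, CorrectAnswer g (k A) q η b → (A ∈ C ↔ b = b₀) := by
  obtain ⟨q, η, Y, X, b, hη, hX, hY, hXb⟩ := exists_forced_of_not_continuous hgc
  let pt : Option ℕ → Cantor := fun s => s.elim Y X
  let step : ℕ → Set Cantor → Option ℕ → Option ℕ := fun n U s =>
    if (U ∩ C).Nonempty then s else some (s.getD n)
  have hstep : ∀ n U s, pt (step n U s) ∈ cylinder (pt s) n := by
    intro n U s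
    by_cases h : (U ∩ C).Nonempty
    · simp only [step, if_pos h, self_mem_cylinder]
    · simp only [step, if_neg h]
      cases s
      · exact hX n
      · exact self_mem_cylinder _ _
  obtain ⟨k, hk, hlim⟩ := exists_continuous_of_approxState pt none step hstep
  refine ⟨q, η, k, !b, hη, hk, fun A b' hb' => ?_⟩
  by_cases hA : A ∈ C
  · have hn : ∀ n, approxState none step A n = none := by
      intro n
      induction n with
      | zero => rfl
      | succ n ih =>
        simp only [approxState, ih, step]
        exact if_pos ⟨A, self_mem_cylinder A n, hA⟩
    have hkA : k A = Y := hlim A Y 0 fun n _ => by rw [hn]; rfl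
    rw [hkA] at hb'
    exact iff_of_true hA (Bool.eq_not_of_ne fun h => hY (h ▸ hb'))
  · obtain ⟨N, hN⟩ := exists_cylinder_subset hC.isOpen_compl hA
    have hmiss : ∀ n ≥ N, ¬ (cylinder A n ∩ C).Nonempty := fun n hn ⟨B, hB, hBC⟩ =>
      hN (cylinder_anti A hn hB) hBC
    obtain ⟨m, hm⟩ : ∃ m, approxState none step A (N + 1) = some m :=
      ⟨_, if_neg (hmiss N le_rfl)⟩
    have hn : ∀ n ≥ N + 1, approxState none step A n = some m := by
      intro n hn
      induction n, hn using Nat.le_induction with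
      | base => exact hm
      | succ n hn ih =>
        simp only [approxState, ih, step]
        exact if_neg (hmiss n (by lia))
    have hkA : k A = X m := hlim A (X m) (N + 1) fun n h => by rw [hn n h]; rfl
    rw [hkA] at hb'
    exact iff_of_false hA fun h => hXb m (h ▸ hb')

open Classical in
/-- If `P^δ` of a question to `g` is inhabited, then one such question answers `f A ≲_ε p` for
all `A` leaving the derivation sequence of `f` in the interval `[β, β + δ)`. -/
lemma exists_reduction_on_block (f : Cantor → ℝ) {g : Cantor → ℝ} (p ε : ℚ) {q η : ℚ}
    {δ : Ordinal.{0}} (hδ : (derivSeq g q η δ).Nonempty) (β : Ordinal.{0}) :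
    ∃ k : Cantor → Cantor, Continuous k ∧ ∀ A ∈ derivSeq f p ε β, A ∉ derivSeq f p ε (β + δ) →
      ∀ b, CorrectAnswer g (k A) q η b → CorrectAnswer f A p ε b := by
  let State := {s : Cantor × Ordinal.{0} // s.1 ∈ derivSeq g q η s.2}
  let Decided : Set Cantor → Ordinal.{0} → Bool → Prop := fun U ρ b =>
    (derivSeq f p ε (β + ρ) ∩ U).Nonempty ∧
      ∀ B ∈ derivSeq f p ε (β + ρ) ∩ U, CorrectAnswer f B p ε b
  have hmove : ∀ (n : ℕ) (s : State) (ρ : Ordinal.{0}) (b : Bool), ρ < s.1.2 →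
      ∃ X ∈ cylinder s.1.1 n, X ∈ derivSeq g q η ρ ∧ ¬ CorrectAnswer g X q η (!b) := by
    intro n s ρ b hρ
    have := derivSeq_antitone g q η (Order.add_one_le_of_lt hρ) s.2
    obtain ⟨X, ⟨hX, hXc⟩, h⟩ := (mem_derivSeq_add_one.1 this).2 _
      (isOpen_cylinder (fun _ => Bool) s.1.1 n) (self_mem_cylinder _ n) (!b)
    exact ⟨X, hXc, hX, h⟩
  choose! move hmove_cyl hmove_mem hmove_forced using hmove
  have hnext : ∀ (n : ℕ) (U : Set Cantor) (s : State), ∃ s' : State,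
      s'.1.1 ∈ cylinder s.1.1 n ∧
      ((s' = s ∧ ¬ ∃ ρ < s.1.2, ∃ b, Decided U ρ b) ∨
        (s'.1.2 < s.1.2 ∧ ∃ b, Decided U s'.1.2 b ∧ ¬ CorrectAnswer g s'.1.1 q η (!b))) := by
    intro n U s
    by_cases h : ∃ ρ < s.1.2, ∃ b, Decided U ρ b
    · obtain ⟨ρ, hρ, b, hb⟩ := h
      exact ⟨⟨(move n s ρ b, ρ), hmove_mem n s ρ b hρ⟩, hmove_cyl n s ρ b hρ,
        Or.inr ⟨hρ, b, hb, hmove_forced n s ρ b hρ⟩⟩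
    · exact ⟨s, self_mem_cylinder _ n, Or.inl ⟨rfl, h⟩⟩
  choose step hstep_cyl hstep using hnext
  obtain ⟨Y, hY⟩ := hδ
  let s₀ : State := ⟨(Y, δ), hY⟩
  obtain ⟨k, hk, hlim⟩ := exists_continuous_of_approxState (fun s : State => s.1.1) s₀ step
    hstep_cyl
  refine ⟨k, hk, fun A hAβ hAδ b hb => ?_⟩
  obtain ⟨ρ', hρ', hAρ, hAρ'⟩ := exists_mem_derivSeq_notMem_add_one hAδ
  obtain ⟨ρ, rfl⟩ : ∃ ρ, ρ' = β + ρ := by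
    refine exists_add_of_le (le_of_not_gt fun h => hAρ' ?_)
    exact derivSeq_antitone f p ε (Order.add_one_le_of_lt h) hAβ
  have hρδ : ρ < δ := lt_of_add_lt_add_left hρ'
  have hge : ∀ n ν c, Decided (cylinder A n) ν c → ρ ≤ ν := by
    intro n ν c hD
    by_contra! h
    have hA := derivSeq_antitone f p ε
      (Order.add_one_le_of_lt (add_lt_add_right h β)) hAρ
    obtain ⟨B, hB, hBc⟩ := (mem_derivSeq_add_one.1 hA).2 _
      (isOpen_cylinder (fun _ => Bool) A n) (self_mem_cylinder A n) c
    exact hBc (hD.2 B hB)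
  let S := approxState s₀ step A
  have hinv : ∀ n, ρ ≤ (S n).1.2 ∧ ((S n).1.2 = ρ →
      ∀ b, CorrectAnswer g (S n).1.1 q η b → CorrectAnswer f A p ε b) := by
    intro n
    induction n with
    | zero => exact ⟨hρδ.le, fun h => absurd h hρδ.ne'⟩
    | succ n ih =>
      have hS : S (n + 1) = step n (cylinder A n) (S n) := rfl
      rcases hstep n (cylinder A n) (S n) with ⟨h, -⟩ | ⟨-, c, hD, hc⟩
      · rw [hS, h]; exact ih
      · rw [hS]
        refine ⟨hge n _ c hD, fun h b hb => ?_⟩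
        rw [h] at hD
        have : b = c := by
          by_contra hne
          exact hc (Bool.eq_not_of_ne hne ▸ hb)
        exact this ▸ hD.2 A ⟨hAρ, self_mem_cylinder A n⟩
  obtain ⟨U, hU, hAU, c, hc⟩ := exists_nhd_of_notMem_derivSeq_add_one hAρ hAρ'
  obtain ⟨N, hN⟩ := exists_cylinder_subset hU hAU
  have hDec : ∀ n ≥ N, Decided (cylinder A n) ρ c := fun n hn =>
    ⟨⟨A, hAρ, self_mem_cylinder A n⟩, fun B hB => hc B ⟨hB.1, hN (cylinder_anti A hn hB.2)⟩⟩
  have hle : ∀ n ≥ N, ∀ ν d, Decided (cylinder A n) ν d → ν ≤ ρ := by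
    intro n hn ν d hD
    by_contra! h
    obtain ⟨B, hB, hBn⟩ := hD.1
    have hB' := derivSeq_antitone f p ε
      (Order.add_one_le_of_lt (add_lt_add_right h β)) hB
    obtain ⟨B', hB', hBc⟩ := (mem_derivSeq_add_one.1 hB').2 _
      (isOpen_cylinder (fun _ => Bool) A n) hBn c
    exact hBc ((hDec n hn).2 B' hB')
  have hN1 : (S (N + 1)).1.2 = ρ := by
    have hS : S (N + 1) = step N (cylinder A N) (S N) := rfl
    rcases hstep N (cylinder A N) (S N) with ⟨h, hnot⟩ | ⟨-, d, hD, -⟩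
    · rw [hS, h]
      refine le_antisymm (le_of_not_gt fun hlt => hnot ⟨ρ, hlt, c, hDec N le_rfl⟩) (hinv N).1
    · rw [hS]
      exact le_antisymm (hle N le_rfl _ d hD) (hge N _ d hD)
  have hconst : ∀ n ≥ N + 1, S n = S (N + 1) := by
    intro n hn
    induction n, hn using Nat.le_induction with
    | base => rfl
    | succ n hn ih =>
      have hS : S (n + 1) = step n (cylinder A n) (S n) := rfl
      rcases hstep n (cylinder A n) (S n) with ⟨h, -⟩ | ⟨hlt, d, hD, -⟩
      · rw [hS, h, ih]
      · rw [ih, hN1] at hlt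
        exact absurd (hge n _ d (ih ▸ hD)) (not_le.2 hlt)
  have hkA : k A = (S (N + 1)).1.1 := hlim A _ (N + 1) fun n hn =>
    congrArg (fun s : State => s.1.1) (hconst n hn)
  exact (hinv (N + 1)).2 hN1 b (hkA ▸ hb)

/-! ### Comparison of ranks implies reducibility -/

/-- Finitely many questions to `g` answer `f A ≲_ε p` for all `A ∈ S`. -/
def TTAnswersOn (f g : Cantor → ℝ) (p ε : ℚ) (S : Set Cantor) : Prop :=
  ∃ (r : ℕ) (q δ : Fin r → ℚ) (k : Fin r → Cantor → Cantor) (h : (Fin r → Bool) → Bool),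
    (∀ i, 0 < δ i) ∧ (∀ i, Continuous (k i)) ∧
    ∀ A ∈ S, ∀ σ : Fin r → Bool,
      (∀ i, CorrectAnswer g (k i A) (q i) (δ i) (σ i)) → CorrectAnswer f A p ε (h σ)

lemma ttAnswersOn_compl_derivSeq (f : Cantor → ℝ) {g : Cantor → ℝ} (hgc : ¬ Continuous g)
    (p ε : ℚ) {q η : ℚ} (hη : 0 < η) {δ : Ordinal.{0}} (hδ : (derivSeq g q η δ).Nonempty)
    (n : ℕ) : TTAnswersOn f g p ε (derivSeq f p ε (δ * n))ᶜ := by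
  induction n with
  | zero =>
    refine ⟨0, fun _ => 0, fun _ => 1, fun _ => id, fun _ => true, fun _ => zero_lt_one,
      fun _ => continuous_id, fun A hA => absurd ?_ hA⟩
    simp [derivSeq_zero]
  | succ n ih =>
    obtain ⟨r, Q, E, K, H, hE, hK, hH⟩ := ih
    obtain ⟨q₁, η₁, k₁, b₁, hη₁, hk₁, hdec⟩ :=
      exists_decides_isClosed hgc (isClosed_derivSeq f p ε (δ * n))
    obtain ⟨k, hk, hkc⟩ := exists_reduction_on_block f p ε hδ (δ * n)
    refine ⟨r + 1 + 1, Fin.cons q₁ (Fin.cons q Q), Fin.cons η₁ (Fin.cons η E),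
      Fin.cons k₁ (Fin.cons k K),
      fun σ => if σ 0 = b₁ then σ 1 else H fun i => σ i.succ.succ, ?_, ?_, ?_⟩
    · exact Fin.cases hη₁ (Fin.cases hη hE)
    · exact Fin.cases hk₁ (Fin.cases hk hK)
    · intro A hA σ hσ
      have h0 := hdec A (σ 0) (hσ 0)
      beta_reduce
      by_cases hb : σ 0 = b₁
      · rw [if_pos hb]
        refine hkc A (h0.2 hb) ?_ (σ 1) (hσ 1)
        simpa [mul_add_one] using hA
      · rw [if_neg hb]
        exact hH A (fun h => hb (h0.1 h)) _ fun i => hσ i.succ.succ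

lemma OrdLesssim.ttReducible {f g : Cantor → ℝ} (hf : BaireOne f) (hgc : ¬ Continuous g)
    (h : OrdLesssim (bourgainRank f) (bourgainRank g)) : TTReducible f g := by
  intro p ε hε
  obtain ⟨ν, hν, hempty⟩ := exists_add_one_of_derivSeq_eq_empty (hf.derivSeq_bAlpha p hε)
  obtain ⟨δ, hδ, n, hn⟩ := h ν (hν.trans_le (bAlpha_le_bourgainRank f p hε))
  obtain ⟨q, η, hη, hδ⟩ := exists_lt_bAlpha_of_lt_bourgainRank hδ
  obtain ⟨r, Q, E, K, H, hE, hK, hH⟩ := ttAnswersOn_compl_derivSeq f hgc p ε hη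
    (derivSeq_nonempty_of_lt_bAlpha hδ) n
  refine ⟨r, Q, E, K, H, hE, hK, fun A => hH A fun hA => ?_⟩
  have := derivSeq_antitone f p ε (Order.add_one_le_of_lt hn) hA
  rwa [hempty] at this

/-- For discontinuous Baire 1 functions `f, g`, one has `f ≤_tt g` iff
`|f|_α ≲ |g|_α`. -/
theorem ttReducible_iff_ordLesssim (f g : Cantor → ℝ) (hf : BaireOne f) (hg : BaireOne g)
    (hfc : ¬ Continuous f) (hgc : ¬ Continuous g) :
    TTReducible f g ↔ OrdLesssim (bourgainRank f) (bourgainRank g) :=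
  ⟨TTReducible.ordLesssim hg hgc, OrdLesssim.ttReducible hf hgc⟩
end

section
/- Let f, g : 2^ω → ℝ be Borel measurable functions. Then f ≤_m g or g ≤_m (−f), where −f is the pointwise negation of f. -/
/-- A pruned game tree: positions with a level and a parent map.  The two players alternate; player
`true` moves at even levels and player `false` at odd levels. -/
structure Arena where
  /-- The positions. -/
  Pos : Type
  /-- The number of moves made so far. -/
  lev : Pos → ℕ
  /-- The position before the last move (a junk value at level `0`). -/
  par : Pos → Pos
  lev_par : ∀ p, lev (par p) = lev p - 1
  exists_child : ∀ p, ∃ q, lev q = lev p + 1 ∧ par q = p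

namespace Arena

variable (T : Arena)

/-- `q` is reached from `p` by one move. -/
def Child (p q : T.Pos) : Prop := T.lev q = T.lev p + 1 ∧ T.par q = p

/-- An infinite play. -/
structure IsPlay (x : ℕ → T.Pos) : Prop where
  lev : ∀ n, T.lev (x n) = n
  par : ∀ n, T.par (x (n + 1)) = x n

/-- A strategy, telling what to do at every position. -/
structure Strat where
  /-- The next position. -/
  move : T.Pos → T.Pos
  child : ∀ p, T.Child p (move p)

/-- Player `b` moves at level `n`. -/
def Turn (b : Bool) (n : ℕ) : Prop := n % 2 = 0 ↔ b = true

@[simp] theorem turn_true (n : ℕ) : Turn true n ↔ n % 2 = 0 := by simp [Turn]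

@[simp] theorem turn_false (n : ℕ) : Turn false n ↔ n % 2 = 1 := by simp [Turn]

/-- In `x`, player `b` follows `σ`. -/
def Consistent {T : Arena} (b : Bool) (σ : T.Strat) (x : ℕ → T.Pos) : Prop :=
  ∀ n, Turn b n → x (n + 1) = σ.move (x n)

/-- The set `A` of plays is open. -/
def OpenPlays (A : Set (ℕ → T.Pos)) : Prop :=
  ∀ x, T.IsPlay x → x ∈ A → ∃ n, ∀ y, T.IsPlay y → y n = x n → y ∈ A

/-- The ancestor of `p` at level `m`. -/
def anc (m : ℕ) (p : T.Pos) : T.Pos := T.par^[T.lev p - m] p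

variable {T}

theorem IsPlay.child {x : ℕ → T.Pos} (hx : T.IsPlay x) (n : ℕ) : T.Child (x n) (x (n + 1)) :=
  ⟨by rw [hx.lev, hx.lev], hx.par n⟩

theorem lev_iterate_par (k : ℕ) (p : T.Pos) : T.lev (T.par^[k] p) = T.lev p - k := by
  induction k with
  | zero => rfl
  | succ k ih => rw [Function.iterate_succ_apply' T.par, T.lev_par, ih]; omega

theorem lev_anc {m : ℕ} {p : T.Pos} (h : m ≤ T.lev p) : T.lev (T.anc m p) = m := by
  rw [anc, lev_iterate_par]; omega

theorem lev_anc_le (m : ℕ) (p : T.Pos) : T.lev (T.anc m p) ≤ m := by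
  rw [anc, lev_iterate_par]; omega

@[simp] theorem anc_lev (p : T.Pos) : T.anc (T.lev p) p = p := by simp [anc]

theorem anc_par {m : ℕ} {p : T.Pos} (h : m < T.lev p) : T.anc m (T.par p) = T.anc m p := by
  rw [anc, anc, ← Function.iterate_succ_apply T.par, T.lev_par]
  congr 1
  omega

theorem par_anc {m : ℕ} {p : T.Pos} (h : m < T.lev p) : T.par (T.anc (m + 1) p) = T.anc m p := by
  rw [anc, anc, ← Function.iterate_succ_apply' T.par]
  congr 1
  omega

theorem Child.anc_eq {m : ℕ} {p q : T.Pos} (h : T.Child p q) (hm : m ≤ T.lev p) :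
    T.anc m q = T.anc m p := by
  rw [← h.2, anc_par]
  have := h.1
  omega

theorem IsPlay.anc_eq {x : ℕ → T.Pos} (hx : T.IsPlay x) {m n : ℕ} (h : m ≤ n) :
    T.anc m (x n) = x m := by
  induction n, h using Nat.le_induction with
  | base => rw [anc, hx.lev]; simp
  | succ n hn ih => rw [(hx.child n).anc_eq (by rw [hx.lev]; exact hn), ih]

/-- The positions comparable with `u` in the tree order. -/
def cone (u : T.Pos) : Set T.Pos :=
  {q | (T.lev q ≤ T.lev u ∧ T.anc (T.lev q) u = q) ∨ (T.lev u ≤ T.lev q ∧ T.anc (T.lev u) q = u)}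

theorem IsPlay.mem_cone {x : ℕ → T.Pos} (hx : T.IsPlay x) (m n : ℕ) : x n ∈ cone (x m) := by
  rcases le_total n m with h | h
  · exact Or.inl ⟨by simpa [hx.lev] using h, by rw [hx.lev, hx.anc_eq h]⟩
  · exact Or.inr ⟨by simpa [hx.lev] using h, by rw [hx.lev, hx.anc_eq h]⟩

theorem eq_anc_of_mem_cone {u q : T.Pos} (h : q ∈ cone u) (hl : T.lev q ≤ T.lev u) :
    q = T.anc (T.lev q) u := by
  rcases h with h | h
  · exact h.2.symm
  · have e : T.lev q = T.lev u := le_antisymm hl h.1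
    have h2 := h.2
    rw [← e, anc_lev] at h2
    rw [e, anc_lev, h2]

theorem exists_child_mem_cone {u p : T.Pos} (h : p ∈ cone u) : ∃ q, T.Child p q ∧ q ∈ cone u := by
  by_cases hl : T.lev p < T.lev u
  · have e := eq_anc_of_mem_cone h hl.le
    refine ⟨T.anc (T.lev p + 1) u, ⟨lev_anc hl, ?_⟩, Or.inl ?_⟩
    · rw [par_anc hl, ← e]
    · rw [lev_anc hl]; exact ⟨hl, rfl⟩
  · push Not at hl
    obtain ⟨q, hq⟩ := T.exists_child p
    have hu : T.anc (T.lev u) p = u := by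
      rcases h with h | h
      · have e : T.lev p = T.lev u := le_antisymm h.1 hl
        have h2 := h.2
        rw [e, anc_lev] at h2
        rw [← h2, anc_lev]
      · exact h.2
    refine ⟨q, hq, Or.inr ⟨by omega, ?_⟩⟩
    rw [Child.anc_eq hq hl, hu]

/-- Player `b` can force the play from `p` into `U` in at most `α` steps, where all moves have to
stay in `V`. -/
inductive Reach (b : Bool) (U V : Set T.Pos) : Ordinal.{0} → T.Pos → Prop
  | base {α p} : p ∈ U → Reach b U V α p
  | mine {α β p q} : Turn b (T.lev p) → T.Child p q → q ∈ V → β < α → Reach b U V β q →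
      Reach b U V α p
  | opp {α p} (f : T.Pos → Ordinal) : ¬ Turn b (T.lev p) →
      (∀ q, T.Child p q → q ∈ V → f q < α) →
      (∀ q, T.Child p q → q ∈ V → Reach b U V (f q) q) → Reach b U V α p

/-- The positions from which player `b` can force the play into `U`. -/
def win (b : Bool) (U V : Set T.Pos) : Set T.Pos := {p | ∃ α, Reach b U V α p}

/-- The number of steps player `b` needs to reach `U`. -/
noncomputable def rank (b : Bool) (U V : Set T.Pos) (p : T.Pos) : Ordinal :=
  sInf {α | Reach b U V α p}

section Win

variable {b : Bool} {U V : Set T.Pos} {p q : T.Pos}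

theorem reach_rank (h : p ∈ win b U V) : Reach b U V (rank b U V p) p := csInf_mem h

theorem Reach.rank_le {α} (h : Reach b U V α p) : rank b U V p ≤ α := csInf_le' h

theorem subset_win (h : p ∈ U) : p ∈ win b U V := ⟨0, .base h⟩

theorem exists_child_rank_lt (h : p ∈ win b U V) (hU : p ∉ U) (ht : Turn b (T.lev p)) :
    ∃ q, T.Child p q ∧ q ∈ V ∧ q ∈ win b U V ∧ rank b U V q < rank b U V p := by
  cases reach_rank h with
  | base h => exact absurd h hU
  | mine _ hc hV hlt hr => exact ⟨_, hc, hV, ⟨_, hr⟩, hr.rank_le.trans_lt hlt⟩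
  | opp f ht' => exact absurd ht ht'

theorem rank_lt_of_child (h : p ∈ win b U V) (hU : p ∉ U) (ht : ¬ Turn b (T.lev p))
    (hc : T.Child p q) (hV : q ∈ V) : q ∈ win b U V ∧ rank b U V q < rank b U V p := by
  cases reach_rank h with
  | base h => exact absurd h hU
  | mine ht' => exact absurd ht' ht
  | opp f _ h1 h2 => exact ⟨⟨_, h2 q hc hV⟩, (h2 q hc hV).rank_le.trans_lt (h1 q hc hV)⟩

theorem notMem_win_of_child (h : p ∉ win b U V) (ht : Turn b (T.lev p)) (hc : T.Child p q)
    (hV : q ∈ V) : q ∉ win b U V := fun ⟨α, hα⟩ =>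
  h ⟨_, .mine ht hc hV (Order.lt_succ α) hα⟩

theorem exists_child_notMem_win (h : p ∉ win b U V) (ht : ¬ Turn b (T.lev p)) :
    ∃ q, T.Child p q ∧ q ∈ V ∧ q ∉ win b U V := by
  by_contra! hc
  exact h ⟨Order.succ (⨆ q, rank b U V q), .opp (rank b U V) ht
    (fun q _ _ => Order.lt_succ_of_le (Ordinal.le_iSup _ q))
    (fun q h1 h2 => reach_rank (hc q h1 h2))⟩

/-- A play in which player `b` decreases the rank reaches the target. -/
theorem exists_mem_of_rank_lt {x : ℕ → T.Pos} (hx : T.IsPlay x) {n₀ : ℕ}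
    (h₀ : x n₀ ∈ win b U V) (hV₀ : x n₀ ∈ V)
    (hV : ∀ n ≥ n₀, ¬ Turn b n → x n ∈ V → x (n + 1) ∈ V)
    (h : ∀ n ≥ n₀, Turn b n → x n ∈ win b U V → x (n + 1) ∈ V ∧
      x (n + 1) ∈ win b U V ∧ rank b U V (x (n + 1)) < rank b U V (x n)) :
    ∃ n ≥ n₀, x n ∈ U := by
  by_contra! hU
  have key : ∀ n ≥ n₀, x n ∈ V → x n ∈ win b U V → x (n + 1) ∈ V ∧
      x (n + 1) ∈ win b U V ∧ rank b U V (x (n + 1)) < rank b U V (x n) := by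
    intro n hn hnV hw
    by_cases ht : Turn b n
    · exact h n hn ht hw
    · have h1 := hV n hn ht hnV
      exact ⟨h1, rank_lt_of_child hw (hU n hn) (by rwa [hx.lev]) (hx.child n) h1⟩
  have hw : ∀ k, x (n₀ + k) ∈ V ∧ x (n₀ + k) ∈ win b U V := by
    intro k
    induction k with
    | zero => exact ⟨hV₀, h₀⟩
    | succ k ih =>
      have := key _ (by omega) ih.1 ih.2
      exact ⟨this.1, this.2.1⟩
  exact not_strictAnti_of_wellFoundedLT (fun k => rank b U V (x (n₀ + k)))
    (strictAnti_nat_of_succ_lt fun k => (key (n₀ + k) (by omega) (hw k).1 (hw k).2).2.2)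

end Win

/-- A covering of `T` by `T'` which is the identity up to level `N`. -/
structure Cover (N : ℕ) (T' T : Arena) where
  /-- The projection. -/
  proj : T'.Pos → T.Pos
  lev_proj : ∀ p, T.lev (proj p) = T'.lev p
  par_proj : ∀ p, T.par (proj p) = proj (T'.par p)
  inj : ∀ p q, T'.lev p ≤ N → T'.lev q ≤ N → proj p = proj q → p = q
  surj : ∀ p, T.lev p ≤ N → ∃ q, proj q = p
  /-- The map on strategies. -/
  push : Bool → T'.Strat → T.Strat
  push_congr : ∀ b σ τ n, (∀ p, T'.lev p < n → σ.move p = τ.move p) →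
    ∀ p, T.lev p < n → (push b σ).move p = (push b τ).move p
  push_proj : ∀ b σ p, T'.lev p < N → (push b σ).move (proj p) = proj (σ.move p)
  lift : ∀ b σ x, T.IsPlay x → Consistent b (push b σ) x →
    ∃ y, T'.IsPlay y ∧ Consistent b σ y ∧ ∀ n, proj (y n) = x n

namespace Cover

variable {N : ℕ} {T₀ T₁ T₂ : Arena}

theorem isPlay (c : Cover N T₁ T₀) {y : ℕ → T₁.Pos} (hy : T₁.IsPlay y) :
    T₀.IsPlay (c.proj ∘ y) :=
  ⟨fun n => by simp [c.lev_proj, hy.lev], fun n => by simp [c.par_proj, hy.par]⟩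

theorem openPlays (c : Cover N T₁ T₀) {A : Set (ℕ → T₀.Pos)} (hA : T₀.OpenPlays A) :
    T₁.OpenPlays {y | c.proj ∘ y ∈ A} := by
  intro x hx hxA
  obtain ⟨n, hn⟩ := hA _ (c.isPlay hx) hxA
  exact ⟨n, fun y hy hyx => hn _ (c.isPlay hy) (by simp [hyx])⟩

/-- Composition of coverings. -/
def comp (c : Cover N T₁ T₀) (d : Cover N T₂ T₁) : Cover N T₂ T₀ where
  proj := c.proj ∘ d.proj
  lev_proj p := by simp [c.lev_proj, d.lev_proj]
  par_proj p := by simp [c.par_proj, d.par_proj]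
  inj p q hp hq h := d.inj p q hp hq
    (c.inj _ _ (by rwa [d.lev_proj]) (by rwa [d.lev_proj]) h)
  surj p hp := by
    obtain ⟨q, rfl⟩ := c.surj p hp
    obtain ⟨r, rfl⟩ := d.surj q (by rwa [c.lev_proj] at hp)
    exact ⟨r, rfl⟩
  push b σ := c.push b (d.push b σ)
  push_congr b σ τ n h := c.push_congr b _ _ n (d.push_congr b σ τ n h)
  push_proj b σ p hp := by
    rw [Function.comp_apply, c.push_proj _ _ _ (by rwa [d.lev_proj]), d.push_proj _ _ _ hp]
    rfl
  lift b σ x hx h := by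
    obtain ⟨y, hy, hyc, hyx⟩ := c.lift b _ x hx h
    obtain ⟨z, hz, hzc, hzy⟩ := d.lift b _ y hy hyc
    exact ⟨z, hz, hzc, fun n => by simp [hzy, hyx]⟩

end Cover

/-- In an inverse system of sets, an element which can be lifted forever lies on a thread. -/
theorem exists_thread (i : ℕ) : ∀ (X : ℕ → Type) (f : ∀ j, X (j + 1) → X j) (G : ∀ j, X j → Prop)
    (_ : ∀ j, i ≤ j → ∀ p, G j p → ∃ q, f j q = p ∧ G (j + 1) q) (p : X i) (_ : G i p),
    ∃ t : ∀ j, X j, (∀ j, f j (t (j + 1)) = t j) ∧ t i = p := by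
  induction i with
  | zero =>
    intro X f G h p hp
    choose g hg using fun j (p : {p : X j // G j p}) => h j (Nat.zero_le j) p.1 p.2
    let t : ∀ j, {p : X j // G j p} := fun j =>
      Nat.rec ⟨p, hp⟩ (fun j q => ⟨g j q, (hg j q).2⟩) j
    exact ⟨fun j => (t j).1, fun j => (hg j (t j)).1, rfl⟩
  | succ i ih =>
    intro X f G h p hp
    obtain ⟨t, ht, hti⟩ := ih (fun j => X (j + 1)) (fun j => f (j + 1)) (fun j => G (j + 1))
      (fun j hj => h (j + 1) (by omega)) p hp
    refine ⟨fun j => Nat.casesOn j (f 0 (t 0)) t, fun j => ?_, hti⟩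
    cases j with
    | zero => rfl
    | succ j => exact ht j

section Limit

variable {X : ℕ → Arena} {N : ℕ} (c : ∀ i, Cover (N + 2 * i) (X (i + 1)) (X i))

theorem lev_thread {t : ∀ i, (X i).Pos} (ht : ∀ i, (c i).proj (t (i + 1)) = t i) (i : ℕ) :
    (X i).lev (t i) = (X 0).lev (t 0) := by
  induction i with
  | zero => rfl
  | succ i ih => rw [← ih, ← ht i, (c i).lev_proj]

theorem exists_thread_pos {i : ℕ} {p : (X i).Pos} (hp : (X i).lev p ≤ N + 2 * i) :
    ∃ t : ∀ i, (X i).Pos, (∀ i, (c i).proj (t (i + 1)) = t i) ∧ t i = p := by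
  refine exists_thread i (fun i => (X i).Pos) (fun i => (c i).proj)
    (fun j q => (X j).lev q ≤ N + 2 * i) (fun j hj q hq => ?_) p hp
  obtain ⟨r, rfl⟩ := (c j).surj q (by omega)
  exact ⟨r, rfl, by rwa [(c j).lev_proj] at hq⟩

theorem thread_ext {s t : ∀ i, (X i).Pos} (hs : ∀ i, (c i).proj (s (i + 1)) = s i)
    (ht : ∀ i, (c i).proj (t (i + 1)) = t i) {i : ℕ} (hi : (X i).lev (s i) ≤ N + 2 * i)
    (h : s i = t i) : s = t := by
  have up : ∀ j, i ≤ j → s j = t j := by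
    intro j hj
    induction j, hj using Nat.le_induction with
    | base => exact h
    | succ j hj ih =>
      have e := lev_thread c hs
      have e' := lev_thread c ht
      have e1 : (X i).lev (t i) = (X i).lev (s i) := by rw [h]
      refine (c j).inj _ _ ?_ ?_ (by rw [hs, ht, ih])
      · rw [e, ← e i]; omega
      · rw [e', ← e' i]; omega
  have down : ∀ k j, j + k = i → s j = t j := by
    intro k
    induction k with
    | zero => rintro j rfl; exact h
    | succ k ih => intro j hj; rw [← hs, ← ht, ih (j + 1) (by omega)]
  funext j
  rcases le_total i j with hj | hj
  · exact up j hj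
  · exact down (i - j) j (by omega)

/-- The inverse limit of a sequence of coverings. -/
def limit : Arena where
  Pos := {t : ∀ i, (X i).Pos // ∀ i, (c i).proj (t (i + 1)) = t i}
  lev t := (X 0).lev (t.1 0)
  par t := ⟨fun i => (X i).par (t.1 i), fun i => by rw [← (c i).par_proj, t.2]⟩
  lev_par t := (X 0).lev_par _
  exists_child t := by
    have e := lev_thread c t.2
    set i := (X 0).lev (t.1 0) + 1 with hi
    obtain ⟨q, hq1, hq2⟩ := (X i).exists_child (t.1 i)
    obtain ⟨s, hs, hsi⟩ := exists_thread_pos c (p := q) (by rw [hq1, e]; omega)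
    have e' := lev_thread c hs
    have hs0 : (X 0).lev (s 0) = (X 0).lev (t.1 0) + 1 := by rw [← e' i, hsi, hq1, e]
    refine ⟨⟨s, hs⟩, hs0, Subtype.ext ?_⟩
    refine thread_ext c (i := i) (fun i => by rw [← (c i).par_proj, hs]) t.2 ?_ ?_
    · change (X i).lev ((X i).par (s i)) ≤ _
      rw [(X i).lev_par, e', hs0]; omega
    · change (X i).par (s i) = _
      rw [hsi, hq2]

theorem limit_lev (t : (limit c).Pos) (i : ℕ) : (X i).lev (t.1 i) = (limit c).lev t :=
  lev_thread c t.2 i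

theorem limit_ext {s t : (limit c).Pos} {i : ℕ} (hi : (limit c).lev s ≤ N + 2 * i)
    (h : s.1 i = t.1 i) : s = t :=
  Subtype.ext (thread_ext c s.2 t.2 (by rwa [limit_lev c s i]) h)

theorem exists_limit_pos {i : ℕ} {p : (X i).Pos} (hp : (X i).lev p ≤ N + 2 * i) :
    ∃ t : (limit c).Pos, t.1 i = p := by
  obtain ⟨t, ht, h⟩ := exists_thread_pos c hp
  exact ⟨⟨t, ht⟩, h⟩

theorem isPlay_limit_apply {x : ℕ → (limit c).Pos} (hx : (limit c).IsPlay x) (i : ℕ) :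
    (X i).IsPlay fun n => (x n).1 i :=
  ⟨fun n => by rw [limit_lev, hx.lev], fun n => by rw [← hx.par n]; rfl⟩

open Classical in
/-- The strategy on `X i` which copies a strategy on the limit at low levels. -/
noncomputable def limitStrat (σ : (limit c).Strat) (i : ℕ) : (X i).Strat where
  move p := if h : ∃ t : (limit c).Pos, t.1 i = p ∧ (limit c).lev t < N + 2 * i then
    (σ.move h.choose).1 i else ((X i).exists_child p).choose
  child p := by
    split_ifs with h
    · have h1 := h.choose_spec.1
      have h2 := σ.child h.choose
      constructor
      · rw [limit_lev, h2.1, ← limit_lev c _ i, h1]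
      · conv_rhs => rw [← h1, ← h2.2]
        rfl
    · exact ((X i).exists_child p).choose_spec

theorem limitStrat_apply (σ : (limit c).Strat) {i : ℕ} {t : (limit c).Pos}
    (ht : (limit c).lev t < N + 2 * i) : (limitStrat c σ i).move (t.1 i) = (σ.move t).1 i := by
  have h : ∃ s : (limit c).Pos, s.1 i = t.1 i ∧ (limit c).lev s < N + 2 * i := ⟨t, rfl, ht⟩
  rw [limitStrat]
  dsimp only
  rw [dif_pos h, limit_ext c h.choose_spec.2.le h.choose_spec.1]

theorem limitStrat_congr {σ τ : (limit c).Strat} {n : ℕ}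
    (h : ∀ p, (limit c).lev p < n → σ.move p = τ.move p) (i : ℕ) (p : (X i).Pos)
    (hp : (X i).lev p < n) : (limitStrat c σ i).move p = (limitStrat c τ i).move p := by
  by_cases ht : ∃ t : (limit c).Pos, t.1 i = p ∧ (limit c).lev t < N + 2 * i
  · obtain ⟨t, rfl, ht⟩ := ht
    rw [limitStrat_apply c σ ht, limitStrat_apply c τ ht, h t (by rwa [← limit_lev c t i])]
  · simp [limitStrat, ht]

/-- Pushing down to `X i` the approximation on `X (i + m)` of a strategy on the limit. -/
noncomputable def limitApprox (b : Bool) (σ : (limit c).Strat) : ℕ → ∀ i, (X i).Strat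
  | 0, i => limitStrat c σ i
  | m + 1, i => (c i).push b (limitApprox b σ m (i + 1))

theorem limitApprox_congr (b : Bool) {σ τ : (limit c).Strat} {n : ℕ}
    (h : ∀ p, (limit c).lev p < n → σ.move p = τ.move p) (m : ℕ) : ∀ (i : ℕ) (p : (X i).Pos),
    (X i).lev p < n → (limitApprox c b σ m i).move p = (limitApprox c b τ m i).move p := by
  induction m with
  | zero => exact limitStrat_congr c h
  | succ m ih => exact fun i => (c i).push_congr b _ _ n (ih (i + 1))

theorem limitApprox_succ (b : Bool) (σ : (limit c).Strat) (m : ℕ) : ∀ (i : ℕ) (p : (X i).Pos),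
    (X i).lev p < N + 2 * (i + m) →
      (limitApprox c b σ (m + 1) i).move p = (limitApprox c b σ m i).move p := by
  induction m with
  | zero =>
    intro i p hp
    obtain ⟨t, rfl⟩ := exists_limit_pos c (p := p) (by omega)
    rw [limit_lev] at hp
    change ((c i).push b (limitStrat c σ (i + 1))).move (t.1 i) = (limitStrat c σ i).move (t.1 i)
    rw [limitStrat_apply c σ (by omega), ← t.2 i, (c i).push_proj _ _ _ (by rw [limit_lev]; omega),
      limitStrat_apply c σ (by omega), (σ.move t).2]
  | succ m ih =>
    intro i p hp
    exact (c i).push_congr b _ _ (N + 2 * (i + (m + 1)))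
      (fun q hq => ih (i + 1) q (by omega)) p hp

theorem limitApprox_eq (b : Bool) (σ : (limit c).Strat) {m k i : ℕ} (hk : m ≤ k) {p : (X i).Pos}
    (hp : (X i).lev p < N + 2 * (i + m)) :
    (limitApprox c b σ k i).move p = (limitApprox c b σ m i).move p := by
  induction k, hk using Nat.le_induction with
  | base => rfl
  | succ k hk ih => rw [limitApprox_succ c b σ k i p (by omega), ih]

/-- The image on `X i` of a strategy on the limit. -/
noncomputable def limitPush (b : Bool) (σ : (limit c).Strat) (i : ℕ) : (X i).Strat where
  move p := (limitApprox c b σ ((X i).lev p + 1) i).move p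
  child p := (limitApprox c b σ ((X i).lev p + 1) i).child p

theorem limitPush_eq_limitStrat (b : Bool) (σ : (limit c).Strat) {i : ℕ} {p : (X i).Pos}
    (hp : (X i).lev p < N + 2 * i) : (limitPush c b σ i).move p = (limitStrat c σ i).move p :=
  limitApprox_eq c b σ (Nat.zero_le _) hp

theorem push_limitPush (b : Bool) (σ : (limit c).Strat) (i : ℕ) (p : (X i).Pos) :
    ((c i).push b (limitPush c b σ (i + 1))).move p = (limitPush c b σ i).move p := by
  change _ = (limitApprox c b σ ((X i).lev p + 1) i).move p
  rw [← limitApprox_eq c b σ (Nat.le_succ ((X i).lev p + 1)) (by omega)]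
  refine (c i).push_congr b _ _ ((X i).lev p + 1) (fun q hq => ?_) p (Nat.lt_succ_self _)
  exact (limitApprox_eq c b σ (by omega) (by omega)).symm

/-- The projection from the inverse limit is a covering. -/
noncomputable def limitCover : Cover N (limit c) (X 0) where
  proj t := t.1 0
  lev_proj _ := rfl
  par_proj _ := rfl
  inj s t hs _ h := limit_ext c (i := 0) hs h
  surj _ hp := exists_limit_pos c (i := 0) hp
  push b σ := limitPush c b σ 0
  push_congr b _ _ _ h p hp := limitApprox_congr c b h _ 0 p hp
  push_proj b σ p hp := by
    rw [limitPush_eq_limitStrat c b σ (i := 0) hp, limitStrat_apply c σ (i := 0) hp]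
  lift b σ x hx h := by
    have step : ∀ i (y : {y : ℕ → (X i).Pos // (X i).IsPlay y ∧ Consistent b (limitPush c b σ i) y}),
        ∃ z : {z : ℕ → (X (i + 1)).Pos //
          (X (i + 1)).IsPlay z ∧ Consistent b (limitPush c b σ (i + 1)) z},
          ∀ n, (c i).proj (z.1 n) = y.1 n := by
      rintro i ⟨y, hy, hyc⟩
      obtain ⟨z, hz, hzc, hzy⟩ := (c i).lift b (limitPush c b σ (i + 1)) y hy
        (fun n hn => by rw [push_limitPush, hyc n hn])
      exact ⟨⟨z, hz, hzc⟩, hzy⟩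
    choose g hg using step
    let y : ∀ i, {y : ℕ → (X i).Pos // (X i).IsPlay y ∧ Consistent b (limitPush c b σ i) y} :=
      fun i => Nat.rec ⟨x, hx, h⟩ (fun i y => g i y) i
    have hy : ∀ i n, (c i).proj ((y (i + 1)).1 n) = (y i).1 n := fun i => hg i (y i)
    let z : ℕ → (limit c).Pos := fun n => ⟨fun i => (y i).1 n, fun i => hy i n⟩
    have hz : (limit c).IsPlay z := by
      refine ⟨fun n => hx.lev n, fun n => Subtype.ext (funext fun i => ?_)⟩
      exact (y i).2.1.par n
    refine ⟨z, hz, fun n hn => ?_, fun n => rfl⟩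
    refine limit_ext c (i := n + 1) (by rw [hz.lev]; omega) ?_
    have h1 := (y (n + 1)).2.2 n hn
    rw [limitPush_eq_limitStrat c b σ (by rw [(y (n + 1)).2.1.lev]; omega)] at h1
    rw [← limitStrat_apply c σ (by rw [hz.lev]; omega)]
    exact h1

end Limit

section Unravel

variable (T) (N : ℕ) (O : Set T.Pos)

/-- `V` restricts only the moves of player `true`. -/
def QuasiStrat (V : Set T.Pos) : Prop :=
  ∀ q ∈ V, (T.lev q % 2 = 1 → ∀ r, T.Child q r → r ∈ V) ∧
    (T.lev q % 2 = 0 → ∃ r, T.Child q r ∧ r ∈ V)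

/-- The answers of player `false` to the quasi-strategy `V` of player `true`: either a position `u`
in `V` and in the open set generated by `O`, or a quasi-strategy inside `V` for avoiding `O`. -/
def Answer (V S : Set T.Pos) : Prop :=
  (∃ u ∈ V, u ∈ O ∧ N + 2 ≤ T.lev u ∧ S = cone u) ∨
    (S ⊆ V ∧ (∀ q ∈ S, q ∉ O) ∧ ∀ q ∈ S,
      (T.lev q % 2 = 0 → ∀ r, T.Child q r → r ∈ V → r ∈ S) ∧
      (T.lev q % 2 = 1 → ∃ r, T.Child q r ∧ r ∈ S))

/-- The positions of the unravelled game: a position of `T`, the quasi-strategy played by player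
`true` at level `N`, and the answer of player `false` at level `N + 1`. -/
structure Legal (t : T.Pos × Set T.Pos × Set T.Pos) : Prop where
  quasi_empty : T.lev t.1 ≤ N → t.2.1 = ∅
  quasi : N < T.lev t.1 → T.QuasiStrat t.2.1
  quasi_mem : N < T.lev t.1 → T.anc (N + 1) t.1 ∈ t.2.1
  answer_empty : T.lev t.1 ≤ N + 1 → t.2.2 = ∅
  answer : N + 1 < T.lev t.1 → T.Answer N O t.2.1 t.2.2
  answer_mem : ∀ m, N + 2 ≤ m → m ≤ T.lev t.1 → T.anc m t.1 ∈ t.2.2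

variable {T N O}

theorem Legal.base {p : T.Pos} (hp : T.lev p ≤ N) : T.Legal N O (p, ∅, ∅) :=
  ⟨fun _ => rfl, fun h => absurd h (by simpa using hp), fun h => absurd h (by simpa using hp),
    fun _ => rfl, fun h => absurd h (by simp; omega), fun m h h' => by simp at h'; omega⟩

theorem Legal.par {t : T.Pos × Set T.Pos × Set T.Pos} (ht : T.Legal N O t) {V S : Set T.Pos}
    (hV : T.lev t.1 ≤ N + 1 → V = ∅) (hV' : N + 1 < T.lev t.1 → V = t.2.1)
    (hS : T.lev t.1 ≤ N + 2 → S = ∅) (hS' : N + 2 < T.lev t.1 → S = t.2.2) :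
    T.Legal N O (T.par t.1, V, S) := by
  have hl := T.lev_par t.1
  constructor
  · intro h
    exact hV (by simp only at h; omega)
  · intro h
    simp only at h ⊢
    rw [hV' (by omega)]
    exact ht.quasi (by omega)
  · intro h
    simp only at h ⊢
    rw [hV' (by omega), anc_par (by omega)]
    exact ht.quasi_mem (by omega)
  · intro h
    exact hS (by simp only at h; omega)
  · intro h
    simp only at h ⊢
    rw [hV' (by omega), hS' (by omega)]
    exact ht.answer (by omega)
  · intro m hm h
    simp only at h ⊢
    rw [hS' (by omega), anc_par (by omega)]
    exact ht.answer_mem m hm (by omega)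

/-- Moves keep the auxiliary data, once played. -/
theorem Legal.child {p q : T.Pos} {V S : Set T.Pos} (hpq : T.Child p q) (hp : N + 1 < T.lev p)
    (ht : T.Legal N O (p, V, S)) (hq : q ∈ S) : T.Legal N O (q, V, S) := by
  have hl := hpq.1
  refine ⟨fun h => ?_, fun h => ht.quasi (by simp only; omega), fun h => ?_, fun h => ?_,
    fun h => ht.answer hp, fun m hm h => ?_⟩
  · simp only at h; omega
  · have := ht.quasi_mem (by simp only; omega)
    rwa [← hpq.anc_eq (by omega)] at this
  · simp only at h; omega
  · simp only at h ⊢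
    rcases Nat.lt_or_ge (T.lev p) m with h' | h'
    · obtain rfl : m = T.lev q := by omega
      rwa [anc_lev]
    · rw [hpq.anc_eq h']
      exact ht.answer_mem m hm h'

theorem Legal.quasi_child {p q : T.Pos} {V : Set T.Pos} (hpq : T.Child p q) (hp : T.lev p = N)
    (hV : T.QuasiStrat V) (hq : q ∈ V) : T.Legal N O (q, V, ∅) := by
  have hl := hpq.1
  refine ⟨fun h => ?_, fun _ => hV, fun h => ?_, fun _ => rfl, fun h => ?_, fun m hm h => ?_⟩
  · simp only at h; omega
  · simp only; rwa [← hp, ← hl, anc_lev]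
  · simp only at h; omega
  · simp only at h; omega

theorem Legal.answer_child {p q : T.Pos} {V S : Set T.Pos} (hpq : T.Child p q)
    (hp : T.lev p = N + 1) (ht : T.Legal N O (p, V, ∅)) (hS : T.Answer N O V S) (hq : q ∈ S) :
    T.Legal N O (q, V, S) := by
  have hl := hpq.1
  refine ⟨fun h => ?_, fun h => ht.quasi (by simp only; omega), fun h => ?_, fun h => ?_,
    fun h => hS, fun m hm h => ?_⟩
  · simp only at h; omega
  · have := ht.quasi_mem (by simp only; omega)
    rwa [← hpq.anc_eq (by omega)] at this
  · simp only at h; omega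
  · simp only at h ⊢
    obtain rfl : m = T.lev q := by omega
    rwa [anc_lev]

theorem Answer.exists_child {p : T.Pos} {V S : Set T.Pos} (hV : T.QuasiStrat V)
    (hS : T.Answer N O V S) (hp : p ∈ S) : ∃ q, T.Child p q ∧ q ∈ S := by
  rcases hS with ⟨u, -, -, -, rfl⟩ | ⟨h1, -, h3⟩
  · exact exists_child_mem_cone hp
  · rcases Nat.mod_two_eq_zero_or_one (T.lev p) with h | h
    · obtain ⟨r, hr, hrV⟩ := (hV p (h1 hp)).2 h
      exact ⟨r, hr, (h3 p hp).1 h r hr hrV⟩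
    · exact (h3 p hp).2 h

theorem exists_answer {q : T.Pos} {V : Set T.Pos} (hV : T.QuasiStrat V) (hq : q ∈ V)
    (hl : T.lev q = N + 2) : ∃ S, T.Answer N O V S ∧ q ∈ S := by
  by_cases h : ∃ u ∈ V, u ∈ O ∧ T.lev q ≤ T.lev u ∧ T.anc (T.lev q) u = q
  · obtain ⟨u, huV, huO, hu1, hu2⟩ := h
    exact ⟨cone u, Or.inl ⟨u, huV, huO, by omega, rfl⟩, Or.inl ⟨hu1, hu2⟩⟩
  · refine ⟨{u | u ∈ V ∧ T.lev q ≤ T.lev u ∧ T.anc (T.lev q) u = q},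
      Or.inr ⟨fun u hu => hu.1, fun u hu hO => h ⟨u, hu.1, hO, hu.2⟩, fun u hu => ?_⟩,
      ⟨hq, le_rfl, anc_lev q⟩⟩
    have key : ∀ r, T.Child u r → r ∈ V →
        r ∈ {u | u ∈ V ∧ T.lev q ≤ T.lev u ∧ T.anc (T.lev q) u = q} := fun r hr hrV =>
      ⟨hrV, by have := hr.1; have := hu.2.1; omega, by rw [hr.anc_eq hu.2.1, hu.2.2]⟩
    refine ⟨fun _ => key, fun h1 => ?_⟩
    obtain ⟨r, hr⟩ := T.exists_child u
    exact ⟨r, hr, key r hr ((hV u hu.1).1 h1 r hr)⟩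

open Classical in
variable (T N O) in
/-- The game unravelling the closed set of the plays avoiding `O`. -/
noncomputable def unravel (hN : N % 2 = 0) : Arena where
  Pos := {t : T.Pos × Set T.Pos × Set T.Pos // T.Legal N O t}
  lev t := T.lev t.1.1
  par t := ⟨(T.par t.1.1, if T.lev t.1.1 ≤ N + 1 then ∅ else t.1.2.1,
      if T.lev t.1.1 ≤ N + 2 then ∅ else t.1.2.2),
    t.2.par (fun h => if_pos h) (fun h => if_neg (by omega)) (fun h => if_pos h)
      (fun h => if_neg (by omega))⟩
  lev_par t := T.lev_par _
  exists_child := by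
    rintro ⟨⟨p, V, S⟩, ht⟩
    have h1 := ht.quasi_empty
    have h2 := ht.answer_empty
    simp only at h1 h2
    rcases lt_trichotomy (T.lev p) (N + 1) with hp | hp | hp
    · obtain ⟨q, hq⟩ := T.exists_child p
      obtain rfl := h1 (by omega)
      obtain rfl := h2 (by omega)
      rcases Nat.lt_or_ge (T.lev p) N with hp' | hp'
      · refine ⟨⟨(q, ∅, ∅), .base (by omega)⟩, hq.1, Subtype.ext ?_⟩
        simp [hq.2]
      · refine ⟨⟨(q, Set.univ, ∅), .quasi_child hq (by omega) (fun r _ =>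
          ⟨fun _ _ _ => trivial, fun _ => ?_⟩) trivial⟩, hq.1, Subtype.ext ?_⟩
        · obtain ⟨s, hs⟩ := T.exists_child r
          exact ⟨s, hs, trivial⟩
        · simp only [hq.2, hq.1]
          rw [if_pos (by omega), if_pos (by omega)]
    · obtain ⟨q, hq⟩ := T.exists_child p
      obtain rfl := h2 (by omega)
      have hV := ht.quasi (by simp only; omega)
      have hpV := ht.quasi_mem (by simp only; omega)
      simp only at hV hpV
      rw [← hp, anc_lev] at hpV
      obtain ⟨S, hS, hqS⟩ := exists_answer (N := N) (O := O) hV ((hV p hpV).1 (by omega) q hq)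
        (by have := hq.1; omega)
      refine ⟨⟨(q, V, S), ht.answer_child hq hp hS hqS⟩, hq.1, Subtype.ext ?_⟩
      simp only [hq.2, hq.1]
      rw [if_neg (by omega), if_pos (by omega)]
    · have hpS := ht.answer_mem (T.lev p) (by omega) le_rfl
      simp only [anc_lev] at hpS
      obtain ⟨q, hq, hqS⟩ := (ht.answer hp).exists_child (ht.quasi (by simp only; omega)) hpS
      refine ⟨⟨(q, V, S), ht.child hq hp hqS⟩, hq.1, Subtype.ext ?_⟩
      simp only [hq.2, hq.1]
      rw [if_neg (by omega), if_neg (by omega)]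

variable {hN : N % 2 = 0}

variable (hN) in
/-- A legal triple as a position of the unravelled game. -/
def Legal.pos {t : T.Pos × Set T.Pos × Set T.Pos} (ht : T.Legal N O t) :
    (T.unravel N O hN).Pos := ⟨t, ht⟩

@[simp] theorem Legal.pos_val {t : T.Pos × Set T.Pos × Set T.Pos} (ht : T.Legal N O t) :
    (ht.pos hN).1 = t := rfl

@[simp] theorem unravel_lev (t : (T.unravel N O hN).Pos) :
    (T.unravel N O hN).lev t = T.lev t.1.1 := rfl

theorem unravel_mem_answer {t : (T.unravel N O hN).Pos} (ht : N + 2 ≤ T.lev t.1.1) :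
    t.1.1 ∈ t.1.2.2 := by
  simpa using t.2.answer_mem _ ht le_rfl

theorem unravel_child_iff {s t : (T.unravel N O hN).Pos} : (T.unravel N O hN).Child s t ↔
    T.Child s.1.1 t.1.1 ∧ (N < T.lev s.1.1 → t.1.2.1 = s.1.2.1) ∧
      (N + 1 < T.lev s.1.1 → t.1.2.2 = s.1.2.2) := by
  constructor
  · rintro ⟨h1, rfl⟩
    change T.lev t.1.1 = T.lev (T.par t.1.1) + 1 at h1
    refine ⟨⟨h1, rfl⟩, fun h => ?_, fun h => ?_⟩
    · change N < T.lev (T.par t.1.1) at h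
      exact (if_neg (by omega)).symm
    · change N + 1 < T.lev (T.par t.1.1) at h
      exact (if_neg (by omega)).symm
  · rintro ⟨h1, h2, h3⟩
    refine ⟨h1.1, Subtype.ext (Prod.ext h1.2 (Prod.ext ?_ ?_))⟩
    · change (if T.lev t.1.1 ≤ N + 1 then ∅ else t.1.2.1) = _
      have := h1.1
      split_ifs with h
      · rw [s.2.quasi_empty (by omega)]
      · exact h2 (by omega)
    · change (if T.lev t.1.1 ≤ N + 2 then ∅ else t.1.2.2) = _
      have := h1.1
      split_ifs with h
      · rw [s.2.answer_empty (by omega)]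
      · exact h3 (by omega)

theorem unravel_isPlay {y : ℕ → (T.unravel N O hN).Pos} (h0 : T.lev (y 0).1.1 = 0)
    (h : ∀ n, (T.unravel N O hN).Child (y n) (y (n + 1))) : (T.unravel N O hN).IsPlay y := by
  refine ⟨fun n => ?_, fun n => (h n).2⟩
  induction n with
  | zero => exact h0
  | succ n ih => rw [(h n).1, ih]

open Classical in
/-- The move of `σ` at the position `p` with auxiliary data `V` and `S`; where this makes no sense,
a move to a position in `C`. -/
noncomputable def followMove (σ : (T.unravel N O hN).Strat) (p : T.Pos) (V S C : Set T.Pos) :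
    T.Pos :=
  if h : ∃ t : (T.unravel N O hN).Pos, t.1 = (p, V, S) then (σ.move h.choose).1.1
  else if h : ∃ q, T.Child p q ∧ q ∈ C then h.choose
  else (T.exists_child p).choose

/-- Follow a strategy for the unravelled game at the positions with auxiliary data `V` and `S`;
where this makes no sense, make a move allowed by `C`. -/
noncomputable def follow (σ : (T.unravel N O hN).Strat) (V S C : T.Pos → Set T.Pos) : T.Strat where
  move p := followMove σ p (V p) (S p) (C p)
  child p := by
    rw [followMove]
    split_ifs with h1 h2
    · have := (unravel_child_iff.1 (σ.child h1.choose)).1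
      rwa [h1.choose_spec] at this
    · exact h2.choose_spec.1
    · exact (T.exists_child p).choose_spec

section Follow

variable {σ τ : (T.unravel N O hN).Strat} {V S C V' S' C' : T.Pos → Set T.Pos}

theorem follow_apply {p : T.Pos} (t : (T.unravel N O hN).Pos) (ht : t.1 = (p, V p, S p)) :
    (follow σ V S C).move p = (σ.move t).1.1 := by
  have h : ∃ s : (T.unravel N O hN).Pos, s.1 = (p, V p, S p) := ⟨t, ht⟩
  have e : h.choose = t := Subtype.ext (h.choose_spec.trans ht.symm)
  change followMove σ _ _ _ _ = _
  rw [followMove, dif_pos h, e]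

theorem follow_of_not {p : T.Pos} (h : ¬ T.Legal N O (p, V p, S p))
    (hC : ∃ q, T.Child p q ∧ q ∈ C p) :
    (follow σ V S C).move p ∈ C p := by
  have h' : ¬ ∃ t : (T.unravel N O hN).Pos, t.1 = (p, V p, S p) := fun ⟨t, ht⟩ => h (ht ▸ t.2)
  change followMove σ _ _ _ _ ∈ _
  rw [followMove, dif_neg h', dif_pos hC]
  exact hC.choose_spec.2

theorem follow_congr {p : T.Pos} (h : ∀ t : (T.unravel N O hN).Pos, t.1.1 = p → σ.move t = τ.move t)
    (hV : V p = V' p) (hS : S p = S' p) (hC : C p = C' p) :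
    (follow σ V S C).move p = (follow τ V' S' C').move p := by
  change followMove σ _ _ _ _ = followMove τ _ _ _ _
  have e : ∀ h1 : ∃ t : (T.unravel N O hN).Pos, t.1 = (p, V' p, S' p),
      σ.move h1.choose = τ.move h1.choose := fun h1 => h _ (by rw [h1.choose_spec])
  rw [hV, hS, hC]
  simp only [followMove, e]

end Follow

/-- A play of `T` together with auxiliary data is a play of the unravelled game. -/
theorem exists_unravel_play {x : ℕ → T.Pos} (hx : T.IsPlay x) {V S : Set T.Pos}
    (hV : T.QuasiStrat V) (hxV : x (N + 1) ∈ V) (hS : T.Answer N O V S)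
    (hxS : ∀ n, N + 2 ≤ n → x n ∈ S) :
    ∃ y : ℕ → (T.unravel N O hN).Pos, (T.unravel N O hN).IsPlay y ∧
      ∀ n, (y n).1 = (x n, if n ≤ N then ∅ else V, if n ≤ N + 1 then ∅ else S) := by
  have key : ∀ n, T.Legal N O (x n, if n ≤ N then ∅ else V, if n ≤ N + 1 then ∅ else S) := by
    intro n
    constructor <;> simp only [hx.lev]
    · exact fun h => if_pos h
    · intro h; rwa [if_neg (by omega)]
    · intro h; rwa [if_neg (by omega), hx.anc_eq (by omega)]
    · exact fun h => if_pos h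
    · intro h; rwa [if_neg (by omega), if_neg (by omega)]
    · intro m hm h
      rw [if_neg (by omega), hx.anc_eq h]
      exact hxS m hm
  refine ⟨fun n => (key n).pos hN, unravel_isPlay (hx.lev 0) fun n => ?_, fun n => rfl⟩
  rw [unravel_child_iff]
  simp only [hx.lev, Legal.pos_val]
  refine ⟨hx.child n, fun h => ?_, fun h => ?_⟩
  · rw [if_neg (by omega), if_neg (by omega)]
  · rw [if_neg (by omega), if_neg (by omega)]

theorem unravel_child_ext {p s t : (T.unravel N O hN).Pos} (hs : (T.unravel N O hN).Child p s)
    (ht : (T.unravel N O hN).Child p t) (h : s.1.1 = t.1.1)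
    (hV : T.lev p.1.1 = N → s.1.2.1 = t.1.2.1) (hS : T.lev p.1.1 = N + 1 → s.1.2.2 = t.1.2.2) :
    s = t := by
  rw [unravel_child_iff] at hs ht
  have hs1 := hs.1.1
  have ht1 := ht.1.1
  refine Subtype.ext (Prod.ext h (Prod.ext ?_ ?_))
  · rcases lt_trichotomy (T.lev p.1.1) N with h' | h' | h'
    · rw [s.2.quasi_empty (by omega), t.2.quasi_empty (by omega)]
    · exact hV h'
    · rw [hs.2.1 h', ht.2.1 h']
  · rcases lt_trichotomy (T.lev p.1.1) (N + 1) with h' | h' | h'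
    · rw [s.2.answer_empty (by omega), t.2.answer_empty (by omega)]
    · exact hS h'
    · rw [hs.2.2 h', ht.2.2 h']

/-- When the answer is a cone, the moves up to its vertex are forced. -/
theorem unravel_forced {x : ℕ → T.Pos} (hx : T.IsPlay x) {m n : ℕ}
    {s t : (T.unravel N O hN).Pos} (ht : (T.unravel N O hN).Child s t) (hs : T.lev s.1.1 = n)
    (hn : N + 1 ≤ n) (hm : n < m) (hS : t.1.2.2 = cone (x m)) : t.1.1 = x (n + 1) := by
  have ht1 := (unravel_child_iff.1 ht).1.1
  have h := t.2.answer_mem (T.lev t.1.1) (by omega) le_rfl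
  rw [anc_lev, hS] at h
  rw [eq_anc_of_mem_cone h (by rw [hx.lev]; omega), ht1, hs, hx.anc_eq (by omega)]

section Hit

variable (N) in
/-- Some ancestor of `p` after level `N + 2` lies in `Z`. -/
def Hit (Z : Set T.Pos) (p : T.Pos) : Prop := ∃ m, N + 2 ≤ m ∧ m ≤ T.lev p ∧ T.anc m p ∈ Z

variable (N) in
/-- The first ancestor of `p` after level `N + 2` which lies in `Z`. -/
noncomputable def firstHit (Z : Set T.Pos) (p : T.Pos) : T.Pos :=
  T.anc (sInf {m | N + 2 ≤ m ∧ m ≤ T.lev p ∧ T.anc m p ∈ Z}) p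

variable {x : ℕ → T.Pos} {Z : Set T.Pos} {m n : ℕ}

theorem IsPlay.hit_iff (hx : T.IsPlay x) : Hit N Z (x n) ↔ ∃ m, N + 2 ≤ m ∧ m ≤ n ∧ x m ∈ Z := by
  rw [Hit, hx.lev]
  refine exists_congr fun m => and_congr_right fun _ => and_congr_right fun h => ?_
  rw [hx.anc_eq h]

theorem IsPlay.firstHit_eq (hx : T.IsPlay x) (hm : N + 2 ≤ m) (hZ : x m ∈ Z)
    (hmin : ∀ k, N + 2 ≤ k → k < m → x k ∉ Z) (hmn : m ≤ n) : firstHit N Z (x n) = x m := by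
  have h : sInf {m | N + 2 ≤ m ∧ m ≤ T.lev (x n) ∧ T.anc m (x n) ∈ Z} = m := by
    refine (IsLeast.csInf_eq ⟨⟨hm, by rwa [hx.lev], by rwa [hx.anc_eq hmn]⟩, fun k hk => ?_⟩)
    by_contra! hlt
    have hk3 := hk.2.2
    rw [hx.anc_eq (by omega)] at hk3
    exact hmin k hk.1 hlt hk3
  rw [firstHit, h, hx.anc_eq hmn]

theorem exists_first_hit (h : ∃ m, N + 2 ≤ m ∧ x m ∈ Z) :
    ∃ m, N + 2 ≤ m ∧ x m ∈ Z ∧ ∀ k, N + 2 ≤ k → k < m → x k ∉ Z := by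
  classical
  refine ⟨Nat.find h, (Nat.find_spec h).1, (Nat.find_spec h).2, fun k hk hlt hZ => ?_⟩
  exact Nat.find_min h hlt ⟨hk, hZ⟩

end Hit

section PushTrue

open Classical in
/-- The quasi-strategy played by `σ` before the position `p`. -/
noncomputable def quasiTrue (σ : (T.unravel N O hN).Strat) (p : T.Pos) : Set T.Pos :=
  if T.lev p ≤ N then ∅ else (σ.move ((Legal.base (lev_anc_le N p)).pos hN)).1.2.1

variable (N O) in
open Classical in
/-- The imagined answer to the quasi-strategy `V`, as seen from `p`. -/
noncomputable def answerTrue (V : Set T.Pos) (p : T.Pos) : Set T.Pos :=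
  if T.lev p ≤ N + 1 then ∅
  else if Hit N (V ∩ O) p then cone (firstHit N (V ∩ O) p) else V \ win true (V ∩ O) V

variable (O) in
/-- The good moves at `p` inside the quasi-strategy `V`. -/
def goodTrue (V : Set T.Pos) (p : T.Pos) : Set T.Pos :=
  {q | q ∈ V ∧ q ∈ win true (V ∩ O) V ∧ rank true (V ∩ O) V q < rank true (V ∩ O) V p}

/-- The strategy of player `true` in `T` derived from one in the unravelled game. -/
noncomputable def pushTrue (σ : (T.unravel N O hN).Strat) : T.Strat :=
  follow σ (quasiTrue σ) (fun p => answerTrue N O (quasiTrue σ p) p)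
    (fun p => goodTrue O (quasiTrue σ p) p)

theorem pushTrue_low (σ : (T.unravel N O hN).Strat) (t : (T.unravel N O hN).Pos)
    (ht : T.lev t.1.1 ≤ N) : (pushTrue σ).move t.1.1 = (σ.move t).1.1 := by
  refine follow_apply t (Prod.ext rfl (Prod.ext ?_ ?_))
  · simp [quasiTrue, ht, t.2.quasi_empty ht]
  · have : T.lev t.1.1 ≤ N + 1 := by omega
    simp [answerTrue, this, t.2.answer_empty this]

theorem pushTrue_congr (σ τ : (T.unravel N O hN).Strat) (n : ℕ)
    (h : ∀ t, (T.unravel N O hN).lev t < n → σ.move t = τ.move t) (p : T.Pos) (hp : T.lev p < n) :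
    (pushTrue σ).move p = (pushTrue τ).move p := by
  have hV : quasiTrue σ p = quasiTrue τ p := by
    rw [quasiTrue, quasiTrue]
    split_ifs with h1
    · rfl
    · rw [h]
      change T.lev (T.anc N p) < n
      rw [lev_anc (by omega)]
      omega
  refine follow_congr (fun t ht => h t ?_) hV (by simp only [hV]) (by simp only [hV])
  change T.lev t.1.1 < n
  rwa [ht]

theorem pushTrue_lift (σ : (T.unravel N O hN).Strat) (x : ℕ → T.Pos) (hx : T.IsPlay x)
    (hc : Consistent true (pushTrue σ) x) : ∃ y, (T.unravel N O hN).IsPlay y ∧ Consistent true σ y ∧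
      ∀ n, (y n).1.1 = x n := by
  have hNl : T.Legal N O (x N, ∅, ∅) := .base (hx.lev N).le
  set V := (σ.move (hNl.pos hN)).1.2.1 with hVdef
  have hV : ∀ n, N < n → quasiTrue σ (x n) = V := by
    intro n hn
    rw [quasiTrue, if_neg (by rw [hx.lev]; omega), hVdef]
    simp only [hx.anc_eq hn.le]
  have hlow : ∀ t : (T.unravel N O hN).Pos, ∀ n ≤ N, Turn true n → t.1.1 = x n →
      (σ.move t).1.1 = x (n + 1) := by
    intro t n hn hn' ht
    rw [hc n hn', ← ht, pushTrue_low σ t (by rw [ht, hx.lev]; exact hn)]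
  have hσN := hlow (hNl.pos hN) N le_rfl (by simpa using hN) rfl
  have hσl : N < T.lev (σ.move (hNl.pos hN)).1.1 := by rw [hσN, hx.lev]; omega
  have hquasi : T.QuasiStrat V := (σ.move (hNl.pos hN)).2.quasi hσl
  have hV1 : x (N + 1) ∈ V := by
    have := (σ.move (hNl.pos hN)).2.quasi_mem hσl
    rwa [hσN, hx.anc_eq le_rfl] at this
  -- it is enough to follow `σ` beyond level `N + 2`
  have main : ∀ S, T.Answer N O V S → (∀ n, N + 2 ≤ n → x n ∈ S) →
      (∀ n, N + 2 ≤ n → Turn true n → ∀ t : (T.unravel N O hN).Pos, t.1 = (x n, V, S) →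
        (σ.move t).1.1 = x (n + 1)) →
      ∃ y, (T.unravel N O hN).IsPlay y ∧ Consistent true σ y ∧ ∀ n, (y n).1.1 = x n := by
    intro S hS hxS h
    obtain ⟨y, hy, hyx⟩ := exists_unravel_play (hN := hN) hx hquasi hV1 hS hxS
    refine ⟨y, hy, fun n hn => ?_, fun n => by rw [hyx]⟩
    have hn2 : n % 2 = 0 := by simpa using hn
    have hlev : T.lev (y n).1.1 = n := hy.lev n
    refine unravel_child_ext (hy.child n) (σ.child _) ?_ (fun h' => ?_) (fun h' => ?_)
    · rw [hyx]
      rcases Nat.lt_or_ge N n with h' | h'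
      · exact (h n (by omega) hn _ (by
          rw [hyx, if_neg (by omega), if_neg (by omega)])).symm
      · exact (hlow (y n) n h' hn (by rw [hyx])).symm
    · obtain rfl : n = N := by omega
      have e : y n = hNl.pos hN := Subtype.ext (by simp [hyx])
      rw [e, ← hVdef, hyx, if_neg (by omega)]
    · omega
  by_cases h : ∃ m, N + 2 ≤ m ∧ x m ∈ V ∩ O
  · obtain ⟨m, hm, hmZ, hmin⟩ := exists_first_hit h
    refine main (cone (x m)) (Or.inl ⟨x m, hmZ.1, hmZ.2, by rwa [hx.lev], rfl⟩)
      (fun n _ => hx.mem_cone m n) fun n hn hn' t ht => ?_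
    rcases Nat.lt_or_ge n m with hnm | hnm
    · have htl : T.lev t.1.1 = n := by rw [ht, hx.lev]
      refine unravel_forced hx (σ.child t) htl (by omega) hnm ?_
      rw [(unravel_child_iff.1 (σ.child t)).2.2 (by omega), ht]
    · rw [hc n hn']
      refine (follow_apply t ?_).symm
      rw [ht, hV n (by omega), answerTrue, if_neg (by rw [hx.lev]; omega),
        if_pos (hx.hit_iff.2 ⟨m, hm, hnm, hmZ⟩), hx.firstHit_eq hm hmZ hmin hnm]
  · push Not at h
    have hans : ∀ n, N + 2 ≤ n →
        answerTrue N O (quasiTrue σ (x n)) (x n) = V \ win true (V ∩ O) V := by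
      intro n hn
      rw [hV n (by omega), answerTrue, if_neg (by rw [hx.lev]; omega), if_neg]
      rw [hx.hit_iff]
      rintro ⟨m, hm, -, hmZ⟩
      exact h m hm hmZ
    set R := win true (V ∩ O) V with hR
    have hstep : ∀ n ≥ N + 2, Turn true n → x n ∈ R →
        x (n + 1) ∈ goodTrue O (quasiTrue σ (x n)) (x n) := by
      intro n hn hn' hnR
      rw [hc n hn']
      refine follow_of_not (fun hl => ?_) ?_
      · have := hl.answer_mem n hn (hx.lev n).ge
        simp only [hans n hn, hx.anc_eq le_rfl] at this
        exact this.2 hnR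
      · rw [hV n (by omega)]
        exact exists_child_rank_lt hnR (h n hn) (by rwa [hx.lev])
    have hno : ∀ n ≥ N + 2, x n ∈ V → x n ∉ R := by
      intro n hn hnV hnR
      obtain ⟨m, hm, hmZ⟩ := exists_mem_of_rank_lt hx hnR hnV (fun k _ hk' hkV =>
          (hquasi _ hkV).1 (by rw [hx.lev]; simpa using hk') _ (hx.child k))
        (fun k hk hk' hkR => by
          have := hstep k (by omega) hk' hkR
          rwa [hV k (by omega)] at this)
      exact h m (by omega) hmZ
    have hS : T.Answer N O V (V \ R) := by
      refine Or.inr ⟨Set.sdiff_subset, fun q hq hqO => hq.2 (subset_win ⟨hq.1, hqO⟩),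
        fun q hq => ⟨fun hq' r hr hrV => ?_, fun hq' => ?_⟩⟩
      · exact ⟨hrV, notMem_win_of_child hq.2 (by simpa using hq') hr hrV⟩
      · obtain ⟨r, hr, hrV, hrR⟩ := exists_child_notMem_win hq.2 (by simpa using hq')
        exact ⟨r, hr, hrV, hrR⟩
    have hlegal : ∀ n ≥ N + 2, T.Legal N O (x n, V, V \ R) := by
      intro n hn
      induction n, hn using Nat.le_induction with
      | base =>
        have hV2 : x (N + 2) ∈ V := (hquasi _ hV1).1 (by rw [hx.lev]; omega) _ (hx.child _)
        exact .answer_child (hx.child _) (hx.lev _)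
          (.quasi_child (hx.child N) (hx.lev N) hquasi hV1) hS ⟨hV2, hno _ le_rfl hV2⟩
      | succ n hn ih =>
        refine ih.child (hx.child n) (by rw [hx.lev]; omega) ?_
        have hnS : x n ∈ V \ R := unravel_mem_answer (t := ih.pos hN) (by simpa [hx.lev] using hn)
        by_cases hn' : Turn true n
        · have e : x (n + 1) = (σ.move (ih.pos hN)).1.1 := by
            rw [hc n hn']
            exact follow_apply _ (by rw [Legal.pos_val, hans n hn, hV n (by omega)])
          have hch := unravel_child_iff.1 (σ.child (ih.pos hN))
          have h2 := hch.2.2 (by simp [hx.lev]; omega)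
          have h3 := unravel_mem_answer (t := σ.move (ih.pos hN)) (by rw [← e, hx.lev]; omega)
          rwa [h2, ← e] at h3
        · have hV2 : x (n + 1) ∈ V :=
            (hquasi _ hnS.1).1 (by rw [hx.lev]; simpa using hn') _ (hx.child _)
          exact ⟨hV2, hno _ (by omega) hV2⟩
    refine main _ hS (fun n hn => ?_) fun n hn hn' t ht => ?_
    · exact unravel_mem_answer (t := (hlegal n hn).pos hN) (by simpa [hx.lev] using hn)
    · rw [hc n hn']
      exact (follow_apply t (by rw [ht, hans n hn, hV n (by omega)])).symm

end PushTrue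

section PushFalse

/-- At the position `a` of level `N + 1`, the strategy `σ` answers the quasi-strategy of `t` by `u`. -/
def Witness (σ : (T.unravel N O hN).Strat) (a u : T.Pos) (t : (T.unravel N O hN).Pos) : Prop :=
  t.1.1 = a ∧ u ∈ t.1.2.1 ∧ u ∈ O ∧ N + 2 ≤ T.lev u ∧ (σ.move t).1.2.2 = cone u

/-- The positions `u` which are answers to some quasi-strategy. -/
def target (K : T.Pos → (T.unravel N O hN).Pos → Prop) : Set T.Pos := {u | ∃ t, K u t}

open Classical in
/-- A quasi-strategy to which `u` is an answer. -/
noncomputable def witnessed (K : T.Pos → (T.unravel N O hN).Pos → Prop) (u : T.Pos) : Set T.Pos :=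
  if h : ∃ t, K u t then h.choose.1.2.1 else ∅

/-- The positions from which player `false` cannot force the play into the target. -/
def avoid (K : T.Pos → (T.unravel N O hN).Pos → Prop) : Set T.Pos :=
  (win false (target K) Set.univ)ᶜ

open Classical in
/-- The answer of `σ` to the quasi-strategy `V`. -/
noncomputable def reply (σ : (T.unravel N O hN).Strat) (a : T.Pos) (V : Set T.Pos) : Set T.Pos :=
  if h : ∃ t : (T.unravel N O hN).Pos, t.1 = (a, V, ∅) then (σ.move h.choose).1.2.2 else ∅

open Classical in
/-- The imagined quasi-strategy of player `true`, as seen from `p`. -/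
noncomputable def quasiFalse (K : T.Pos → (T.unravel N O hN).Pos → Prop) (p : T.Pos) :
    Set T.Pos :=
  if T.lev p ≤ N then ∅
  else if Hit N (target K) p then witnessed K (firstHit N (target K) p)
  else avoid K

open Classical in
/-- The answer to the imagined quasi-strategy, as seen from `p`. -/
noncomputable def answerFalse (K : T.Pos → (T.unravel N O hN).Pos → Prop) (S : Set T.Pos)
    (p : T.Pos) : Set T.Pos :=
  if T.lev p ≤ N + 1 then ∅
  else if Hit N (target K) p then cone (firstHit N (target K) p) else S

/-- The moves at `p` towards the target. -/
def goodFalse (K : T.Pos → (T.unravel N O hN).Pos → Prop) (p : T.Pos) : Set T.Pos :=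
  {q | q ∈ Set.univ ∧ q ∈ win false (target K) Set.univ ∧
    rank false (target K) Set.univ q < rank false (target K) Set.univ p}

/-- The strategy of player `false` in `T` derived from one in the unravelled game. -/
noncomputable def pushFalse (σ : (T.unravel N O hN).Strat) : T.Strat :=
  follow σ (fun p => quasiFalse (Witness σ (T.anc (N + 1) p)) p)
    (fun p => answerFalse (Witness σ (T.anc (N + 1) p))
      (reply σ (T.anc (N + 1) p) (avoid (Witness σ (T.anc (N + 1) p)))) p)
    (fun p => goodFalse (Witness σ (T.anc (N + 1) p)) p)

theorem pushFalse_low (σ : (T.unravel N O hN).Strat) (t : (T.unravel N O hN).Pos)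
    (ht : T.lev t.1.1 ≤ N) : (pushFalse σ).move t.1.1 = (σ.move t).1.1 := by
  refine follow_apply t (Prod.ext rfl (Prod.ext ?_ ?_))
  · simp [quasiFalse, ht, t.2.quasi_empty ht]
  · have : T.lev t.1.1 ≤ N + 1 := by omega
    simp [answerFalse, this, t.2.answer_empty this]

theorem pushFalse_congr (σ τ : (T.unravel N O hN).Strat) (n : ℕ)
    (h : ∀ t, (T.unravel N O hN).lev t < n → σ.move t = τ.move t) (p : T.Pos) (hp : T.lev p < n) :
    (pushFalse σ).move p = (pushFalse τ).move p := by
  have hpos : ∀ t : (T.unravel N O hN).Pos, t.1.1 = p → σ.move t = τ.move t := fun t ht =>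
    h t (by rwa [unravel_lev, ht])
  rcases Nat.lt_or_ge N (T.lev p) with hl | hl
  · have hanc : ∀ t : (T.unravel N O hN).Pos, t.1.1 = T.anc (N + 1) p → σ.move t = τ.move t :=
      fun t ht => h t (by rw [unravel_lev, ht, lev_anc hl]; omega)
    have hK : Witness σ (T.anc (N + 1) p) = Witness τ (T.anc (N + 1) p) := by
      funext u t
      exact propext (and_congr_right fun ht => by rw [hanc t ht])
    have hr : ∀ V, reply σ (T.anc (N + 1) p) V = reply τ (T.anc (N + 1) p) V := by
      intro V
      have e : ∀ h1 : ∃ t : (T.unravel N O hN).Pos, t.1 = (T.anc (N + 1) p, V, ∅),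
        σ.move h1.choose = τ.move h1.choose := fun h1 => hanc _ (by rw [h1.choose_spec])
      simp only [reply, e]
    exact follow_congr hpos (by simp only [hK]) (by simp only [hK, hr]) (by simp only [hK])
  · have h1 : ∃ t : (T.unravel N O hN).Pos, t.1.1 = p := ⟨(Legal.base hl).pos hN, rfl⟩
    obtain ⟨t, rfl⟩ := h1
    rw [pushFalse_low σ t hl, pushFalse_low τ t hl, hpos t rfl]

theorem avoid_quasiStrat (K : T.Pos → (T.unravel N O hN).Pos → Prop) : T.QuasiStrat (avoid K) := by
  refine fun q hq => ⟨fun hq' r hr => ?_, fun hq' => ?_⟩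
  · exact notMem_win_of_child hq (by simpa using hq') hr trivial
  · obtain ⟨r, hr, -, hrR⟩ := exists_child_notMem_win hq (by simpa using hq')
    exact ⟨r, hr, hrR⟩

theorem reply_eq (σ : (T.unravel N O hN).Strat) {a : T.Pos} {V : Set T.Pos}
    {t : (T.unravel N O hN).Pos} (ht : t.1 = (a, V, ∅)) : reply σ a V = (σ.move t).1.2.2 := by
  have h : ∃ t : (T.unravel N O hN).Pos, t.1 = (a, V, ∅) := ⟨t, ht⟩
  have e : h.choose = t := Subtype.ext (h.choose_spec.trans ht.symm)
  rw [reply, dif_pos h, e]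

/-- The quasi-strategy `avoid` is never answered by a position. -/
theorem answer_avoid (σ : (T.unravel N O hN).Strat) {a : T.Pos} (ha : T.lev a = N + 1)
    {t : (T.unravel N O hN).Pos} (ht : t.1 = (a, avoid (Witness σ a), ∅)) :
    (σ.move t).1.2.2 ⊆ avoid (Witness σ a) ∧ (∀ q ∈ (σ.move t).1.2.2, T.lev q % 2 = 0 →
      ∀ r, T.Child q r → r ∈ avoid (Witness σ a) → r ∈ (σ.move t).1.2.2) := by
  have hta : t.1.1 = a := by rw [ht]
  have htV : t.1.2.1 = avoid (Witness σ a) := by rw [ht]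
  have hch := unravel_child_iff.1 (σ.child t)
  rw [hta] at hch
  have hlev := hch.1.1
  have hans := (σ.move t).2.answer (by omega)
  rw [hch.2.1 (by omega), htV] at hans
  rcases hans with ⟨u, huV, huO, hul, hS⟩ | ⟨h1, -, h3⟩
  · exact absurd (subset_win (show u ∈ target (Witness σ a) from
      ⟨t, hta, by rwa [htV], huO, hul, hS⟩)) huV
  · exact ⟨h1, fun q hq => (h3 q hq).1⟩

theorem reply_subset (σ : (T.unravel N O hN).Strat) {a : T.Pos} (ha : T.lev a = N + 1) :
    reply σ a (avoid (Witness σ a)) ⊆ avoid (Witness σ a) := by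
  by_cases h : ∃ t : (T.unravel N O hN).Pos, t.1 = (a, avoid (Witness σ a), ∅)
  · obtain ⟨t, ht⟩ := h
    rw [reply_eq σ ht]
    exact (answer_avoid σ ha ht).1
  · rw [reply, dif_neg h]
    exact Set.empty_subset _

theorem pushFalse_lift (σ : (T.unravel N O hN).Strat) (x : ℕ → T.Pos) (hx : T.IsPlay x)
    (hc : Consistent false (pushFalse σ) x) : ∃ y, (T.unravel N O hN).IsPlay y ∧
      Consistent false σ y ∧ ∀ n, (y n).1.1 = x n := by
  set K := Witness σ (x (N + 1)) with hK
  have hmove : ∀ n, N < n → Turn false n → ∀ t : (T.unravel N O hN).Pos,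
      t.1 = (x n, quasiFalse K (x n), answerFalse K (reply σ (x (N + 1)) (avoid K)) (x n)) →
      (σ.move t).1.1 = x (n + 1) := by
    intro n hn hn' t ht
    rw [hc n hn']
    refine (follow_apply t ?_).symm
    simp only [hx.anc_eq (show N + 1 ≤ n from hn)]
    exact ht
  have hlow : ∀ t : (T.unravel N O hN).Pos, ∀ n ≤ N, Turn false n → t.1.1 = x n →
      (σ.move t).1.1 = x (n + 1) := by
    intro t n hn hn' ht
    rw [hc n hn', ← ht, pushFalse_low σ t (by rw [ht, hx.lev]; exact hn)]
  -- it is enough to follow `σ` beyond level `N + 1`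
  have main : ∀ t : (T.unravel N O hN).Pos, t.1.1 = x (N + 1) →
      (∀ n, N + 2 ≤ n → x n ∈ (σ.move t).1.2.2) → (σ.move t).1.1 = x (N + 2) →
      (∀ n, N + 2 ≤ n → Turn false n → ∀ s : (T.unravel N O hN).Pos,
        s.1 = (x n, t.1.2.1, (σ.move t).1.2.2) → (σ.move s).1.1 = x (n + 1)) →
      ∃ y, (T.unravel N O hN).IsPlay y ∧ Consistent false σ y ∧ ∀ n, (y n).1.1 = x n := by
    intro t ht hxS hσt h
    have htl : T.lev t.1.1 = N + 1 := by rw [ht, hx.lev]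
    have hVmem := t.2.quasi_mem (by omega)
    rw [ht, hx.anc_eq le_rfl] at hVmem
    have hS := (σ.move t).2.answer (by rw [hσt, hx.lev]; omega)
    rw [(unravel_child_iff.1 (σ.child t)).2.1 (by omega)] at hS
    obtain ⟨y, hy, hyx⟩ := exists_unravel_play (hN := hN) hx (t.2.quasi (by omega)) hVmem hS hxS
    refine ⟨y, hy, fun n hn => ?_, fun n => by rw [hyx]⟩
    have hn2 : n % 2 = 1 := by simpa using hn
    have hlev : T.lev (y n).1.1 = n := hy.lev n
    have hyt : n = N + 1 → y n = t := by
      rintro rfl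
      refine Subtype.ext ?_
      rw [hyx, if_neg (by omega), if_pos le_rfl, ← ht, ← t.2.answer_empty (by omega)]
    refine unravel_child_ext (hy.child n) (σ.child _) ?_ (fun h' => ?_) (fun h' => ?_)
    · rw [hyx]
      rcases lt_trichotomy n (N + 1) with h' | h' | h'
      · exact (hlow (y n) n (by omega) hn (by rw [hyx])).symm
      · rw [hyt h', hσt, h']
      · exact (h n (by omega) hn _ (by
          rw [hyx, if_neg (by omega), if_neg (by omega)])).symm
    · omega
    · rw [hyt (by omega), hyx]
      exact if_neg (by omega)
  by_cases h : ∃ m, N + 2 ≤ m ∧ x m ∈ target K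
  · obtain ⟨m, hm, hmZ, hmin⟩ := exists_first_hit h
    have hw : ∃ t, K (x m) t := hmZ
    obtain ⟨ht, -, -, -, hS⟩ := hw.choose_spec
    have hV : witnessed K (x m) = hw.choose.1.2.1 := dif_pos hw
    have htl : T.lev hw.choose.1.1 = N + 1 := by rw [ht, hx.lev]
    refine main hw.choose ht (fun n _ => ?_) ?_ fun n hn hn' s hs => ?_
    · rw [hS]; exact hx.mem_cone m n
    · exact unravel_forced hx (σ.child _) htl le_rfl (by omega) hS
    · rcases Nat.lt_or_ge n m with hnm | hnm
      · have hsl : T.lev s.1.1 = n := by rw [hs, hx.lev]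
        refine unravel_forced hx (σ.child s) hsl (by omega) hnm ?_
        rw [(unravel_child_iff.1 (σ.child s)).2.2 (by omega), hs, hS]
      · refine hmove n (by omega) hn' s ?_
        have hhit : Hit N (target K) (x n) := hx.hit_iff.2 ⟨m, hm, hnm, hmZ⟩
        rw [hs, hS, quasiFalse, if_neg (by rw [hx.lev]; omega), if_pos hhit, answerFalse,
          if_neg (by rw [hx.lev]; omega), if_pos hhit, hx.firstHit_eq hm hmZ hmin hnm, hV]
  · push Not at h
    have hhit : ∀ n, ¬ Hit N (target K) (x n) := by
      intro n
      rw [hx.hit_iff]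
      rintro ⟨m, hm, -, hmZ⟩
      exact h m hm hmZ
    have hquasi : ∀ n, N < n → quasiFalse K (x n) = avoid K := by
      intro n hn
      rw [quasiFalse, if_neg (by rw [hx.lev]; omega), if_neg (hhit n)]
    have hans : ∀ n, N + 2 ≤ n → answerFalse K (reply σ (x (N + 1)) (avoid K)) (x n) =
        reply σ (x (N + 1)) (avoid K) := by
      intro n hn
      rw [answerFalse, if_neg (by rw [hx.lev]; omega), if_neg (hhit n)]
    have hla : T.lev (x (N + 1)) = N + 1 := hx.lev _
    have hU : ∀ n, x n ∉ target K := by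
      intro n hn
      have hn' := hn
      obtain ⟨t, -, -, -, hl, -⟩ := hn'
      exact h n (by rwa [hx.lev] at hl) hn
    have hstep : ∀ n, N < n → Turn false n → x n ∈ win false (target K) Set.univ →
        x (n + 1) ∈ goodFalse K (x n) := by
      intro n hn hn' hnR
      have hKn : Witness σ (T.anc (N + 1) (x n)) = K := by rw [hx.anc_eq hn]
      rw [hc n hn', ← hKn]
      refine follow_of_not (fun hl => ?_) ?_
      · rw [hKn, hx.anc_eq hn, hquasi n hn] at hl
        rcases Nat.lt_or_ge (N + 1) n with h' | h'
        · have := hl.answer_mem n h' (hx.lev n).ge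
          simp only [hans n h', hx.anc_eq le_rfl] at this
          exact reply_subset σ hla this hnR
        · obtain rfl : n = N + 1 := by omega
          have := hl.quasi_mem (by rw [hx.lev]; omega)
          simp only [hx.anc_eq le_rfl] at this
          exact this hnR
      · rw [hKn]
        exact exists_child_rank_lt hnR (hU n) (by rwa [hx.lev])
    have hno : ∀ n, N < n → x n ∈ avoid K := by
      intro n hn hnR
      obtain ⟨m, hm, hmZ⟩ := exists_mem_of_rank_lt hx hnR trivial (fun _ _ _ _ => trivial)
        (fun k hk hk' hkR => hstep k (by omega) hk' hkR)
      exact hU m hmZ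
    have hta : T.Legal N O (x (N + 1), avoid K, ∅) :=
      .quasi_child (hx.child N) (hx.lev N) (avoid_quasiStrat K) (hno _ (by omega))
    have hr : reply σ (x (N + 1)) (avoid K) = (σ.move (hta.pos hN)).1.2.2 := reply_eq σ rfl
    have hav := answer_avoid σ hla (t := hta.pos hN) rfl
    have hσt : (σ.move (hta.pos hN)).1.1 = x (N + 2) := by
      refine hmove (N + 1) (by omega) (by simp; omega) _ ?_
      rw [hquasi _ (by omega), answerFalse, if_pos hla.le, Legal.pos_val]
    have hmem : ∀ n ≥ N + 2, T.Legal N O (x n, avoid K, (σ.move (hta.pos hN)).1.2.2) := by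
      intro n hn
      induction n, hn using Nat.le_induction with
      | base =>
        have h1 := (σ.move (hta.pos hN)).2
        have h2 := (unravel_child_iff.1 (σ.child (hta.pos hN))).2.1
          (by rw [Legal.pos_val, hx.lev]; omega)
        have e : (σ.move (hta.pos hN)).1 = (x (N + 2), avoid K, (σ.move (hta.pos hN)).1.2.2) :=
          Prod.ext hσt (Prod.ext h2 rfl)
        rwa [e] at h1
      | succ n hn ih =>
        refine ih.child (hx.child n) (by rw [hx.lev]; omega) ?_
        by_cases hn' : Turn false n
        · have e := hmove n (by omega) hn' (ih.pos hN)
            (by rw [Legal.pos_val, hans n hn, hquasi n (by omega), hr])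
          have hch := unravel_child_iff.1 (σ.child (ih.pos hN))
          have h2 := hch.2.2 (by simp [hx.lev]; omega)
          have h3 := unravel_mem_answer (t := σ.move (ih.pos hN)) (by rw [e, hx.lev]; omega)
          rwa [h2, e] at h3
        · have hnS := unravel_mem_answer (t := ih.pos hN) (by simpa [hx.lev] using hn)
          exact hav.2 _ hnS (by rw [Legal.pos_val, hx.lev]; simpa using hn') _ (hx.child n)
            (hno _ (by omega))
    refine main (hta.pos hN) rfl (fun n hn => ?_) hσt fun n hn hn' s hs => ?_
    · exact unravel_mem_answer (t := (hmem n hn).pos hN) (by simpa [hx.lev] using hn)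
    · refine hmove n (by omega) hn' s ?_
      rw [hs, hans n hn, hquasi n (by omega), hr, Legal.pos_val]

end PushFalse

variable (hN) in
/-- The projection from the unravelled game is a covering. -/
noncomputable def unravelCover : Cover N (T.unravel N O hN) T where
  proj t := t.1.1
  lev_proj _ := rfl
  par_proj _ := rfl
  inj s t hs ht h := by
    rw [unravel_lev] at hs ht
    refine Subtype.ext (Prod.ext h (Prod.ext ?_ ?_))
    · rw [s.2.quasi_empty hs, t.2.quasi_empty ht]
    · rw [s.2.answer_empty (by omega), t.2.answer_empty (by omega)]
  surj p hp := ⟨(Legal.base hp).pos hN, rfl⟩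
  push b σ := if b then pushTrue σ else pushFalse σ
  push_congr b := by
    cases b
    · exact pushFalse_congr
    · exact pushTrue_congr
  push_proj b σ p hp := by
    cases b
    · exact pushFalse_low σ p hp.le
    · exact pushTrue_low σ p hp.le
  lift b := by
    cases b
    · exact pushFalse_lift
    · exact pushTrue_lift

theorem unravel_answer_eq {y : ℕ → (T.unravel N O hN).Pos} (hy : (T.unravel N O hN).IsPlay y)
    {n : ℕ} (hn : N + 2 ≤ n) : (y n).1.2.2 = (y (N + 2)).1.2.2 := by
  induction n, hn using Nat.le_induction with
  | base => rfl
  | succ n hn ih =>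
    have hl := hy.lev n
    rw [unravel_lev] at hl
    rw [(unravel_child_iff.1 (hy.child n)).2.2 (by omega), ih]

end Unravel

/-- Closed sets of plays can be unravelled. -/
theorem exists_cover_of_closed {T : Arena} {N : ℕ} (hN : N % 2 = 0) {A : Set (ℕ → T.Pos)}
    (hA : T.OpenPlays Aᶜ) : ∃ (T' : Arena) (c : Cover N T' T),
      T'.OpenPlays {y | c.proj ∘ y ∈ A} ∧ T'.OpenPlays {y | c.proj ∘ y ∈ A}ᶜ := by
  set O : Set T.Pos := {u | ∀ z, T.IsPlay z → z (T.lev u) = u → z ∉ A} with hO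
  refine ⟨T.unravel N O hN, unravelCover hN, ?_, (unravelCover hN).openPlays hA⟩
  intro x hx hxA
  refine ⟨N + 2, fun y hy hyx => ?_⟩
  have hx' : T.IsPlay fun n => (x n).1.1 := (unravelCover hN).isPlay hx
  have hy' : T.IsPlay fun n => (y n).1.1 := (unravelCover hN).isPlay hy
  have hlx : ∀ n, T.lev (x n).1.1 = n := hx.lev
  have hly : ∀ n, T.lev (y n).1.1 = n := hy.lev
  by_contra hyA
  obtain ⟨n, hn⟩ := hA _ hy' hyA
  have hmemx : ∀ k, N + 2 ≤ k → (x k).1.1 ∈ (x (N + 2)).1.2.2 := by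
    intro k hk
    rw [← unravel_answer_eq hx hk]
    exact unravel_mem_answer (by rw [hlx]; exact hk)
  have hmemy : ∀ k, N + 2 ≤ k → (y k).1.1 ∈ (x (N + 2)).1.2.2 := by
    intro k hk
    rw [← hyx, ← unravel_answer_eq hy hk]
    exact unravel_mem_answer (by rw [hly]; exact hk)
  rcases (x (N + 2)).2.answer (by rw [hlx]; omega) with ⟨u, -, huO, hul, hS⟩ | ⟨-, h2, -⟩
  · have h := hmemx (T.lev u) hul
    rw [hS] at h
    have e := eq_anc_of_mem_cone h (hlx _).le
    rw [hlx, anc_lev] at e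
    exact huO _ hx' e hxA
  · refine h2 _ (hmemy (max n (N + 2)) (le_max_right _ _)) fun z hz hzy => ?_
    rw [hly] at hzy
    refine hn z hz ?_
    rw [← hz.anc_eq (le_max_left n (N + 2)), hzy]
    exact hy'.anc_eq (le_max_left n (N + 2))

/-- The map `r` from plays to Cantor space is continuous. -/
def Cont (T : Arena) (r : (ℕ → T.Pos) → Cantor) : Prop :=
  ∀ x, T.IsPlay x → ∀ n, ∃ m, ∀ y, T.IsPlay y → y m = x m → r y n = r x n

theorem Cover.cont {N : ℕ} {T' T : Arena} (c : Cover N T' T) {r : (ℕ → T.Pos) → Cantor}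
    (hr : T.Cont r) : T'.Cont fun y => r (c.proj ∘ y) := by
  intro x hx n
  obtain ⟨m, hm⟩ := hr _ (c.isPlay hx) n
  exact ⟨m, fun y hy hyx => hm _ (c.isPlay hy) (by simp [hyx])⟩

/-- All continuous preimages of `D` can be made clopen by a covering. -/
def Unravellable (D : Set Cantor) : Prop :=
  ∀ (T : Arena) (r : (ℕ → T.Pos) → Cantor), T.Cont r → ∀ N, N % 2 = 0 →
    ∃ (T' : Arena) (c : Cover N T' T), T'.OpenPlays {y | r (c.proj ∘ y) ∈ D} ∧
      T'.OpenPlays {y | r (c.proj ∘ y) ∈ D}ᶜ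

theorem unravellable_of_closed {D : Set Cantor}
    (hD : ∀ (T : Arena) (r : (ℕ → T.Pos) → Cantor), T.Cont r → T.OpenPlays {x | r x ∈ D}ᶜ) :
    Unravellable D := fun T r hr _ hN => exists_cover_of_closed hN (hD T r hr)

theorem Unravellable.compl {D : Set Cantor} (hD : Unravellable D) : Unravellable Dᶜ := by
  intro T r hr N hN
  obtain ⟨T', c, h1, h2⟩ := hD T r hr N hN
  refine ⟨T', c, h2, ?_⟩
  have e : {y | r (c.proj ∘ y) ∈ Dᶜ}ᶜ = {y | r (c.proj ∘ y) ∈ D} := by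
    ext y
    simp
  rwa [e]

theorem Unravellable.iUnion {D : ℕ → Set Cantor} (hD : ∀ i, Unravellable (D i)) :
    Unravellable (⋃ i, D i) := by
  intro T r hr N hN
  choose F c h1 h2 using fun i (s : Σ T : Arena, {r : (ℕ → T.Pos) → Cantor // T.Cont r}) =>
    hD i s.1 s.2.1 s.2.2 (N + 2 * i) (by omega)
  let s : ℕ → Σ T : Arena, {r : (ℕ → T.Pos) → Cantor // T.Cont r} := fun i =>
    Nat.rec ⟨T, r, hr⟩ (fun i s => ⟨F i s, fun y => s.2.1 ((c i s).proj ∘ y), (c i s).cont s.2.2⟩) i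
  let X : ℕ → Arena := fun i => (s i).1
  let d : ∀ i, Cover (N + 2 * i) (X (i + 1)) (X i) := fun i => c i (s i)
  let L : Cover N (limit d) (X 0) := limitCover d
  have hs : ∀ (x : ℕ → (limit d).Pos) (i : ℕ), (s i).2.1 (fun n => (x n).1 i) = r (L.proj ∘ x) := by
    intro x i
    induction i with
    | zero => rfl
    | succ i ih =>
      rw [← ih]
      change (s i).2.1 (fun n => (d i).proj ((x n).1 (i + 1))) = _
      simp only [(x _).2]
  have hopen : (limit d).OpenPlays {x | r (L.proj ∘ x) ∈ ⋃ i, D i} := by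
    intro x hx hxD
    obtain ⟨i, hi⟩ := Set.mem_iUnion.1 hxD
    obtain ⟨n, hn⟩ := h1 i (s i) _ (isPlay_limit_apply d hx (i + 1)) (by
      have h := hs x (i + 1)
      change (s i).2.1 ((c i (s i)).proj ∘ fun n => (x n).1 (i + 1)) = _ at h
      rw [Set.mem_ofPred_eq, h]
      exact hi)
    refine ⟨n, fun y hy hyx => Set.mem_iUnion.2 ⟨i, ?_⟩⟩
    have h := hn _ (isPlay_limit_apply d hy (i + 1)) (by rw [hyx])
    rw [← hs y (i + 1)]
    exact h
  obtain ⟨T', c', h1', h2'⟩ := exists_cover_of_closed (T := limit d) hN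
    (A := {x | r (L.proj ∘ x) ∈ ⋃ i, D i}ᶜ) (by rwa [compl_compl])
  refine ⟨T', L.comp c', ?_, h1'⟩
  rwa [show {y | c'.proj ∘ y ∈ {x | r (L.proj ∘ x) ∈ ⋃ i, D i}ᶜ}ᶜ =
    {y | r ((L.comp c').proj ∘ y) ∈ ⋃ i, D i} from compl_compl _] at h2'

/-- Borel sets can be unravelled. -/
theorem unravellable_of_measurableSet {D : Set Cantor} (hD : MeasurableSet D) :
    Unravellable D := by
  let M : MeasurableSpace Cantor :=
    { MeasurableSet' := Unravellable
      measurableSet_empty := unravellable_of_closed fun T r _ x _ _ => ⟨0, fun y _ _ => by simp⟩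
      measurableSet_compl := fun _ h => h.compl
      measurableSet_iUnion := fun _ h => .iUnion h }
  have hM : (MeasurableSpace.pi : MeasurableSpace Cantor) ≤ M := by
    refine iSup_le fun n => ?_
    rintro _ ⟨B, -, rfl⟩
    refine unravellable_of_closed fun T r hr x hx hxB => ?_
    obtain ⟨m, hm⟩ := hr x hx n
    refine ⟨m, fun y hy hyx => ?_⟩
    simp only [Set.mem_compl_iff, Set.mem_ofPred_eq, Set.mem_preimage] at hxB ⊢
    rwa [hm y hy hyx]
  exact hM D hD

theorem exists_strat (T : Arena) (P : T.Pos → T.Pos → Prop) :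
    ∃ σ : T.Strat, ∀ p, (∃ q, T.Child p q ∧ P p q) → P p (σ.move p) := by
  have h : ∀ p, ∃ q, T.Child p q ∧ ((∃ q, T.Child p q ∧ P p q) → P p q) := by
    intro p
    by_cases h : ∃ q, T.Child p q ∧ P p q
    · obtain ⟨q, hq⟩ := h
      exact ⟨q, hq.1, fun _ => hq.2⟩
    · obtain ⟨q, hq⟩ := T.exists_child p
      exact ⟨q, hq, fun h' => absurd h' h⟩
  choose m hm using h
  exact ⟨⟨m, fun p => (hm p).1⟩, fun p => (hm p).2⟩

/-- Open games are determined. -/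
theorem determined_of_openPlays {T : Arena} {e : T.Pos} (he : ∀ p, T.lev p = 0 → p = e)
    {A : Set (ℕ → T.Pos)} (hA : T.OpenPlays A) :
    (∃ σ : T.Strat, ∀ x, T.IsPlay x → Consistent true σ x → x ∈ A) ∨
      ∃ σ : T.Strat, ∀ x, T.IsPlay x → Consistent false σ x → x ∉ A := by
  set U : Set T.Pos := {u | ∀ z, T.IsPlay z → z (T.lev u) = u → z ∈ A} with hU
  by_cases h : e ∈ win true U Set.univ
  · left
    obtain ⟨σ, hσ⟩ := T.exists_strat fun p q => q ∈ Set.univ ∧ q ∈ win true U Set.univ ∧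
      rank true U Set.univ q < rank true U Set.univ p
    refine ⟨σ, fun x hx hc => ?_⟩
    by_contra hxA
    have hxU : ∀ n, x n ∉ U := fun n hn => hxA (hn x hx (by rw [hx.lev]))
    obtain ⟨n, -, hn⟩ := exists_mem_of_rank_lt (b := true) (U := U) (V := Set.univ) (n₀ := 0) hx
      (by rwa [he _ (hx.lev 0)]) trivial (fun _ _ _ _ => trivial) (fun n _ ht hw => by
        rw [hc n ht]
        exact hσ _ (exists_child_rank_lt hw (hxU n) (by rwa [hx.lev])))
    exact hxU n hn
  · right
    obtain ⟨σ, hσ⟩ := T.exists_strat fun _ q => q ∉ win true U Set.univ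
    refine ⟨σ, fun x hx hc hxA => ?_⟩
    have hxW : ∀ n, x n ∉ win true U Set.univ := by
      intro n
      induction n with
      | zero => rwa [he _ (hx.lev 0)]
      | succ n ih =>
        by_cases ht : Turn true n
        · exact notMem_win_of_child ih (by rwa [hx.lev]) (hx.child n) trivial
        · rw [hc n (by simpa using ht)]
          obtain ⟨q, hq, -, hqW⟩ := exists_child_notMem_win ih (by rwa [hx.lev])
          exact hσ _ ⟨q, hq, hqW⟩
    obtain ⟨n, hn⟩ := hA x hx hxA
    exact hxW n (subset_win fun z hz hzx => hn z hz (by rwa [hx.lev] at hzx))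

/-- Borel games are determined. -/
theorem determined_of_measurableSet {T : Arena} {e : T.Pos} (he : ∀ p, T.lev p = 0 ↔ p = e)
    {r : (ℕ → T.Pos) → Cantor} (hr : T.Cont r) {D : Set Cantor} (hD : MeasurableSet D) :
    (∃ σ : T.Strat, ∀ x, T.IsPlay x → Consistent true σ x → r x ∈ D) ∨
      ∃ σ : T.Strat, ∀ x, T.IsPlay x → Consistent false σ x → r x ∉ D := by
  obtain ⟨T', c, hc, -⟩ := unravellable_of_measurableSet hD T r hr 0 rfl
  obtain ⟨e', he'⟩ := c.surj e ((he e).2 rfl).le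
  have hroot : ∀ p, T'.lev p = 0 → p = e' := by
    intro p hp
    have hl : T'.lev e' = 0 := by rw [← c.lev_proj, he', (he e).2 rfl]
    exact c.inj p e' hp.le hl.le (by rw [he', (he _).1 ((c.lev_proj p).trans hp)])
  have transfer : ∀ (b : Bool) (σ : T'.Strat) (E : Set Cantor),
      (∀ y, T'.IsPlay y → Consistent b σ y → r (c.proj ∘ y) ∈ E) →
      ∀ x, T.IsPlay x → Consistent b (c.push b σ) x → r x ∈ E := by
    intro b σ E h x hx hxc
    obtain ⟨y, hy, hyc, hyx⟩ := c.lift b σ x hx hxc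
    have := h y hy hyc
    rwa [show c.proj ∘ y = x from funext hyx] at this
  exact (determined_of_openPlays hroot hc).imp (fun ⟨σ, h⟩ => ⟨c.push true σ, transfer true σ D h⟩)
    (fun ⟨σ, h⟩ => ⟨c.push false σ, transfer false σ Dᶜ h⟩)

/-- The game in which the players choose bits. -/
def bitArena : Arena where
  Pos := List Bool
  lev p := p.length
  par p := p.tail
  lev_par p := p.length_tail
  exists_child p := ⟨true :: p, rfl, rfl⟩

/-- The sequence of bits chosen in a play. -/
def bits (x : ℕ → bitArena.Pos) : Cantor := fun n => (show List Bool from x (n + 1)).headI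

/-- Playing `B` against the strategy `σ` of player `b`. -/
def against (b : Bool) (σ : bitArena.Strat) (B : Cantor) : ℕ → bitArena.Pos
  | 0 => ([] : List Bool)
  | n + 1 => if (n % 2 = 0 ↔ b = true) then σ.move (against b σ B n)
      else (B (n / 2) :: against b σ B n : List Bool)

variable (b : Bool) (σ : bitArena.Strat) (B : Cantor)

theorem against_of_turn {n : ℕ} (h : Turn b n) :
    against b σ B (n + 1) = σ.move (against b σ B n) := if_pos h

theorem against_of_not_turn {n : ℕ} (h : ¬ Turn b n) :
    against b σ B (n + 1) = (B (n / 2) :: against b σ B n : List Bool) := if_neg h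

theorem isPlay_against : bitArena.IsPlay (against b σ B) := by
  have h : ∀ n, bitArena.Child (against b σ B n) (against b σ B (n + 1)) := by
    intro n
    by_cases ht : Turn b n
    · rw [against_of_turn b σ B ht]
      exact σ.child _
    · rw [against_of_not_turn b σ B ht]
      exact ⟨rfl, rfl⟩
  refine ⟨fun n => ?_, fun n => (h n).2⟩
  induction n with
  | zero => rfl
  | succ n ih => rw [(h n).1, ih]

theorem isLocallyConstant_against (n : ℕ) : IsLocallyConstant fun B => against b σ B n := by
  induction n with
  | zero => exact IsLocallyConstant.const _
  | succ n ih =>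
    by_cases ht : Turn b n
    · simp only [against_of_turn b σ _ ht]
      exact ih.comp _
    · simp only [against_of_not_turn b σ _ ht]
      exact IsLocallyConstant.comp₂ (IsLocallyConstant.iff_continuous _ |>.2
        (continuous_apply (n / 2))) ih fun a (p : List Bool) => (a :: p : List Bool)

theorem continuous_bits_against : Continuous fun B => bits (against b σ B) :=
  continuous_pi fun n => (isLocallyConstant_against b σ (n + 1)).comp
    (fun p : List Bool => p.headI) |>.continuous

theorem bits_against {n : ℕ} (h : ¬ Turn b n) : bits (against b σ B) n = B (n / 2) := by
  rw [bits, against_of_not_turn b σ B h]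
  rfl

/-- A Borel game in which player `true` plays the bits of `A` and player `false` plays the bits of
`B`. -/
theorem exists_continuous_or_exists_continuous {D : Set (Cantor × Cantor)} (hD : MeasurableSet D) :
    (∃ k : Cantor → Cantor, Continuous k ∧ ∀ B, (k B, B) ∈ D) ∨
      ∃ k : Cantor → Cantor, Continuous k ∧ ∀ A, (A, k A) ∉ D := by
  have hm : Measurable fun z : Cantor => ((fun j => z (2 * j), fun j => z (2 * j + 1)) :
      Cantor × Cantor) :=
    (measurable_pi_lambda _ fun j => measurable_pi_apply _).prodMk
      (measurable_pi_lambda _ fun j => measurable_pi_apply _)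
  have hr : bitArena.Cont bits := fun x _ n => ⟨n + 1, fun y _ h => by rw [bits, bits, h]⟩
  rcases determined_of_measurableSet (T := bitArena) (e := ([] : List Bool))
    (fun p => List.length_eq_zero_iff) hr (hm hD) with ⟨σ, hσ⟩ | ⟨σ, hσ⟩
  · refine .inl ⟨fun B j => bits (against true σ B) (2 * j), continuous_pi fun j =>
      (continuous_pi_iff.1 (continuous_bits_against true σ) _), fun B => ?_⟩
    have h := hσ _ (isPlay_against true σ B) fun n => against_of_turn true σ B
    have e : (fun j => bits (against true σ B) (2 * j + 1)) = B := by
      funext j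
      rw [bits_against true σ B (by simp)]
      congr 1
      omega
    rwa [Set.mem_preimage, e] at h
  · refine .inr ⟨fun A j => bits (against false σ A) (2 * j + 1), continuous_pi fun j =>
      (continuous_pi_iff.1 (continuous_bits_against false σ) _), fun A => ?_⟩
    have h := hσ _ (isPlay_against false σ A) fun n => against_of_turn false σ A
    have e : (fun j => bits (against false σ A) (2 * j)) = A := by
      funext j
      rw [bits_against false σ A (by simp)]
      congr 1
      omega
    rwa [Set.mem_preimage, e] at h

end Arena

/-- For Borel measurable `f, g : 2^ω → ℝ`, either `f ≤_m g` or `g ≤_m (-f)`. -/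
theorem mReducible_or_mReducible_neg (f g : Cantor → ℝ) (hf : Measurable f)
    (hg : Measurable g) : MReducible f g ∨ MReducible g (fun A => - f A) := by
  refine or_iff_not_imp_left.2 fun h q δ hδ => ?_
  simp only [MReducible] at h
  push Not at h
  obtain ⟨p, ε, hε, h⟩ := h
  have hD : MeasurableSet ({z : Cantor × Cantor | g z.2 < q + δ ∧ (p : ℝ) + ε ≤ f z.1} ∪
      {z | (q : ℝ) - δ < g z.2 ∧ f z.1 ≤ p - ε}) :=
    ((measurableSet_lt (hg.comp measurable_snd) measurable_const).inter
      (measurableSet_le measurable_const (hf.comp measurable_fst))).union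
    ((measurableSet_lt measurable_const (hg.comp measurable_snd)).inter
      (measurableSet_le (hf.comp measurable_fst) measurable_const))
  have hε' : (0 : ℝ) < ε := by exact_mod_cast hε
  rcases Arena.exists_continuous_or_exists_continuous hD with ⟨k, hk, hkD⟩ | ⟨k, hk, hkD⟩
  · refine ⟨-p, ε, hε, k, hk, fun B b hb => ?_⟩
    rcases hkD B with ⟨h1, h2⟩ | ⟨h1, h2⟩ <;> rcases hb with ⟨rfl, hb⟩ | ⟨rfl, hb⟩ <;>
      push_cast at hb h2
    · exact Or.inl ⟨rfl, h1⟩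
    · linarith
    · linarith
    · exact Or.inr ⟨rfl, h1⟩
  · obtain ⟨A, b, hb, hA⟩ := h q δ hδ k hk
    refine absurd ?_ (hkD A)
    rcases hb with ⟨rfl, hb⟩ | ⟨rfl, hb⟩
    · exact Or.inl ⟨hb, not_lt.1 fun h' => hA (Or.inl ⟨rfl, h'⟩)⟩
    · exact Or.inr ⟨hb, not_lt.1 fun h' => hA (Or.inr ⟨rfl, h'⟩)⟩
end

section
/- Let D, E₀, E₁ ⊆ ω^ω be Borel sets. Then at least one of the following holds: (1) there is a continuous function φ : ω^ω → ω^ω with φ(D) ⊆ E₀ and φ(ω^ω \ D) ⊆ E₁; (2) there is a continuous function ψ : ω^ω → ω^ω with ψ(E₀) ⊆ ω^ω \ D and ψ(E₁) ⊆ D. -/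
/-- Baire space `ω^ω`. -/
abbrev NNSpace : Type := ℕ → ℕ

namespace BorelGame

/-- A game tree given by its levels of positions and the restriction maps between them.
Positions without a successor are allowed; a player who cannot move there loses. -/
structure GameTree where
  Pos : ℕ → Type
  res : ∀ {n m : ℕ}, n ≤ m → Pos m → Pos n
  res_refl : ∀ {n : ℕ} (p : Pos n), res le_rfl p = p
  res_res : ∀ {l n m : ℕ} (h₁ : l ≤ n) (h₂ : n ≤ m) (p : Pos m),
    res h₁ (res h₂ p) = res (h₁.trans h₂) p

/-- An infinite play of a game tree. -/
@[ext]
structure Play (T : GameTree) where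
  pos : ∀ n, T.Pos n
  res_pos : ∀ {n m : ℕ} (h : n ≤ m), T.res h (pos m) = pos n

/-- A level-preserving morphism of game trees. -/
structure Hom (T' T : GameTree) where
  map : ∀ n, T'.Pos n → T.Pos n
  map_res : ∀ {n m : ℕ} (h : n ≤ m) (p : T'.Pos m), map n (T'.res h p) = T.res h (map m p)

/-- The composition of two morphisms. -/
def Hom.comp {T'' T' T : GameTree} (f : Hom T' T) (g : Hom T'' T') : Hom T'' T where
  map n p := f.map n (g.map n p)
  map_res h p := by rw [g.map_res, f.map_res]

/-- The image of a play under a morphism. -/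
def Hom.play {T' T : GameTree} (f : Hom T' T) (x : Play T') : Play T where
  pos n := f.map n (x.pos n)
  res_pos h := by rw [← f.map_res, x.res_pos]

/-- A set of positions on each level. -/
abbrev Family (T : GameTree) : Type := ∀ n, Set (T.Pos n)

/-- Player `false` moves on even levels, player `true` on odd levels. -/
def Own (b : Bool) (n : ℕ) : Prop := n % 2 = cond b 1 0

lemma own_false {n : ℕ} : Own false n ↔ n % 2 = 0 := Iff.rfl

lemma own_true {n : ℕ} : Own true n ↔ n % 2 = 1 := Iff.rfl

lemma own_not {b : Bool} {n : ℕ} : Own (!b) n ↔ ¬ Own b n := by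
  cases b <;> simp [Own]

/-- The family `S` offers a move to player `b`, and allows all moves of the opponent, on
level `n`. -/
def IsStratAt {T : GameTree} (b : Bool) (S : Family T) (n : ℕ) : Prop :=
  ∀ p ∈ S n, (Own b n → ∃ q ∈ S (n + 1), T.res n.le_succ q = p) ∧
    (¬ Own b n → ∀ q, T.res n.le_succ q = p → q ∈ S (n + 1))

/-- The family `S` is a (nondeterministic) strategy of player `b` for the first `N` moves. -/
def IsStratTo {T : GameTree} (b : Bool) (S : Family T) (N : ℕ) : Prop :=
  S 0 = Set.univ ∧ ∀ n < N, IsStratAt b S n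

lemma IsStratAt.congr {T : GameTree} {b : Bool} {S S' : Family T} {n : ℕ}
    (h : IsStratAt b S n) (h₀ : S n = S' n) (h₁ : S (n + 1) = S' (n + 1)) :
    IsStratAt b S' n := by
  unfold IsStratAt at *
  rwa [← h₀, ← h₁]

lemma IsStratTo.congr {T : GameTree} {b : Bool} {S S' : Family T} {N : ℕ}
    (h : IsStratTo b S N) (hS : ∀ n ≤ N, S n = S' n) : IsStratTo b S' N :=
  ⟨by rw [← hS 0 N.zero_le]; exact h.1,
    fun n hn => (h.2 n hn).congr (hS n hn.le) (hS (n + 1) hn)⟩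

/-- A covering in the sense of Martin that is the identity up to level `k`. -/
structure Covering (k : ℕ) (T' T : GameTree) where
  hom : Hom T' T
  bijective : ∀ n ≤ k, Function.Bijective (hom.map n)
  trans : Bool → Family T' → Family T
  trans_local : ∀ b n (S S' : Family T'), (∀ m ≤ n, S m = S' m) → trans b S n = trans b S' n
  trans_strat : ∀ b S N, IsStratTo b S N → IsStratTo b (trans b S) N
  trans_low : ∀ b S, ∀ n ≤ k, trans b S n = hom.map n '' S n
  lift : ∀ b S, (∀ N, IsStratTo b S N) → ∀ x : Play T, (∀ n, x.pos n ∈ trans b S n) →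
    ∃ y : Play T', (∀ n, y.pos n ∈ S n) ∧ hom.play y = x

/-- The composition of two coverings. -/
def Covering.comp {k : ℕ} {T'' T' T : GameTree} (f : Covering k T' T) (g : Covering k T'' T') :
    Covering k T'' T where
  hom := f.hom.comp g.hom
  bijective n hn := (f.bijective n hn).comp (g.bijective n hn)
  trans b S := f.trans b (g.trans b S)
  trans_local b n S S' h := f.trans_local b n _ _ fun m hm =>
    g.trans_local b m _ _ fun l hl => h l (hl.trans hm)
  trans_strat b S N h := f.trans_strat b _ N (g.trans_strat b S N h)
  trans_low b S n hn := by
    rw [f.trans_low b _ n hn, g.trans_low b S n hn, Set.image_image]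
    rfl
  lift b S hS x hx := by
    obtain ⟨y, hy, rfl⟩ := f.lift b _ (fun N => g.trans_strat b S N (hS N)) x hx
    obtain ⟨z, hz, rfl⟩ := g.lift b S hS y hy
    exact ⟨z, hz, rfl⟩

section Limit

variable {T : ℕ → GameTree} (f : ∀ i, Hom (T (i + 1)) (T i))

/-- The inverse limit of a sequence of game trees. -/
def limitTree : GameTree where
  Pos n := {p : ∀ i, (T i).Pos n // ∀ i, (f i).map n (p (i + 1)) = p i}
  res h p := ⟨fun i => (T i).res h (p.1 i), fun i => by rw [(f i).map_res, p.2]⟩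
  res_refl p := Subtype.ext (funext fun i => (T i).res_refl _)
  res_res h₁ h₂ p := Subtype.ext (funext fun i => (T i).res_res h₁ h₂ _)

/-- The projections of the inverse limit. -/
def limitProj (i : ℕ) : Hom (limitTree f) (T i) where
  map _ p := p.1 i
  map_res _ _ := rfl

lemma limitProj_succ (i n : ℕ) (p : (limitTree f).Pos n) :
    (f i).map n ((limitProj f (i + 1)).map n p) = (limitProj f i).map n p := p.2 i

lemma limitProj_injective {k i n : ℕ} (hf : ∀ i, ∀ n ≤ k + i, Function.Bijective ((f i).map n))
    (hn : n ≤ k + i) : Function.Injective ((limitProj f i).map n) := by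
  intro p q hpq
  have hpq : p.1 i = q.1 i := hpq
  have up : ∀ d, p.1 (i + d) = q.1 (i + d) := by
    intro d
    induction d with
    | zero => exact hpq
    | succ d ih =>
      apply (hf (i + d) n (by omega)).1
      have h₁ := p.2 (i + d)
      have h₂ := q.2 (i + d)
      exact h₁.trans (ih.trans h₂.symm)
  have down : ∀ j d, p.1 (j + d) = q.1 (j + d) → p.1 j = q.1 j := by
    intro j d
    induction d with
    | zero => exact id
    | succ d ih =>
      intro h
      apply ih
      rw [← p.2 (j + d), ← q.2 (j + d)]
      exact congrArg _ h
  apply Subtype.ext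
  funext j
  apply down j i
  rw [add_comm]
  exact up j

lemma limitProj_surjective {k i n : ℕ}
    (hf : ∀ i, ∀ n ≤ k + i, Function.Bijective ((f i).map n))
    (hn : n ≤ k + i) : Function.Surjective ((limitProj f i).map n) := by
  induction i generalizing T k with
  | zero =>
    intro p
    choose g hg using fun i => (hf i n (by omega)).2
    exact ⟨⟨fun i => Nat.rec p (fun i q => g i q) i, fun i => hg i _⟩, rfl⟩
  | succ i ih =>
    intro p
    obtain ⟨q, hq⟩ := ih (T := fun j => T (j + 1)) (fun j => f (j + 1)) (k := k + 1)
      (fun j m hm => hf (j + 1) m (by omega)) (by omega) p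
    let r : ∀ j, (T j).Pos n := fun j =>
      Nat.casesOn (motive := fun j => (T j).Pos n) j ((f 0).map n (q.1 0)) fun j => q.1 j
    refine ⟨⟨r, ?_⟩, hq⟩
    rintro (_ | j)
    · rfl
    · exact q.2 j

variable {k : ℕ} (C : ∀ i, Covering (k + i) (T (i + 1)) (T i))

/-- The approximations to the strategy transfer from the inverse limit. -/
def limitApprox (b : Bool) (S : Family (limitTree fun i => (C i).hom)) :
    ℕ → ∀ i, Family (T i)
  | 0, i => fun n => (limitProj _ i).map n '' S n
  | d + 1, i => (C i).trans b (limitApprox b S d (i + 1))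

/-- The strategy transfer from the inverse limit. -/
def limitTrans (b : Bool) (S : Family (limitTree fun i => (C i).hom)) (i : ℕ) : Family (T i) :=
  fun n => limitApprox C b S n i n

variable (b : Bool) (S : Family (limitTree fun i => (C i).hom))

lemma limitApprox_succ (d i n : ℕ) (h : n ≤ k + i + d) :
    limitApprox C b S (d + 1) i n = limitApprox C b S d i n := by
  induction d generalizing i n with
  | zero =>
    simp only [limitApprox]
    rw [(C i).trans_low b _ n (by omega), Set.image_image]
    exact Set.image_congr fun p _ => limitProj_succ _ i n p
  | succ d ih =>
    rw [limitApprox, limitApprox]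
    exact (C i).trans_local b n _ _ fun m hm => ih (i + 1) m (by omega)

lemma limitApprox_eq_add (d e i n : ℕ) (h : n ≤ k + i + d) :
    limitApprox C b S (d + e) i n = limitApprox C b S d i n := by
  induction e with
  | zero => rfl
  | succ e ih => rw [← ih, ← add_assoc, limitApprox_succ C b S (d + e) i n (by omega)]

lemma limitTrans_eq_approx (d i n : ℕ) (h : n ≤ d) :
    limitTrans C b S i n = limitApprox C b S d i n := by
  obtain ⟨e, rfl⟩ := Nat.exists_eq_add_of_le h
  exact (limitApprox_eq_add C b S n e i n (by omega)).symm

lemma limitTrans_low (i n : ℕ) (h : n ≤ k + i) :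
    limitTrans C b S i n = (limitProj _ i).map n '' S n := by
  have := limitApprox_eq_add C b S 0 n i n (by omega)
  rw [zero_add] at this
  exact this

lemma limitTrans_succ (i : ℕ) : limitTrans C b S i = (C i).trans b (limitTrans C b S (i + 1)) := by
  funext n
  rw [limitTrans_eq_approx C b S (n + 1) i n (by omega), limitApprox]
  exact (C i).trans_local b n _ _ fun m hm => (limitTrans_eq_approx C b S n (i + 1) m hm).symm

lemma limitApprox_strat {N : ℕ} (hS : IsStratTo b S N) (d i : ℕ) (hN : N ≤ k + i + d) :
    IsStratTo b (limitApprox C b S d i) N := by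
  induction d generalizing i with
  | zero =>
    have hC : ∀ i, ∀ n ≤ k + i, Function.Bijective ((C i).hom.map n) := fun i => (C i).bijective
    refine ⟨?_, ?_⟩
    · change (limitProj _ i).map 0 '' S 0 = _
      rw [hS.1, Set.image_univ]
      exact (limitProj_surjective _ hC (Nat.zero_le (k + i))).range_eq
    · rintro n hn _ ⟨p, hp, rfl⟩
      refine ⟨fun ho => ?_, fun ho q hq => ?_⟩
      · obtain ⟨q, hq, rfl⟩ := (hS.2 n hn p hp).1 ho
        exact ⟨_, ⟨q, hq, rfl⟩, ((limitProj _ i).map_res _ _).symm⟩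
      · obtain ⟨q, rfl⟩ := limitProj_surjective _ hC (show n + 1 ≤ k + i by omega) q
        refine ⟨q, (hS.2 n hn p hp).2 ho q ?_, rfl⟩
        apply limitProj_injective _ hC (show n ≤ k + i by omega)
        rw [(limitProj _ i).map_res, hq]
  | succ d ih => exact (C i).trans_strat b _ N (ih (i + 1) (by omega))

lemma limitTrans_strat {N : ℕ} (hS : IsStratTo b S N) (i : ℕ) :
    IsStratTo b (limitTrans C b S i) N :=
  (limitApprox_strat C b S hS N i (by omega)).congr fun n hn =>
    (limitTrans_eq_approx C b S N i n hn).symm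

/-- The inverse limit of a sequence of coverings covers the first tree of the sequence. -/
def limitCovering : Covering k (limitTree fun i => (C i).hom) (T 0) where
  hom := limitProj _ 0
  bijective n hn := ⟨limitProj_injective _ (fun i => (C i).bijective) hn,
    limitProj_surjective _ (fun i => (C i).bijective) hn⟩
  trans b S := limitTrans C b S 0
  trans_local b n S S' h := by
    have key : ∀ d i, ∀ m ≤ n, limitApprox C b S d i m = limitApprox C b S' d i m := by
      intro d
      induction d with
      | zero => intro i m hm; simp only [limitApprox, h m hm]
      | succ d ih =>
        intro i m hm
        exact (C i).trans_local b m _ _ fun l hl => ih (i + 1) l (hl.trans hm)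
    exact key n 0 n le_rfl
  trans_strat b S N hS := limitTrans_strat C b S hS 0
  trans_low b S n hn := limitTrans_low C b S 0 n hn
  lift b S hS x hx := by
    have step : ∀ i (y : {y : Play (T i) // ∀ n, y.pos n ∈ limitTrans C b S i n}),
        ∃ z : {z : Play (T (i + 1)) // ∀ n, z.pos n ∈ limitTrans C b S (i + 1) n},
          (C i).hom.play z.1 = y.1 := by
      rintro i ⟨y, hy⟩
      rw [limitTrans_succ] at hy
      obtain ⟨z, hz, hzy⟩ := (C i).lift b _ (fun N => limitTrans_strat C b S (hS N) (i + 1)) y hy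
      exact ⟨⟨z, hz⟩, hzy⟩
    choose g hg using step
    let y : ∀ i, {y : Play (T i) // ∀ n, y.pos n ∈ limitTrans C b S i n} :=
      fun i => Nat.rec ⟨x, hx⟩ (fun i y => g i y) i
    have hy : ∀ i, (C i).hom.play (y (i + 1)).1 = (y i).1 := fun i => hg i (y i)
    refine ⟨⟨fun n => ⟨fun i => (y i).1.pos n, fun i => ?_⟩, fun h => ?_⟩, fun n => ?_, rfl⟩
    · exact congrArg (fun z => z.pos n) (hy i)
    · exact Subtype.ext (funext fun i => (y i).1.res_pos h)
    · have := (y n).2 n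
      rw [limitTrans_low C b S n n (by omega)] at this
      obtain ⟨p, hp, hpy⟩ := this
      obtain rfl : p = ⟨fun i => (y i).1.pos n, fun i => congrArg (fun z => z.pos n) (hy i)⟩ :=
        limitProj_injective _ (fun i => (C i).bijective) (show n ≤ k + n by omega) hpy
      exact hp

end Limit

section Finite

variable {T : GameTree}

/-- Player `b` has a strategy from `p` on all of whose infinite plays lie in `W`. -/
def Wins (b : Bool) (W : Set (Play T)) {n : ℕ} (p : T.Pos n) : Prop :=
  ∃ S : Family T, p ∈ S n ∧ (∀ m, n ≤ m → IsStratAt b S m) ∧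
    ∀ x : Play T, x.pos n = p → (∀ m, n ≤ m → x.pos m ∈ S m) → x ∈ W

lemma wins_of_succ {b : Bool} {W : Set (Play T)} {n : ℕ} {p : T.Pos n}
    (h₁ : Own b n → ∃ q, T.res n.le_succ q = p ∧ Wins b W q)
    (h₂ : ¬ Own b n → ∀ q, T.res n.le_succ q = p → Wins b W q) : Wins b W p := by
  have : ∀ q : T.Pos (n + 1), ∃ S : Family T, Wins b W q →
      q ∈ S (n + 1) ∧ (∀ m, n + 1 ≤ m → IsStratAt b S m) ∧
      ∀ x : Play T, x.pos (n + 1) = q → (∀ m, n + 1 ≤ m → x.pos m ∈ S m) → x ∈ W := by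
    intro q
    by_cases h : Wins b W q
    · obtain ⟨S, hS⟩ := h
      exact ⟨S, fun _ => hS⟩
    · exact ⟨fun _ => ∅, fun h' => (h h').elim⟩
  choose S hS using this
  refine ⟨fun m => {r | ∃ h : n ≤ m, T.res h r = p ∧ ∀ h' : n + 1 ≤ m,
    Wins b W (T.res h' r) ∧ r ∈ S (T.res h' r) m}, ?_, ?_, ?_⟩
  · exact ⟨le_rfl, T.res_refl p, fun h => by omega⟩
  · rintro m hm r ⟨_, hr, hr'⟩
    rcases hm.eq_or_lt with rfl | hm
    · rw [T.res_refl] at hr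
      subst hr
      refine ⟨fun ho => ?_, fun ho q hq => ?_⟩
      · obtain ⟨q, hq, hw⟩ := h₁ ho
        refine ⟨q, ⟨n.le_succ, hq, fun h' => ?_⟩, hq⟩
        rw [T.res_refl]
        exact ⟨hw, (hS q hw).1⟩
      · refine ⟨n.le_succ, hq, fun h' => ?_⟩
        rw [T.res_refl]
        exact ⟨h₂ ho q hq, (hS q (h₂ ho q hq)).1⟩
    · obtain ⟨hw, hrS⟩ := hr' hm
      have hstep := (hS _ hw).2.1 m hm r hrS
      have key : ∀ q, T.res m.le_succ q = r → q ∈ S (T.res hm r) (m + 1) →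
          ∃ h : n ≤ m + 1, T.res h q = p ∧ ∀ h' : n + 1 ≤ m + 1,
            Wins b W (T.res h' q) ∧ q ∈ S (T.res h' q) (m + 1) := by
        rintro q rfl hq
        rw [T.res_res] at hr hw hq
        exact ⟨_, hr, fun h' => ⟨hw, hq⟩⟩
      refine ⟨fun ho => ?_, fun ho q hq => key q hq (hstep.2 ho q hq)⟩
      obtain ⟨q, hq, hqr⟩ := hstep.1 ho
      exact ⟨q, key q hqr hq, hqr⟩
  · intro x hx hxS
    have h₀ := (hxS (n + 1) n.le_succ).choose_spec.2 le_rfl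
    rw [T.res_refl] at h₀
    refine (hS _ h₀.1).2.2 x rfl fun m hm => ?_
    have := ((hxS m (by omega)).choose_spec.2 hm).2
    rwa [x.res_pos] at this

/-- A game on a tree whose infinite plays are decided at level `N` is determined. -/
lemma wins_or_wins (N : ℕ) (C : Set (T.Pos N)) {n : ℕ} (p : T.Pos n) :
    Wins false {x | x.pos N ∈ C} p ∨ Wins true {x | x.pos N ∉ C} p := by
  set W : Bool → Set (Play T) := fun b => {x | x.pos N ∈ C ↔ b = false} with hW
  suffices Wins false (W false) p ∨ Wins true (W true) p by simpa [hW] using this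
  have defend : ∀ b {n : ℕ} (p : T.Pos n), (∀ x : Play T, x.pos n = p → x ∈ W b) →
      ¬ Wins (!b) (W (!b)) p → Wins b (W b) p := by
    intro b n p hp hw
    refine ⟨fun m => {r | ¬ Wins (!b) (W (!b)) r}, hw, fun m _ r hr => ?_, fun x hx _ => hp x hx⟩
    refine ⟨fun ho => ?_, fun ho q hq hqw => ?_⟩
    · by_contra! hcon
      refine hr (wins_of_succ (fun h => (own_not.1 h ho).elim) fun _ q hq => ?_)
      by_contra hqw
      exact hcon q hqw hq
    · exact hr (wins_of_succ (fun _ => ⟨q, hq, hqw⟩) fun h => (h (own_not.2 ho)).elim)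
  have high : ∀ {n : ℕ} (p : T.Pos n), N ≤ n → Wins false (W false) p ∨ Wins true (W true) p := by
    intro n p hn
    by_cases hC : T.res hn p ∈ C
    · by_contra! h
      refine h.1 (defend false p (fun x hx => ?_) h.2)
      subst hx
      rw [x.res_pos] at hC
      simpa [hW] using hC
    · by_contra! h
      refine h.2 (defend true p (fun x hx => ?_) h.1)
      subst hx
      rw [x.res_pos] at hC
      simpa [hW] using hC
  have low : ∀ d {n : ℕ} (p : T.Pos n), N ≤ n + d →
      Wins false (W false) p ∨ Wins true (W true) p := by
    intro d
    induction d with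
    | zero => exact high
    | succ d ih =>
      intro n p hn
      have ih' : ∀ b (q : T.Pos (n + 1)), ¬ Wins b (W b) q → Wins (!b) (W (!b)) q := by
        rintro (_ | _) q hq
        · exact (ih q (by omega)).resolve_left hq
        · exact (ih q (by omega)).resolve_right hq
      have main : ∀ b, Own b n → Wins b (W b) p ∨ Wins (!b) (W (!b)) p := by
        intro b ho
        by_cases h : ∃ q, T.res n.le_succ q = p ∧ Wins b (W b) q
        · exact Or.inl (wins_of_succ (fun _ => h) fun h' => (h' ho).elim)
        · push Not at h
          exact Or.inr (wins_of_succ (fun h' => (own_not.1 h' ho).elim)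
            fun _ q hq => ih' b q (h q hq))
      by_cases ho : Own false n
      · exact main false ho
      · exact (main true (own_not.2 ho)).symm
  exact low N p (by omega)

lemma exists_strategy_of_wins [Subsingleton (T.Pos 0)] {b : Bool} {W : Set (Play T)}
    {p : T.Pos 0} (h : Wins b W p) :
    ∃ S : Family T, (∀ N, IsStratTo b S N) ∧ ∀ x : Play T, (∀ n, x.pos n ∈ S n) → x ∈ W := by
  obtain ⟨S, hp, hS, hW⟩ := h
  refine ⟨S, fun N => ⟨?_, fun n _ => hS n n.zero_le⟩, fun x hx =>
    hW x (Subsingleton.elim _ _) fun m _ => hx m⟩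
  exact Set.eq_univ_of_forall fun q => Subsingleton.elim p q ▸ hp

end Finite

section Unravel

variable {T : GameTree}

/-- A position together with its level. -/
abbrev Node (T : GameTree) : Type := Σ n, T.Pos n

/-- `p` and the position `u` are comparable in the tree. -/
def Compatible {n : ℕ} (p : T.Pos n) (u : Node T) : Prop :=
  (∀ h : n ≤ u.1, T.res h u.2 = p) ∧ ∀ h : u.1 ≤ n, T.res h p = u.2

lemma Compatible.res {n m : ℕ} {p : T.Pos m} {u : Node T} (hp : Compatible p u) (h : n ≤ m) :
    Compatible (T.res h p) u := by
  refine ⟨fun h' => ?_, fun h' => ?_⟩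
  · rcases le_total m u.1 with hm | hm
    · rw [← hp.1 hm, T.res_res]
    · rw [← hp.2 hm, T.res_res]
  · rw [T.res_res, hp.2]

variable (E : Family T) (K : ℕ)

/-- The legal positions of the auxiliary game. On level `K + 1` the first player announces a set
`Z` of exit positions, and then the second player either chooses some `u ∈ Z`, after which the
play has to pass through `u`, or promises to avoid the exit positions in `Z`; in the latter case
the play stops once an exit position is reached. -/
structure Legal (n : ℕ) (p : T.Pos n) (Z : Set (Node T)) (o : Option (Node T)) : Prop where
  set_eq : n ≤ K → Z = ∅
  opt_eq : n ≤ K + 1 → o = none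
  of_some : ∀ u, o = some u → u ∈ Z ∧ u.2 ∈ E u.1 ∧ Compatible p u
  of_none : o = none → (∀ m (h : m < n), T.res h.le p ∉ E m) ∧ (p ∈ E n → ⟨n, p⟩ ∉ Z)

/-- The announced set, as far as it is known on level `n`. -/
def cutSet (n : ℕ) (Z : Set (Node T)) : Set (Node T) := if n ≤ K then ∅ else Z

/-- The chosen option, as far as it is known on level `n`. -/
def cutOpt (n : ℕ) (o : Option (Node T)) : Option (Node T) := if n ≤ K + 1 then none else o

variable {E K}

lemma cutSet_low {n : ℕ} (h : n ≤ K) (Z : Set (Node T)) : cutSet K n Z = ∅ := if_pos h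

lemma cutSet_high {n : ℕ} (h : K + 1 ≤ n) (Z : Set (Node T)) : cutSet K n Z = Z :=
  if_neg (by omega)

lemma cutOpt_low {n : ℕ} (h : n ≤ K + 1) (o : Option (Node T)) : cutOpt K n o = none := if_pos h

lemma cutOpt_high {n : ℕ} (h : K + 2 ≤ n) (o : Option (Node T)) : cutOpt K n o = o :=
  if_neg (by omega)

lemma cutSet_cutSet {n m : ℕ} (h : n ≤ m) (Z : Set (Node T)) :
    cutSet K n (cutSet K m Z) = cutSet K n Z := by
  unfold cutSet
  split_ifs <;> first | rfl | omega

lemma cutOpt_cutOpt {n m : ℕ} (h : n ≤ m) (o : Option (Node T)) :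
    cutOpt K n (cutOpt K m o) = cutOpt K n o := by
  unfold cutOpt
  split_ifs <;> first | rfl | omega

lemma Legal.cutSet_self {n : ℕ} {p : T.Pos n} {Z o} (h : Legal E K n p Z o) :
    cutSet K n Z = Z := by
  unfold cutSet
  split_ifs with hn
  · exact (h.set_eq hn).symm
  · rfl

lemma Legal.cutOpt_self {n : ℕ} {p : T.Pos n} {Z o} (h : Legal E K n p Z o) :
    cutOpt K n o = o := by
  unfold cutOpt
  split_ifs with hn
  · exact (h.opt_eq hn).symm
  · rfl

/-- `E` is an antichain of exit positions on even levels above `K`. -/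
structure IsExit (E : Family T) (K : ℕ) : Prop where
  level : ∀ n, ∀ p ∈ E n, n % 2 = 0 ∧ K + 2 ≤ n
  antichain : ∀ l m (h : l < m), ∀ p ∈ E m, T.res h.le p ∉ E l

lemma IsExit.unique (hE : IsExit E K) {n : ℕ} {p : T.Pos n} {u v : Node T} (hu : u.1 ≤ n)
    (hv : v.1 ≤ n) (hpu : T.res hu p = u.2) (hpv : T.res hv p = v.2) (huE : u.2 ∈ E u.1)
    (hvE : v.2 ∈ E v.1) : u = v := by
  have key : ∀ l m (hl : l ≤ n) (hm : m ≤ n), T.res hl p ∈ E l → T.res hm p ∈ E m →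
      (⟨l, T.res hl p⟩ : Node T) = ⟨m, T.res hm p⟩ := by
    intro l m hl hm hlE hmE
    rcases lt_trichotomy l m with hlm | rfl | hlm
    · exact (hE.antichain l m hlm _ hmE (by rwa [T.res_res])).elim
    · rfl
    · exact (hE.antichain m l hlm _ hlE (by rwa [T.res_res])).elim
  rw [← hpu] at huE
  rw [← hpv] at hvE
  have := key _ _ hu hv huE hvE
  rwa [hpu, hpv] at this

lemma Legal.res (hE : IsExit E K) {n m : ℕ} (h : n ≤ m) {p : T.Pos m} {Z o}
    (hp : Legal E K m p Z o) : Legal E K n (T.res h p) (cutSet K n Z) (cutOpt K n o) where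
  set_eq hn := cutSet_low hn Z
  opt_eq hn := cutOpt_low hn o
  of_some u hu := by
    have hn : K + 2 ≤ n := by
      by_contra hn
      rw [cutOpt_low (by omega)] at hu
      cases hu
    rw [cutOpt_high hn] at hu
    rw [cutSet_high (by omega)]
    obtain ⟨h₁, h₂, h₃⟩ := hp.of_some u hu
    exact ⟨h₁, h₂, h₃.res h⟩
  of_none ho := by
    by_cases hn : K + 2 ≤ n
    · rw [cutOpt_high hn] at ho
      rw [cutSet_high (by omega)]
      obtain ⟨h₁, h₂⟩ := hp.of_none ho
      refine ⟨fun l hl => ?_, ?_⟩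
      · rw [T.res_res]
        exact h₁ l (by omega)
      · rcases h.eq_or_lt with rfl | h
        · rwa [T.res_refl]
        · exact fun h' => (h₁ n h h').elim
    · refine ⟨fun l hl hl' => ?_, fun h' => ?_⟩
      · have := (hE.level _ _ hl').2
        omega
      · have := (hE.level _ _ h').2
        omega

/-- The tree of the auxiliary game. -/
def unravelTree (hE : IsExit E K) : GameTree where
  Pos n := {x : T.Pos n × Set (Node T) × Option (Node T) // Legal E K n x.1 x.2.1 x.2.2}
  res h x := ⟨(T.res h x.1.1, cutSet K _ x.1.2.1, cutOpt K _ x.1.2.2), x.2.res hE h⟩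
  res_refl p := Subtype.ext <| Prod.ext (T.res_refl _) <|
    Prod.ext p.2.cutSet_self p.2.cutOpt_self
  res_res h h' _ := Subtype.ext <| Prod.ext (T.res_res h h' _) <|
    Prod.ext (cutSet_cutSet h _) (cutOpt_cutOpt h _)

/-- The projection of the auxiliary game. -/
def unravelHom (hE : IsExit E K) : Hom (unravelTree hE) T where
  map _ x := x.1.1
  map_res _ _ := rfl

lemma legal_low (hE : IsExit E K) {n : ℕ} (hn : n ≤ K) (p : T.Pos n) : Legal E K n p ∅ none where
  set_eq _ := rfl
  opt_eq _ := rfl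
  of_some u hu := by cases hu
  of_none _ := ⟨fun m hm h => by have := (hE.level _ _ h).2; omega, fun _ => by simp⟩

lemma legal_announce (hE : IsExit E K) (p : T.Pos (K + 1)) (Z : Set (Node T)) :
    Legal E K (K + 1) p Z none where
  set_eq h := by omega
  opt_eq _ := rfl
  of_some u hu := by cases hu
  of_none _ := ⟨fun m hm h => by have := (hE.level _ _ h).2; omega,
    fun h => by have := (hE.level _ _ h).2; omega⟩

lemma legal_some {n : ℕ} (hn : K + 2 ≤ n) {p : T.Pos n} {Z : Set (Node T)} {u : Node T}
    (hZ : u ∈ Z) (hu : u.2 ∈ E u.1) (hp : Compatible p u) : Legal E K n p Z (some u) where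
  set_eq h := by omega
  opt_eq h := by omega
  of_some v hv := by
    cases hv
    exact ⟨hZ, hu, hp⟩
  of_none h := by cases h

/-- Membership in a family of positions of the auxiliary game. -/
def Mem {hE : IsExit E K} (S : Family (unravelTree hE)) (n : ℕ) (p : T.Pos n)
    (Z : Set (Node T)) (o : Option (Node T)) : Prop :=
  ∃ h : Legal E K n p Z o, (⟨(p, Z, o), h⟩ : (unravelTree hE).Pos n) ∈ S n

variable {hE : IsExit E K} {S : Family (unravelTree hE)} {b : Bool}

lemma IsStratAt.own_step {n : ℕ} (hS : IsStratAt b S n) (ho : Own b n) {p : T.Pos n} {Z o}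
    (hp : Mem S n p Z o) : ∃ q Z' o', T.res n.le_succ q = p ∧ cutSet K n Z' = Z ∧
      cutOpt K n o' = o ∧ Mem S (n + 1) q Z' o' := by
  obtain ⟨h, hp⟩ := hp
  obtain ⟨⟨⟨q, Z', o'⟩, hl⟩, hq, hqp⟩ := (hS _ hp).1 ho
  have := congrArg Subtype.val hqp
  simp only [unravelTree, Prod.mk.injEq] at this
  exact ⟨q, Z', o', this.1, this.2.1, this.2.2, hl, hq⟩

lemma IsStratAt.opp_step {n : ℕ} (hS : IsStratAt b S n) (ho : ¬ Own b n) {p : T.Pos n} {Z o}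
    (hp : Mem S n p Z o) {q Z' o'} (hl : Legal E K (n + 1) q Z' o')
    (h₁ : T.res n.le_succ q = p) (h₂ : cutSet K n Z' = Z) (h₃ : cutOpt K n o' = o) :
    Mem S (n + 1) q Z' o' := by
  obtain ⟨h, hp⟩ := hp
  refine ⟨hl, (hS _ hp).2 ho _ ?_⟩
  exact Subtype.ext (Prod.ext h₁ (Prod.ext h₂ h₃))

/-- After the second player has chosen `u`, the play is forced until it reaches `u`. -/
lemma mem_forced {N : ℕ} (hS : IsStratTo b S N) {u : Node T} {Z : Set (Node T)}
    (hu : u.2 ∈ E u.1) (h₀ : ∀ h : K + 2 ≤ u.1, Mem S (K + 2) (T.res h u.2) Z (some u))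
    (d : ℕ) (hN : K + 2 + d ≤ N) (h : K + 2 + d ≤ u.1) :
    Mem S (K + 2 + d) (T.res h u.2) Z (some u) := by
  induction d with
  | zero => exact h₀ h
  | succ d ih =>
    have hd := ih (by omega) (by omega)
    have hstep := hS.2 (K + 2 + d) (by omega)
    have hZ : u ∈ Z := (hd.1.of_some u rfl).1
    by_cases ho : Own b (K + 2 + d)
    · obtain ⟨q, Z', o', -, rfl, h₃, hm⟩ := hstep.own_step ho hd
      rw [cutOpt_high (by omega)] at h₃
      rw [cutSet_high (by omega)]
      subst h₃
      have : T.res h u.2 = q := (hm.1.of_some u rfl).2.2.1 h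
      rwa [← this] at hm
    · refine hstep.opp_step ho hd (legal_some (by omega) hZ hu ⟨fun _ => rfl, fun h' => ?_⟩)
        (T.res_res _ _ _) (cutSet_high (by omega) _) (cutOpt_high (by omega) _)
      rw [T.res_res, T.res_refl]

/-- The simulation of a strategy of the auxiliary game in the original one. An exit position in
`V` makes the simulation switch, `Zn` is the announced set before switching, and `Zu` the announced
set after switching. -/
def simulate (S : Family (unravelTree hE)) (base : T.Pos (K + 1) → Prop)
    (V Zn : T.Pos (K + 1) → Set (Node T)) (Zu : T.Pos (K + 1) → Node T → Set (Node T)) :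
    Family T := fun n => {p | (n ≤ K → Mem S n p ∅ none) ∧
      ∀ (h : K + 1 ≤ n) (q : T.Pos (K + 1)), T.res h p = q → base q ∧ (K + 2 ≤ n →
        (∀ (u : Node T) (hu : u.1 ≤ n), T.res hu p = u.2 → u.2 ∈ E u.1 → u ∈ V q →
          Mem S n p (Zu q u) (some u)) ∧
        ((∀ (u : Node T) (hu : u.1 ≤ n), T.res hu p = u.2 → u.2 ∈ E u.1 → u ∉ V q) →
          Mem S n p (Zn q) none))}

/-- The conditions under which `simulate` simulates the first `N` moves. -/
structure Simulates (b : Bool) (S : Family (unravelTree hE)) (N : ℕ) (base : T.Pos (K + 1) → Prop)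
    (V Zn : T.Pos (K + 1) → Set (Node T)) (Zu : T.Pos (K + 1) → Node T → Set (Node T)) :
    Prop where
  even : K % 2 = 0
  strat : IsStratTo b S N
  base_mem : ∀ q, base q → Mem S (K + 1) q (Zn q) none
  base_step : K < N → ∀ p, Mem S K p ∅ none →
    (Own b K → ∃ q, T.res K.le_succ q = p ∧ base q) ∧
    (¬ Own b K → ∀ q, T.res K.le_succ q = p → base q)
  switch_mem : ∀ q, base q → ∀ u ∈ V q, Mem S (K + 1) q (Zu q u) none
  switch : K + 2 ≤ N → ∀ q, base q → ∀ u ∈ V q, u.2 ∈ E u.1 →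
    (∀ h : K + 1 ≤ u.1, T.res h u.2 = q) → ∀ h : K + 2 ≤ u.1,
    Mem S (K + 2) (T.res h u.2) (Zu q u) (some u)
  opt_none : b = true → ∀ q, base q → ∀ p u, ¬ Mem S (K + 2) p (Zn q) (some u)
  exit_true : b = true → ∀ q u, u ∉ Zn q → u ∈ V q
  exit_false : b = false → ∀ q u, u ∈ Zn q → u ∈ V q

lemma simulate_low {base V Zn Zu} {n : ℕ} (hn : n ≤ K) {p : T.Pos n} :
    p ∈ simulate S base V Zn Zu n ↔ Mem S n p ∅ none :=
  ⟨fun h => h.1 hn, fun h => ⟨fun _ => h, fun h' => by omega⟩⟩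

lemma simulate_announce {base V Zn Zu} {p : T.Pos (K + 1)} :
    p ∈ simulate S base V Zn Zu (K + 1) ↔ base p := by
  refine ⟨fun h => (h.2 le_rfl p (T.res_refl p)).1, fun h => ⟨fun h' => by omega, ?_⟩⟩
  rintro h' q rfl
  rw [T.res_refl]
  exact ⟨h, fun h' => by omega⟩

lemma simulate_switched (hE : IsExit E K) {S : Family (unravelTree hE)} {base V Zn Zu} {n : ℕ}
    {p : T.Pos n} (hn : K + 2 ≤ n)
    (hb : base (T.res (show K + 1 ≤ n by omega) p)) {u : Node T} (hu : u.1 ≤ n)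
    (hpu : T.res hu p = u.2) (huE : u.2 ∈ E u.1) (huV : u ∈ V (T.res (by omega) p))
    (hm : Mem S n p (Zu (T.res (by omega) p) u) (some u)) : p ∈ simulate S base V Zn Zu n := by
  refine ⟨fun h => by omega, ?_⟩
  rintro h q rfl
  refine ⟨hb, fun _ => ⟨fun v hv hpv hvE _ => ?_, fun h' => (h' u hu hpu huE huV).elim⟩⟩
  rwa [hE.unique hv hu hpv hpu hvE huE]

lemma simulate_none {base V Zn Zu} {n : ℕ} {p : T.Pos n} (hn : K + 2 ≤ n)
    (hb : base (T.res (show K + 1 ≤ n by omega) p))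
    (hV : ∀ (u : Node T) (hu : u.1 ≤ n), T.res hu p = u.2 → u.2 ∈ E u.1 →
      u ∉ V (T.res (by omega) p))
    (hm : Mem S n p (Zn (T.res (by omega) p)) none) : p ∈ simulate S base V Zn Zu n := by
  refine ⟨fun h => by omega, ?_⟩
  rintro h q rfl
  exact ⟨hb, fun _ => ⟨fun u hu h₁ h₂ h₃ => (hV u hu h₁ h₂ h₃).elim, fun _ => hm⟩⟩

lemma Simulates.forced {N : ℕ} {base V Zn Zu} (H : Simulates b S N base V Zn Zu)
    {q : T.Pos (K + 1)} (hb : base q) {u : Node T} (hu : u ∈ V q) (huE : u.2 ∈ E u.1)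
    (huq : ∀ h : K + 1 ≤ u.1, T.res h u.2 = q) {n : ℕ} (hn : K + 2 ≤ n) (hnN : n ≤ N)
    (h : n ≤ u.1) : Mem S n (T.res h u.2) (Zu q u) (some u) := by
  obtain ⟨d, rfl⟩ := Nat.exists_eq_add_of_le hn
  exact mem_forced H.strat huE (H.switch (by omega) q hb u hu huE huq) d hnN h

/-- Before switching, the simulated strategy contains all successors it should contain. -/
lemma Simulates.succ_mem {N : ℕ} {base V Zn Zu} (H : Simulates b S N base V Zn Zu)
    {n : ℕ} (hn : K + 1 ≤ n) (hnN : n < N) {p : T.Pos n} (hb : base (T.res hn p))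
    (hV : ∀ (u : Node T) (hu : u.1 ≤ n), T.res hu p = u.2 → u.2 ∈ E u.1 → u ∉ V (T.res hn p))
    {q : T.Pos (n + 1)} (hq : T.res n.le_succ q = p)
    (hm : (∀ u : Node T, u = ⟨n + 1, q⟩ → q ∈ E (n + 1) → u ∉ V (T.res hn p)) →
      Mem S (n + 1) q (Zn (T.res hn p)) none) :
    q ∈ simulate S base V Zn Zu (n + 1) := by
  subst hq
  rw [T.res_res] at hb hV hm
  by_cases hex : q ∈ E (n + 1) ∧ ⟨n + 1, q⟩ ∈ V (T.res (by omega) q)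
  · refine simulate_switched hE (by omega) hb (u := ⟨n + 1, q⟩) le_rfl (T.res_refl q) hex.1 hex.2 ?_
    have := H.forced hb hex.2 hex.1 (fun _ => rfl) (n := n + 1) (by omega) hnN le_rfl
    rwa [T.res_refl] at this
  · refine simulate_none (by omega) hb ?_ (hm ?_)
    · rintro ⟨l, u⟩ hu hqu huE huV
      dsimp only at hu hqu huE
      subst hqu
      rcases hu.eq_or_lt with rfl | hu
      · rw [T.res_refl] at huE huV
        exact hex ⟨huE, huV⟩
      · exact hV ⟨l, _⟩ (Nat.lt_succ_iff.1 hu) (T.res_res _ _ _) huE huV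
    · rintro u rfl h h'
      exact hex ⟨h, h'⟩

lemma Simulates.isStratAt {N : ℕ} {base V Zn Zu} (H : Simulates b S N base V Zn Zu)
    {n : ℕ} (hnN : n < N) : IsStratAt b (simulate S base V Zn Zu) n := by
  intro p hp
  have hstep := H.strat.2 n hnN
  rcases lt_trichotomy n K with hn | rfl | hn
  · rw [simulate_low hn.le] at hp
    refine ⟨fun ho => ?_, fun ho q hq => ?_⟩
    · obtain ⟨q, Z, o, hq, -, -, hm⟩ := hstep.own_step ho hp
      refine ⟨q, (simulate_low hn).2 ?_, hq⟩
      rwa [hm.1.set_eq hn, hm.1.opt_eq (by omega)] at hm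
    · exact (simulate_low hn).2 (hstep.opp_step ho hp (legal_low hE hn q) hq
        (cutSet_low hn.le _) (cutOpt_low (by omega) _))
  · rw [simulate_low le_rfl] at hp
    have := H.base_step hnN p hp
    refine ⟨fun ho => ?_, fun ho q hq => simulate_announce.2 (this.2 ho q hq)⟩
    obtain ⟨q, hq, hb⟩ := this.1 ho
    exact ⟨q, simulate_announce.2 hb, hq⟩
  · have hn' : K + 1 ≤ n := hn
    obtain ⟨hb, hp'⟩ := hp.2 hn' _ rfl
    by_cases hex : ∃ (u : Node T) (hu : u.1 ≤ n), T.res hu p = u.2 ∧ u.2 ∈ E u.1 ∧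
        u ∈ V (T.res hn' p)
    · obtain ⟨u, hu, hpu, huE, huV⟩ := hex
      have hn2 : K + 2 ≤ n := (hE.level _ _ huE).2.trans hu
      have hm := (hp' hn2).1 u hu hpu huE huV
      have key : ∀ q, T.res n.le_succ q = p → Mem S (n + 1) q (Zu (T.res hn' p) u) (some u) →
          q ∈ simulate S base V Zn Zu (n + 1) := by
        rintro q rfl hq
        rw [T.res_res] at hb hpu huV hq
        exact simulate_switched hE (by omega) hb (hu.trans n.le_succ) hpu huE huV hq
      refine ⟨fun ho => ?_, fun ho q hq => key q hq ?_⟩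
      · obtain ⟨q, Z, o, hq, hZ, ho, hqm⟩ := hstep.own_step ho hm
        rw [cutSet_high hn'] at hZ
        rw [cutOpt_high hn2] at ho
        subst hZ ho
        exact ⟨q, key q hq hqm, hq⟩
      · refine hstep.opp_step ho hm (legal_some (by omega) (hm.1.of_some u rfl).1 huE
          ⟨fun h => by omega, fun h => ?_⟩) hq (cutSet_high hn' _) (cutOpt_high hn2 _)
        rw [← hpu, ← hq, T.res_res]
    · push Not at hex
      have hm : Mem S n p (Zn (T.res hn' p)) none := by
        rcases hn'.eq_or_lt with rfl | hn2
        · rw [T.res_refl] at hb ⊢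
          exact H.base_mem p hb
        · exact (hp' hn2).2 hex
      have hK := H.even
      refine ⟨fun ho => ?_, fun ho q hq => ?_⟩
      · obtain ⟨q, Z, o, hq, hZ, hopt, hqm⟩ := hstep.own_step ho hm
        rw [cutSet_high hn'] at hZ
        subst hZ
        refine ⟨q, H.succ_mem hn' hnN hb hex hq fun _ => ?_, hq⟩
        rcases hn'.eq_or_lt with rfl | hn2
        · rcases o with _ | u
          · exact hqm
          · refine (H.opt_none ?_ _ hb _ _ hqm).elim
            cases b
            · rw [own_false] at ho
              omega
            · rfl
        · rw [cutOpt_high hn2] at hopt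
          rwa [← hopt]
      · refine H.succ_mem hn' hnN hb hex hq fun hqV => ?_
        refine hstep.opp_step ho hm ?_ hq (cutSet_high hn' _) ?_
        · have hpE : p ∉ E n := by
            intro hpE
            have hlev := (hE.level _ _ hpE).1
            have hbt : b = true := by
              cases b
              · exact (ho hlev).elim
              · rfl
            exact hex ⟨n, p⟩ le_rfl (T.res_refl p) hpE
              (H.exit_true hbt _ _ ((hm.1.of_none rfl).2 hpE))
          refine ⟨fun h => by omega, fun _ => rfl, fun u hu => (by cases hu), fun _ => ⟨?_, ?_⟩⟩
          · intro m hmn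
            rcases (Nat.lt_succ_iff.1 hmn).eq_or_lt with rfl | hmn'
            · rwa [hq]
            · have := (hm.1.of_none rfl).1 m hmn'
              rwa [← hq, T.res_res] at this
          · intro hqE hqZ
            have hlev := (hE.level _ _ hqE).1
            have hbf : b = false := by
              cases b
              · rfl
              · refine (ho ?_).elim
                rw [own_true]
                omega
            exact hqV _ rfl hqE (H.exit_false hbf _ _ hqZ)
        · unfold cutOpt
          split_ifs <;> rfl

lemma Simulates.lift {base V Zn Zu} (H : ∀ N, Simulates b S N base V Zn Zu) (x : Play T)
    (hx : ∀ n, x.pos n ∈ simulate S base V Zn Zu n) :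
    ∃ y : Play (unravelTree hE), (∀ n, y.pos n ∈ S n) ∧ (unravelHom hE).play y = x := by
  suffices ∃ Z o, ∀ n, Mem S n (x.pos n) (cutSet K n Z) (cutOpt K n o) by
    obtain ⟨Z, o, h⟩ := this
    refine ⟨⟨fun n => ⟨_, (h n).choose⟩, fun hnm => ?_⟩, fun n => (h n).choose_spec, rfl⟩
    exact Subtype.ext (Prod.ext (x.res_pos hnm) (Prod.ext (cutSet_cutSet hnm _)
      (cutOpt_cutOpt hnm _)))
  have hb : base (x.pos (K + 1)) := simulate_announce.1 (hx (K + 1))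
  have hlow : ∀ n ≤ K, ∀ Z o, Mem S n (x.pos n) (cutSet K n Z) (cutOpt K n o) := by
    intro n hn Z o
    rw [cutSet_low hn, cutOpt_low (by omega)]
    exact (simulate_low hn).1 (hx n)
  by_cases hex : ∃ l, x.pos l ∈ E l ∧ ⟨l, x.pos l⟩ ∈ V (x.pos (K + 1))
  · obtain ⟨l, hlE, hlV⟩ := hex
    refine ⟨Zu (x.pos (K + 1)) ⟨l, x.pos l⟩, some ⟨l, x.pos l⟩, fun n => ?_⟩
    rcases le_or_gt n K with hn | hn
    · exact hlow n hn _ _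
    · rw [cutSet_high hn]
      rcases (show K + 1 ≤ n from hn).eq_or_lt with rfl | hn2
      · rw [cutOpt_low le_rfl]
        exact (H 0).switch_mem _ hb _ hlV
      · rw [cutOpt_high hn2]
        rcases le_total n l with hnl | hln
        · have := (H n).forced hb hlV hlE (fun h => x.res_pos h) hn2 le_rfl hnl
          rwa [x.res_pos] at this
        · exact (((hx n).2 hn _ (x.res_pos _)).2 hn2).1 _ hln (x.res_pos _) hlE hlV
  · push Not at hex
    refine ⟨Zn (x.pos (K + 1)), none, fun n => ?_⟩
    rcases le_or_gt n K with hn | hn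
    · exact hlow n hn _ _
    · rw [cutSet_high hn]
      have : cutOpt K n (none : Option (Node T)) = none := by
        unfold cutOpt
        split_ifs <;> rfl
      rw [this]
      rcases (show K + 1 ≤ n from hn).eq_or_lt with rfl | hn2
      · exact (H 0).base_mem _ hb
      · refine (((hx n).2 hn _ (x.res_pos _)).2 hn2).2 ?_
        rintro ⟨l, u⟩ hu huv huE
        rw [x.res_pos] at huv
        dsimp only at huv huE
        subst huv
        exact hex l huE

lemma simulate_congr {S' : Family (unravelTree hE)} {base V Zn Zu base' V' Zn' Zu'} {n : ℕ}
    (hS : S n = S' n) (hb : K + 1 ≤ n → base = base')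
    (hV : K + 2 ≤ n → V = V' ∧ Zn = Zn' ∧ Zu = Zu') :
    simulate S base V Zn Zu n = simulate S' base' V' Zn' Zu' n := by
  have hM : Mem S n = Mem S' n := by
    unfold Mem
    rw [hS]
  rcases le_or_gt n K with hn | hn
  · ext p
    rw [simulate_low hn, simulate_low hn, hM]
  · obtain rfl := hb hn
    rcases (show K + 1 ≤ n from hn).eq_or_lt with rfl | hn2
    · ext p
      rw [simulate_announce, simulate_announce]
    · obtain ⟨rfl, rfl, rfl⟩ := hV hn2
      unfold simulate
      rw [hM]

/-- The set announced by a strategy of the first player. -/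
noncomputable def announced (S : Family (unravelTree hE)) (q : T.Pos (K + 1)) : Set (Node T) :=
  Classical.epsilon fun Z => Mem S (K + 1) q Z none

/-- A strategy of the second player chooses `u` when the first player announces `Z`. -/
def Chooses (S : Family (unravelTree hE)) (u : Node T) (Z : Set (Node T)) : Prop :=
  ∃ h : K + 2 ≤ u.1, Mem S (K + 2) (T.res h u.2) Z (some u)

/-- The transfer of strategies from the auxiliary game. -/
noncomputable def unravelTrans (hE : IsExit E K) :
    Bool → Family (unravelTree hE) → Family T
  | false, S => simulate S (fun q => Mem S (K + 1) q (announced S q) none) (announced S)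
      (announced S) fun q _ => announced S q
  | true, S => simulate S (fun q => ∀ Z, Mem S (K + 1) q Z none) (fun _ => {u | ∃ Z, Chooses S u Z})
      (fun _ => {u | ∃ Z, Chooses S u Z}ᶜ) fun _ u => Classical.epsilon (Chooses S u)

lemma simulates_false (hK : K % 2 = 0) {N : ℕ} (hS : IsStratTo false S N) :
    Simulates false S N (fun q => Mem S (K + 1) q (announced S q) none) (announced S)
      (announced S) fun q _ => announced S q where
  even := hK
  strat := hS
  base_mem _ hq := hq
  base_step hN p hp := by
    refine ⟨fun ho => ?_, fun ho => (ho hK).elim⟩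
    obtain ⟨q, Z, o, hq, -, -, hm⟩ := (hS.2 K hN).own_step ho hp
    rw [hm.1.opt_eq le_rfl] at hm
    exact ⟨q, hq, Classical.epsilon_spec (p := fun Z => Mem S (K + 1) q Z none) ⟨Z, hm⟩⟩
  switch_mem _ hq _ _ := hq
  switch hN q hq u hu huE huq h := by
    refine (hS.2 (K + 1) hN).opp_step ?_ hq (legal_some le_rfl hu huE ⟨fun _ => rfl, fun h' => ?_⟩)
      ?_ (cutSet_high le_rfl _) (cutOpt_low le_rfl _)
    · rw [own_false]
      omega
    · rw [T.res_res, T.res_refl]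
    · rw [T.res_res, huq]
  opt_none h := by cases h
  exit_true h := by cases h
  exit_false _ _ _ h := h

lemma simulates_true (hK : K % 2 = 0) {N : ℕ} (hS : IsStratTo true S N) :
    Simulates true S N (fun q => ∀ Z, Mem S (K + 1) q Z none) (fun _ => {u | ∃ Z, Chooses S u Z})
      (fun _ => {u | ∃ Z, Chooses S u Z}ᶜ) fun _ u => Classical.epsilon (Chooses S u) where
  even := hK
  strat := hS
  base_mem _ hq := hq _
  base_step hN p hp := by
    refine ⟨fun ho => ?_, fun ho q hq Z => ?_⟩
    · rw [own_true] at ho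
      omega
    · exact (hS.2 K hN).opp_step ho hp (legal_announce hE q Z) hq (cutSet_low le_rfl _)
        (cutOpt_low K.le_succ _)
  switch_mem _ hq _ _ := hq _
  switch _ _ _ _ hu _ _ _ := (Classical.epsilon_spec hu).choose_spec
  opt_none _ q _ p u hm := by
    obtain ⟨h₁, h₂, h₃⟩ := hm.1.of_some u rfl
    have hl := (hE.level _ _ h₂).2
    refine h₁ ⟨{u | ∃ Z, Chooses S u Z}ᶜ, hl, ?_⟩
    rwa [h₃.1 hl]
  exit_true _ _ _ h := not_not.1 h
  exit_false h := by cases h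

lemma unravelTrans_low {n : ℕ} (hn : n ≤ K) {p : T.Pos n} :
    p ∈ unravelTrans hE b S n ↔ Mem S n p ∅ none := by
  cases b <;> exact simulate_low hn

lemma unravelHom_bijective {n : ℕ} (hn : n ≤ K) :
    Function.Bijective ((unravelHom hE).map n) := by
  refine ⟨?_, fun p => ⟨⟨(p, ∅, none), legal_low hE hn p⟩, rfl⟩⟩
  rintro ⟨⟨p, Z, o⟩, h⟩ ⟨⟨p', Z', o'⟩, h'⟩ hpp
  obtain rfl : p = p' := hpp
  have h₁ := h.set_eq hn
  have h₂ := h.opt_eq (by omega)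
  have h₃ := h'.set_eq hn
  have h₄ := h'.opt_eq (by omega)
  dsimp only at h₁ h₂ h₃ h₄
  subst h₁ h₂ h₃ h₄
  rfl

/-- The auxiliary game covers the original one. -/
noncomputable def unravelCovering (hE : IsExit E K) (hK : K % 2 = 0) {k : ℕ} (hk : k ≤ K) :
    Covering k (unravelTree hE) T where
  hom := unravelHom hE
  bijective _ hn := unravelHom_bijective (hn.trans hk)
  trans := unravelTrans hE
  trans_local b n S S' h := by
    have hM : ∀ m ≤ n, Mem S m = Mem S' m := by
      intro m hm
      unfold Mem
      rw [h m hm]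
    cases b
    · have : K + 1 ≤ n → announced S = announced S' := by
        intro hn
        unfold announced
        rw [hM _ hn]
      refine simulate_congr (h n le_rfl) (fun hn => ?_) fun hn => ?_
      · rw [this hn, hM _ hn]
      · rw [this (by omega)]
        exact ⟨rfl, rfl, rfl⟩
    · refine simulate_congr (h n le_rfl) (fun hn => ?_) fun hn => ?_
      · rw [hM _ hn]
      · have : Chooses S = Chooses S' := by
          unfold Chooses
          rw [hM _ hn]
        rw [this]
        exact ⟨rfl, rfl, rfl⟩
  trans_strat b S N hS := by
    refine ⟨Set.eq_univ_of_forall fun p => (unravelTrans_low K.zero_le).2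
      ⟨legal_low hE K.zero_le p, hS.1 ▸ Set.mem_univ _⟩, fun n hn => ?_⟩
    cases b
    · exact (simulates_false hK hS).isStratAt hn
    · exact (simulates_true hK hS).isStratAt hn
  trans_low b S n hn := by
    ext p
    rw [unravelTrans_low (hn.trans hk)]
    constructor
    · rintro ⟨h, hp⟩
      exact ⟨_, hp, rfl⟩
    · rintro ⟨⟨⟨p, Z, o⟩, h⟩, hp, rfl⟩
      have h₁ := h.set_eq (hn.trans hk)
      have h₂ := h.opt_eq (by omega)
      dsimp only at h₁ h₂
      subst h₁ h₂
      exact ⟨h, hp⟩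
  lift b S hS x hx := by
    cases b
    · exact Simulates.lift (fun N => simulates_false hK (hS N)) x hx
    · exact Simulates.lift (fun N => simulates_true hK (hS N)) x hx

lemma unravel_exit_iff (hE : IsExit E K) (x : Play (unravelTree hE)) :
    (∃ n, ((unravelHom hE).play x).pos n ∈ E n) ↔ (x.pos (K + 2)).1.2.2 ≠ none := by
  have hopt : ∀ {n m} (h : n ≤ m), (x.pos n).1.2.2 = cutOpt K n (x.pos m).1.2.2 := by
    intro n m h
    rw [← x.res_pos h]
    rfl
  have hpos : ∀ {n m} (h : n ≤ m), (x.pos n).1.1 = T.res h (x.pos m).1.1 := by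
    intro n m h
    rw [← x.res_pos h]
    rfl
  constructor
  · rintro ⟨n, hn⟩ h
    have hn : (x.pos n).1.1 ∈ E n := hn
    have hl := (hE.level _ _ hn).2
    have := hopt (show K + 2 ≤ n + 1 by omega)
    rw [h, cutOpt_high le_rfl] at this
    refine ((x.pos (n + 1)).2.of_none this.symm).1 n n.lt_succ_self ?_
    rwa [← hpos]
  · intro h
    obtain ⟨u, hu⟩ := Option.ne_none_iff_exists'.1 h
    have hl := (hE.level _ _ ((x.pos (K + 2)).2.of_some u hu).2.1).2
    have := hopt hl
    rw [hu, cutOpt_high le_rfl] at this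
    obtain ⟨-, h₁, h₂⟩ := (x.pos u.1).2.of_some u this.symm
    refine ⟨u.1, ?_⟩
    have := h₂.1 le_rfl
    rw [T.res_refl] at this
    change (x.pos u.1).1.1 ∈ E u.1
    rwa [← this]

end Unravel

/-- Open sets of plays can be unraveled. -/
theorem exists_covering_of_open (T : GameTree) (O : Family T) (k : ℕ) :
    ∃ (T' : GameTree) (C : Covering k T' T) (N : ℕ) (D : Set (T'.Pos N)),
      ∀ x : Play T', (∃ n, (C.hom.play x).pos n ∈ O n) ↔ x.pos N ∈ D := by
  set K := 2 * k with hK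
  let Bad : Family T := fun n => {p | ∃ j, ∃ h : j ≤ n, T.res h p ∈ O j}
  let E : Family T := fun n => {p | (n % 2 = 0 ∧ K + 2 ≤ n) ∧ p ∈ Bad n ∧
    ∀ l (h : l < n), l % 2 = 0 ∧ K + 2 ≤ l → T.res h.le p ∉ Bad l}
  have hE : IsExit E K := by
    refine ⟨fun n p hp => hp.1, fun l m h p hp hp' => hp.2.2 l h hp'.1 hp'.2.1⟩
  refine ⟨_, unravelCovering hE (by omega) (by omega), K + 2, {y | y.1.2.2 ≠ none}, fun x => ?_⟩
  rw [Set.mem_ofPred_eq, ← unravel_exit_iff]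
  change (∃ n, ((unravelHom hE).play x).pos n ∈ O n) ↔ _
  generalize (unravelHom hE).play x = z
  constructor
  · rintro ⟨j, hj⟩
    classical
    have hex : ∃ n, (n % 2 = 0 ∧ K + 2 ≤ n) ∧ z.pos n ∈ Bad n := by
      refine ⟨2 * (j + K + 1), by omega, j, by omega, ?_⟩
      rwa [z.res_pos]
    refine ⟨Nat.find hex, (Nat.find_spec hex).1, (Nat.find_spec hex).2, fun l hl hl' hlB => ?_⟩
    rw [z.res_pos] at hlB
    exact Nat.find_min hex hl ⟨hl', hlB⟩
  · rintro ⟨n, -, ⟨j, h, hj⟩, -⟩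
    rw [z.res_pos] at hj
    exact ⟨j, hj⟩

/-- The game tree in which both players play arbitrary natural numbers. -/
def baseTree : GameTree where
  Pos n := Fin n → ℕ
  res h p := fun i => p (Fin.castLE h i)
  res_refl _ := rfl
  res_res _ _ _ := rfl

instance : Subsingleton (baseTree.Pos 0) := inferInstanceAs (Subsingleton (Fin 0 → ℕ))

/-- The point of Baire space produced by a play. -/
def basePoint (x : Play baseTree) : ℕ → ℕ := fun n => x.pos (n + 1) (Fin.last n)

/-- The play producing a given point of Baire space. -/
def basePlay (z : ℕ → ℕ) : Play baseTree where
  pos _ := fun i => z i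
  res_pos _ := rfl

lemma basePlay_basePoint (x : Play baseTree) : basePlay (basePoint x) = x := by
  ext n
  funext i
  exact (congrFun (x.res_pos (show (i : ℕ) + 1 ≤ n from i.2)) (Fin.last i)).symm

lemma exists_pos_iff_of_isOpen {A : Set (ℕ → ℕ)} (hA : IsOpen A) (x : Play baseTree) :
    (∃ n, ∀ z, (basePlay z).pos n = x.pos n → z ∈ A) ↔ basePoint x ∈ A := by
  constructor
  · rintro ⟨n, hn⟩
    apply hn
    rw [basePlay_basePoint]
  · intro hx
    obtain ⟨I, u, hu, hIA⟩ := isOpen_pi_iff.1 hA _ hx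
    obtain ⟨n, hn⟩ := I.exists_nat_subset_range
    refine ⟨n, fun z hz => hIA fun i hi => ?_⟩
    rw [← basePlay_basePoint x] at hz
    have hzi : z i = basePoint x i := congrFun hz ⟨i, Finset.mem_range.1 (hn hi)⟩
    rw [hzi]
    exact (hu i hi).2

/-- In every game mapping to the base game, the set `A` can be unraveled. -/
def Unravelable (A : Set (ℕ → ℕ)) : Prop :=
  ∀ (T : GameTree) (f : Hom T baseTree) (k : ℕ),
    ∃ (T' : GameTree) (C : Covering k T' T) (N : ℕ) (D : Set (T'.Pos N)),
      ∀ x : Play T', basePoint (f.play (C.hom.play x)) ∈ A ↔ x.pos N ∈ D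

lemma Unravelable.compl {A : Set (ℕ → ℕ)} (hA : Unravelable A) : Unravelable Aᶜ := by
  intro T f k
  obtain ⟨T', C, N, D, h⟩ := hA T f k
  exact ⟨T', C, N, Dᶜ, fun x => not_congr (h x)⟩

lemma unravelable_of_isOpen {A : Set (ℕ → ℕ)} (hA : IsOpen A) : Unravelable A := by
  intro T f k
  obtain ⟨T', C, N, D, h⟩ := exists_covering_of_open T
    (fun n => {p | ∀ z, (basePlay z).pos n = f.map n p → z ∈ A}) k
  refine ⟨T', C, N, D, fun x => ?_⟩
  rw [← h x]
  exact (exists_pos_iff_of_isOpen hA _).symm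

lemma Unravelable.iUnion {A : ℕ → Set (ℕ → ℕ)} (hA : ∀ i, Unravelable (A i)) :
    Unravelable (⋃ i, A i) := by
  intro T f k
  choose T' C N D h using hA
  let s : ℕ → Σ T : GameTree, Hom T baseTree := fun i => Nat.rec ⟨T, f⟩
    (fun i s => ⟨T' i s.1 s.2 (k + i), s.2.comp (C i s.1 s.2 (k + i)).hom⟩) i
  let C' : ∀ i, Covering (k + i) (s (i + 1)).1 (s i).1 := fun i => C i (s i).1 (s i).2 (k + i)
  have hs : ∀ i, (s (i + 1)).2 = (s i).2.comp (C' i).hom := fun i => rfl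
  let L := limitTree (T := fun i => (s i).1) fun i => (C' i).hom
  let Λ : Covering k L T := limitCovering (T := fun i => (s i).1) C'
  let π : ∀ i, Hom L (s i).1 := limitProj (T := fun i => (s i).1) fun i => (C' i).hom
  have hL : ∀ i (x : Play L), (s i).2.play ((π i).play x) = f.play (Λ.hom.play x) := by
    intro i x
    induction i with
    | zero => rfl
    | succ i ih =>
      rw [← ih, hs]
      ext n
      exact congrArg ((s i).2.map n) ((x.pos n).2 i)
  have hD : ∀ i (x : Play L), basePoint (f.play (Λ.hom.play x)) ∈ A i ↔
      (x.pos (N i (s i).1 (s i).2 (k + i))).1 (i + 1) ∈ D i (s i).1 (s i).2 (k + i) := by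
    intro i x
    rw [← hL (i + 1) x]
    exact h i (s i).1 (s i).2 (k + i) ((π (i + 1)).play x)
  obtain ⟨T'', C'', N'', D'', h''⟩ := exists_covering_of_open L
    (fun n => {p | ∃ i, ∃ e : N i (s i).1 (s i).2 (k + i) = n,
      (L.res e.le p).1 (i + 1) ∈ D i (s i).1 (s i).2 (k + i)}) k
  refine ⟨T'', Λ.comp C'', N'', D'', fun x => ?_⟩
  rw [← h'' x, Set.mem_iUnion]
  change (∃ i, basePoint (f.play (Λ.hom.play (C''.hom.play x))) ∈ A i) ↔ _
  generalize C''.hom.play x = y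
  constructor
  · rintro ⟨i, hi⟩
    refine ⟨_, i, rfl, ?_⟩
    rw [L.res_refl]
    exact (hD i y).1 hi
  · rintro ⟨n, i, rfl, hi⟩
    rw [L.res_refl] at hi
    exact ⟨i, (hD i y).2 hi⟩

lemma unravelable_of_measurableSet {A : Set (ℕ → ℕ)} (hA : MeasurableSet A) : Unravelable A :=
  MeasurableSet.induction_on_open (fun _ h => unravelable_of_isOpen h) (fun _ _ h => h.compl)
    (fun _ _ _ h => Unravelable.iUnion h) A hA

/-- **Borel determinacy** for games on the natural numbers. -/
theorem borel_determinacy {A : Set (ℕ → ℕ)} (hA : MeasurableSet A) :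
    ∃ (b : Bool) (S : Family baseTree), (∀ N, IsStratTo b S N) ∧
      ∀ z, (∀ n, (basePlay z).pos n ∈ S n) → (z ∈ A ↔ b = false) := by
  obtain ⟨T, C, N, D, h⟩ := unravelable_of_measurableSet hA baseTree
    ⟨fun _ p => p, fun _ _ => rfl⟩ 0
  have : Subsingleton (T.Pos 0) := (C.bijective 0 le_rfl).1.subsingleton
  obtain ⟨p, -⟩ := (C.bijective 0 le_rfl).2 ((basePlay 0).pos 0)
  have main : ∀ b, Wins b {x | x.pos N ∈ D ↔ b = false} p → ∃ (S : Family baseTree),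
      (∀ N, IsStratTo b S N) ∧
      ∀ z, (∀ n, (basePlay z).pos n ∈ S n) → (z ∈ A ↔ b = false) := by
    intro b hb
    obtain ⟨S, hS, hW⟩ := exists_strategy_of_wins hb
    refine ⟨C.trans b S, fun N => C.trans_strat b S N (hS N), fun z hz => ?_⟩
    obtain ⟨y, hy, hyz⟩ := C.lift b S hS _ hz
    have := h y
    rw [hyz] at this
    exact this.trans (hW y hy)
  rcases wins_or_wins N D p with hp | hp
  · exact ⟨false, main false (by simpa using hp)⟩
  · exact ⟨true, main true (by simpa using hp)⟩

/-- A strategy on the base tree can be played against the moves `x` of the opponent by a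
continuous function of `x`. -/
lemma exists_continuous_response {b : Bool} {S : Family baseTree} (hS : ∀ N, IsStratTo b S N) :
    ∃ F : (ℕ → ℕ) → (ℕ → ℕ), Continuous F ∧ (∀ x n, (basePlay (F x)).pos n ∈ S n) ∧
      ∀ x n, ¬ Own b n → F x n = x (n / 2) := by
  classical
  have hstep : ∀ n, IsStratAt b S n := fun n => (hS (n + 1)).2 n n.lt_succ_self
  have hmove : ∀ n (p : baseTree.Pos n) (a : ℕ), ∃ c : ℕ,
      (p ∈ S n → (Fin.snoc p c : Fin (n + 1) → ℕ) ∈ S (n + 1)) ∧ (¬ Own b n → c = a) := by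
    intro n p a
    by_cases hp : p ∈ S n
    · by_cases ho : Own b n
      · obtain ⟨q, hq, rfl⟩ := (hstep n p hp).1 ho
        refine ⟨q (Fin.last n), fun _ => ?_, fun h => (h ho).elim⟩
        have e : (Fin.snoc (baseTree.res n.le_succ q) (q (Fin.last n)) : Fin (n + 1) → ℕ) = q :=
          Fin.snoc_init_self (α := fun _ => ℕ) q
        rw [e]
        exact hq
      · refine ⟨a, fun _ => (hstep n p hp).2 ho _ ?_, fun _ => rfl⟩
        exact Fin.init_snoc (α := fun _ => ℕ) a p
    · exact ⟨a, fun h => (hp h).elim, fun _ => rfl⟩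
  choose c hc hca using hmove
  let P : (ℕ → ℕ) → ∀ n, Fin n → ℕ := fun x n => Nat.rec (fun i => i.elim0)
    (fun n p => Fin.snoc p (c n p (x (n / 2)))) n
  let F : (ℕ → ℕ) → (ℕ → ℕ) := fun x n => c n (P x n) (x (n / 2))
  have hP : ∀ x n, P x (n + 1) = Fin.snoc (P x n) (F x n) := fun x n => rfl
  have hPF : ∀ x n, (basePlay (F x)).pos n = P x n := by
    intro x n
    induction n with
    | zero => exact funext fun i => i.elim0
    | succ n ih =>
      rw [hP, ← ih]
      exact (Fin.snoc_init_self (α := fun _ => ℕ) fun i : Fin (n + 1) => F x i).symm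
  have hPc : ∀ n, IsLocallyConstant fun x => P x n := by
    intro n
    induction n with
    | zero => exact IsLocallyConstant.const _
    | succ n ih =>
      exact ih.comp₂ ((IsLocallyConstant.iff_continuous _).2 (continuous_apply (n / 2)))
        fun (p : Fin n → ℕ) (a : ℕ) => (Fin.snoc (α := fun _ => ℕ) p (c n p a) : Fin (n + 1) → ℕ)
  refine ⟨F, continuous_pi fun n => ?_, fun x n => ?_, fun x n ho => hca n _ _ ho⟩
  · exact ((hPc n).comp₂ ((IsLocallyConstant.iff_continuous _).2 (continuous_apply (n / 2)))
      (c n)).continuous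
  · rw [hPF]
    induction n with
    | zero => exact (hS 0).1 ▸ Set.mem_univ _
    | succ n ih => exact hc n _ _ ih

end BorelGame

/-- For Borel sets `D, E₀, E₁ ⊆ ω^ω`, either there is a continuous `φ` with
`φ(D) ⊆ E₀` and `φ(Dᶜ) ⊆ E₁`, or there is a continuous `ψ` with `ψ(E₀) ⊆ Dᶜ` and
`ψ(E₁) ⊆ D`. -/
theorem borel_dichotomy (D E₀ E₁ : Set NNSpace) (hD : MeasurableSet D)
    (hE₀ : MeasurableSet E₀) (hE₁ : MeasurableSet E₁) :
    (∃ φ : NNSpace → NNSpace, Continuous φ ∧ φ '' D ⊆ E₀ ∧ φ '' Dᶜ ⊆ E₁) ∨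
    (∃ ψ : NNSpace → NNSpace, Continuous ψ ∧ ψ '' E₀ ⊆ Dᶜ ∧ ψ '' E₁ ⊆ D) := by
  let ev : NNSpace → NNSpace := fun z n => z (2 * n)
  let od : NNSpace → NNSpace := fun z n => z (2 * n + 1)
  have hev : Continuous ev := continuous_pi fun n => continuous_apply _
  have hod : Continuous od := continuous_pi fun n => continuous_apply _
  let A : Set NNSpace := {z | (ev z ∈ D ∧ od z ∉ E₀) ∨ (ev z ∉ D ∧ od z ∉ E₁)}
  have hA : MeasurableSet A :=
    ((hev.measurable hD).inter (hod.measurable hE₀).compl).union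
      ((hev.measurable hD).compl.inter (hod.measurable hE₁).compl)
  obtain ⟨b, S, hS, hW⟩ := BorelGame.borel_determinacy hA
  obtain ⟨F, hF, hFS, hFx⟩ := BorelGame.exists_continuous_response hS
  have hFA : ∀ x, F x ∈ A ↔ b = false := fun x => hW _ (hFS x)
  cases b
  · right
    have hx : ∀ x, od (F x) = x := by
      intro x
      funext n
      have := hFx x (2 * n + 1) (by rw [BorelGame.own_false]; omega)
      rwa [show (2 * n + 1) / 2 = n by omega] at this
    have hxA : ∀ x, (ev (F x) ∈ D ∧ x ∉ E₀) ∨ (ev (F x) ∉ D ∧ x ∉ E₁) := by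
      intro x
      have : F x ∈ A := (hFA x).2 rfl
      simpa only [A, Set.mem_ofPred_eq, hx] using this
    refine ⟨fun x => ev (F x), hev.comp hF, ?_, ?_⟩
    · rintro _ ⟨x, hxE, rfl⟩
      have := hxA x
      simp only [Set.mem_compl_iff]
      tauto
    · rintro _ ⟨x, hxE, rfl⟩
      have := hxA x
      tauto
  · left
    have hx : ∀ x, ev (F x) = x := by
      intro x
      funext n
      have := hFx x (2 * n) (by rw [BorelGame.own_true]; omega)
      rwa [show 2 * n / 2 = n by omega] at this
    have hxA : ∀ x, ¬ ((x ∈ D ∧ od (F x) ∉ E₀) ∨ (x ∉ D ∧ od (F x) ∉ E₁)) := by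
      intro x
      have : F x ∉ A := fun h => by simpa using (hFA x).1 h
      simpa only [A, Set.mem_ofPred_eq, hx] using this
    refine ⟨fun x => od (F x), hod.comp hF, ?_, ?_⟩
    · rintro _ ⟨x, hxD, rfl⟩
      have := hxA x
      tauto
    · rintro _ ⟨x, hxD, rfl⟩
      have := hxA x
      rw [Set.mem_compl_iff] at hxD
      tauto
end
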